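/- arXiv:1308.6696 — 3 statements merged into one kernel-verified Lean document; each statement's English description precedes it below -/
import Mathlib

section
/- Let r : ℕ → ℕ satisfy r(n) ≥ 2 for all n and r(n) = o(ln n / ln ln n), i.e. (r(n)·ln ln n)/ln n → 0 as n → ∞. For r ≥ 2 set q'(r) = (r!)^{1/r} / (2^{1/r} · (1 − 1/r)^{(r−1)/r} · r^{(r−2)/r}). Then for every ε with 0 < ε < 1 there exists n₀ such that for all n ≥ n₀: every n-uniform hypergraph whose chromatic number is greater than r(n) has at least (1−ε) · q'(r(n)) · (n/ln n)^{(r(n)−1)/r(n)} · r(n)^{n−1} edges; that is, m(n, r(n)) ≥ (1−ε) · q'(r(n)) · (n/ln n)^{(r(n)−1)/r(n)} · r(n)^{n−1}. -/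
/-- `q'(r) = (r!)^{1/r} / (2^{1/r} · (1 − 1/r)^{(r−1)/r} · r^{(r−2)/r})`. -/
noncomputable def qprime (r : ℕ) : ℝ :=
  (Nat.factorial r : ℝ) ^ ((1 : ℝ) / r) /
    ((2 : ℝ) ^ ((1 : ℝ) / r) * (1 - 1 / (r : ℝ)) ^ (((r : ℝ) - 1) / r) *
      (r : ℝ) ^ (((r : ℝ) - 2) / r))


namespace HG
open Finset

/-- weight of a label -/
noncomputable def mu (D d : ℝ) (N x : ℕ) : ℝ := if x % (N+1) = 0 then D else d

lemma mu_nonneg {D d : ℝ} (hD : 0 ≤ D) (hd : 0 ≤ d) (N x : ℕ) : 0 ≤ mu D d N x := by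
  unfold mu; split_ifs <;> assumption

lemma sum_block (D d : ℝ) (N i : ℕ) :
    ∑ x ∈ range (i*(N+1)), mu D d N x = i * (D + N*d) := by
  induction i with
  | zero => simp
  | succ i ih =>
    rw [Nat.succ_mul, sum_range_add, ih, sum_range_succ']
    have h1 : ∀ k ∈ range N, mu D d N (i*(N+1)+(k+1)) = d := by
      intro k hk
      have hk' := mem_range.1 hk
      unfold mu
      rw [if_neg]
      rw [Nat.mul_add_mod', Nat.mod_eq_of_lt (by omega)]
      omega
    rw [sum_congr rfl h1]
    have h2 : mu D d N (i*(N+1)+0) = D := by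
      unfold mu; simp
    rw [h2]; simp; ring

lemma mu_mul (D d : ℝ) (N i : ℕ) : mu D d N (i*(N+1)) = D := by
  unfold mu; simp

lemma mu_delta (D d : ℝ) (N i x : ℕ) (h1 : i*(N+1) < x) (h2 : x ≤ i*(N+1)+N) :
    mu D d N x = d := by
  unfold mu
  obtain ⟨y, rfl⟩ := Nat.exists_eq_add_of_lt h1
  rw [if_neg]
  rw [add_assoc, Nat.mul_add_mod', Nat.mod_eq_of_lt (by omega)]
  omega

/-- label set -/
def X (R N : ℕ) : Finset ℕ := range (R*(N+1)+1)

lemma sum_X (D d : ℝ) (R N : ℕ) :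
    ∑ x ∈ X R N, mu D d N x = (R+1)*D + R*N*d := by
  unfold X
  rw [sum_range_succ, sum_block, mu_mul]; ring

lemma Icc_sum (D d : ℝ) (N a b : ℕ) (h : a ≤ b) :
    ∑ x ∈ Icc a b, mu D d N x =
      ∑ x ∈ range b, mu D d N x - ∑ x ∈ range a, mu D d N x + mu D d N b := by
  have : Icc a b = Ico a (b+1) := by ext; simp only [mem_Icc, mem_Ico]; omega
  rw [this, sum_Ico_eq_sub _ (by omega), sum_range_succ]; ring

/-- total length of the intervals of a chain -/
lemma chain_sum (D d : ℝ) (N m j : ℕ) (x : ℕ → ℕ) (h0 : x 0 = j*(N+1))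
    (hm : x (m+1) = (j+m)*(N+1))
    (hx : ∀ t < m, (j+t)*(N+1) < x (t+1) ∧ x (t+1) ≤ (j+t)*(N+1)+N)
    (hmono : ∀ t ≤ m, x t ≤ x (t+1)) :
    ∑ t ∈ range (m+1), ∑ z ∈ Icc (x t) (x (t+1)), mu D d N z = (m+1)*D + m*(N*d) + m*d := by
  have h1 : ∀ t ∈ range (m+1), ∑ z ∈ Icc (x t) (x (t+1)), mu D d N z =
      (∑ z ∈ range (x (t+1)), mu D d N z - ∑ z ∈ range (x t), mu D d N z)
        + mu D d N (x (t+1)) := fun t ht => Icc_sum _ _ _ _ _ (hmono t (by simp at ht; omega))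
  rw [sum_congr rfl h1, sum_add_distrib,
    sum_range_sub (fun t => ∑ z ∈ range (x t), mu D d N z), h0, hm, sum_block, sum_block,
    sum_range_succ, hm, mu_mul]
  have h2 : ∀ t ∈ range m, mu D d N (x (t+1)) = d := fun t ht =>
    mu_delta _ _ _ (j+t) _ (hx t (mem_range.1 ht)).1 (hx t (mem_range.1 ht)).2
  rw [sum_congr rfl h2]
  simp; ring

lemma chain_mono (N m j : ℕ) (x : ℕ → ℕ) (h0 : x 0 = j*(N+1))
    (hm : x (m+1) = (j+m)*(N+1))
    (hx : ∀ t < m, (j+t)*(N+1) < x (t+1) ∧ x (t+1) ≤ (j+t)*(N+1)+N) :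
    ∀ t ≤ m, x t ≤ x (t+1) := by
  intro t ht
  have lo : (j+t)*(N+1) ≤ x (t+1) := by
    rcases Nat.lt_or_ge t m with h | h
    · exact (hx t h).1.le
    · have : t = m := le_antisymm ht h
      rw [this, hm]
  have hi : x t ≤ (j+t)*(N+1) := by
    rcases t with _ | t
    · rw [h0]; simp
    · have := (hx t (by omega)).2
      nlinarith
  exact hi.trans lo

lemma chain_len (D d : ℝ) (hD : 0 ≤ D) (hd : 0 ≤ d) (N m j : ℕ) (x : ℕ → ℕ) (h0 : x 0 = j*(N+1))
    (hm : x (m+1) = (j+m)*(N+1))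
    (hx : ∀ t < m, (j+t)*(N+1) < x (t+1) ∧ x (t+1) ≤ (j+t)*(N+1)+N) (t : ℕ) (ht : t ≤ m) :
    ∑ z ∈ Icc (x t) (x (t+1)), mu D d N z ≤ D + 2*(N*d) := by
  have hi : x (t+1) ≤ (j+t)*(N+1)+N := by
    rcases Nat.lt_or_ge t m with h | h
    · exact (hx t h).2
    · have : t = m := le_antisymm ht h
      rw [this, hm]; omega
  have lo : (j+t)*(N+1) ≤ x t + N := by
    rcases t with _ | t
    · rw [h0]; simp
    · have := (hx t (by omega)).1
      nlinarith
  set c := (j+t)*(N+1) with hc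
  have hsub : Icc (x t) (x (t+1)) ⊆ insert c (Icc (c-N) (c-1) ∪ Icc (c+1) (c+N)) := by
    intro z hz; simp at hz ⊢; omega
  have hval : ∀ z ∈ (Icc (c-N) (c-1) ∪ Icc (c+1) (c+N)).erase c, mu D d N z ≤ d := by
    intro z hz
    simp only [mem_erase, mem_union, mem_Icc] at hz
    unfold mu
    rw [if_neg]
    intro hdv
    obtain ⟨k, hk⟩ := Nat.dvd_of_mod_eq_zero hdv
    have hne : k ≠ j+t := by
      rintro rfl; apply hz.1; rw [hk, hc]; ring
    rcases Nat.lt_or_gt_of_ne hne with h | h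
    · have : (N+1)*(k+1) ≤ c := by rw [hc, mul_comm]; exact Nat.mul_le_mul_right _ h
      have : (N+1)*(k+1) = z + N + 1 := by rw [hk]; ring
      omega
    · have : c + (N+1) ≤ (N+1)*k := by
        rw [hc, mul_comm (N+1) k]; nlinarith [Nat.mul_le_mul_right (N+1) (show j+t+1 ≤ k from h)]
      omega
  calc _ ≤ ∑ z ∈ insert c (Icc (c-N) (c-1) ∪ Icc (c+1) (c+N)), mu D d N z :=
        sum_le_sum_of_subset_of_nonneg hsub (fun z _ _ => mu_nonneg hD hd _ _)
    _ = ∑ z ∈ insert c ((Icc (c-N) (c-1) ∪ Icc (c+1) (c+N)).erase c), mu D d N z := by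
        rw [← erase_insert_eq_erase, insert_erase (mem_insert_self _ _)]
    _ = D + ∑ z ∈ (Icc (c-N) (c-1) ∪ Icc (c+1) (c+N)).erase c, mu D d N z := by
        rw [sum_insert (by simp), hc, mu_mul]
    _ ≤ D + ((Icc (c-N) (c-1) ∪ Icc (c+1) (c+N)).erase c).card • d := by
        gcongr; exact sum_le_card_nsmul _ _ _ hval
    _ ≤ D + (2*N:ℕ) • d := by
        gcongr
        have h1 : (Icc (c-N) (c-1) ∪ Icc (c+1) (c+N)).erase c ⊆ (Icc (c-N) (c-1)).erase c ∪ Icc (c+1) (c+N) := by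
          intro z; simp; tauto
        refine (card_le_card h1).trans ((card_union_le _ _).trans ?_)
        have h3 : ((Icc (c-N) (c-1)).erase c).card ≤ N := by
          have : (Icc (c-N) (c-1)).erase c ⊆ Ico (c-N) c := by
            intro z; simp; omega
          refine (card_le_card this).trans ?_
          simp; omega
        have : (Icc (c+1) (c+N)).card = N := by simp
        omega
    _ = _ := by simp; ring


lemma amgm (m : ℕ) (a : ℕ → ℝ) (ha : ∀ t, 0 ≤ a t) :
    ∏ t ∈ range (m+1), a t ≤ ((∑ t ∈ range (m+1), a t)/(m+1))^(m+1) := by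
  have h := Real.geom_mean_le_arith_mean (range (m+1)) (fun _ => 1) a (by simp) (by simp; positivity)
    (fun i _ => ha i)
  simp only [Real.rpow_one, sum_const, card_range, nsmul_eq_mul, mul_one, one_mul] at h
  push_cast at h
  have h0 : 0 ≤ ∏ t ∈ range (m+1), a t := prod_nonneg (fun i _ => ha i)
  have h2 := pow_le_pow_left₀ (Real.rpow_nonneg h0 _) h (m+1)
  rw [← Real.rpow_natCast, ← Real.rpow_mul h0] at h2
  push_cast at h2
  rwa [inv_mul_cancel₀ (by positivity), Real.rpow_one] at h2

open Classical in
/-- probability of an event under i.i.d. labels -/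
noncomputable def Pr (D d : ℝ) (R N : ℕ) {V : Type} [Fintype V] [DecidableEq V]
    (P : (V → ℕ) → Prop) : ℝ :=
  ∑ w ∈ (Fintype.piFinset fun _ : V => X R N) with P w, ∏ v, mu D d N (w v)

section
variable {D d : ℝ} {R N : ℕ} {V : Type} [Fintype V] [DecidableEq V]

lemma Pr_true (h1 : (R+1)*D + R*N*d = 1) : Pr D d R N (fun _ : V → ℕ => True) = 1 := by
  classical
  unfold Pr
  simp only [filter_true]
  rw [← prod_univ_sum (fun _ : V => X R N) (fun _ z => mu D d N z)]
  simp [sum_X, h1]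

lemma Pr_false : Pr D d R N (fun _ : V → ℕ => False) = 0 := by
  simp [Pr]

lemma Pr_mono (hD : 0 ≤ D) (hd : 0 ≤ d) {P Q : (V → ℕ) → Prop} (h : ∀ w, (∀ v, w v ∈ X R N) → P w → Q w) :
    Pr D d R N P ≤ Pr D d R N Q := by
  classical
  unfold Pr
  refine sum_le_sum_of_subset_of_nonneg ?_ (fun _ _ _ => prod_nonneg fun _ _ => mu_nonneg hD hd _ _)
  intro w hw
  simp only [mem_filter, Fintype.mem_piFinset] at hw ⊢
  exact ⟨hw.1, h w hw.1 hw.2⟩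

lemma Pr_exists (hD : 0 ≤ D) (hd : 0 ≤ d) {ι : Type} (I : Finset ι) (P : ι → (V → ℕ) → Prop) :
    Pr D d R N (fun w => ∃ i ∈ I, P i w) ≤ ∑ i ∈ I, Pr D d R N (P i) := by
  classical
  unfold Pr
  simp only [sum_filter]
  rw [sum_comm]
  refine sum_le_sum fun w _ => ?_
  have h0 : 0 ≤ ∏ v, mu D d N (w v) := prod_nonneg fun _ _ => mu_nonneg hD hd _ _
  split_ifs with h
  · obtain ⟨i, hi, hP⟩ := h
    refine le_trans ?_ (single_le_sum (f := fun i => if P i w then ∏ v, mu D d N (w v) else 0)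
      (fun i _ => by split_ifs <;> simp [h0]) hi)
    simp [hP]
  · exact sum_nonneg (fun i _ => by split_ifs <;> simp [h0])

lemma Pr_event (hD : 0 ≤ D) (hd : 0 ≤ d) (h1 : (R+1)*D + R*N*d = 1) (n : ℕ) (hn : 2 ≤ n) (m j : ℕ) (hjm : j + m ≤ R)
    (A : ℕ → Finset V) (v : ℕ → V) (x : ℕ → ℕ) (h0 : x 0 = j*(N+1))
    (hm : x (m+1) = (j+m)*(N+1))
    (hx : ∀ t < m, (j+t)*(N+1) < x (t+1) ∧ x (t+1) ≤ (j+t)*(N+1)+N)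
    (hA : ∀ t ≤ m, (A t).card = n)
    (hv : ∀ t < m, v t ∈ A t ∧ v t ∈ A (t+1))
    (hv' : ∀ t < m, ∀ u, u ∈ A t → u ∈ A (t+1) → u = v t)
    (hdis : ∀ s t, s + 2 ≤ t → t ≤ m → ∀ u ∈ A s, u ∉ A t) :
    Pr D d R N (fun w : V → ℕ => (∀ t < m, w (v t) = x (t+1)) ∧
      ∀ t ≤ m, ∀ u ∈ A t, w u ∈ Icc (x t) (x (t+1))) ≤
    d^m * ((D+2*(N*d))^2 * (((m+1)*D + m*(N*d) + m*d)/(m+1))^((m+1)*(n-2))) := by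
  classical
  have hmono := chain_mono N m j x h0 hm hx
  have hXm : ∀ t ≤ m+1, x t ≤ R*(N+1) := by
    intro t ht
    have : x t ≤ x (m+1) := by
      refine Nat.le_induction (m := t) (P := fun k _ => k ≤ m+1 → x t ≤ x k) (fun _ => le_rfl) ?_ (m+1) ht le_rfl
      intro k hk ih hk1
      exact (ih (by omega)).trans (hmono k (by omega))
    rw [hm] at this
    exact this.trans (Nat.mul_le_mul_right _ hjm)
  set a : ℕ → ℝ := fun t => ∑ z ∈ Icc (x t) (x (t+1)), mu D d N z with ha
  have hnn : ∀ z, 0 ≤ mu D d N z := mu_nonneg hD hd N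
  have ha0 : ∀ t, 0 ≤ a t := fun t => sum_nonneg fun z _ => hnn z
  have ha1 : ∀ t ≤ m, a t ≤ 1 := by
    intro t ht
    rw [← h1, ← sum_X]
    refine sum_le_sum_of_subset_of_nonneg ?_ (fun z _ _ => hnn z)
    intro z hz
    have := hXm (t+1) (by omega)
    simp [X] at hz ⊢; omega
  set S : V → Finset ℕ := fun u => (X R N).filter (fun z => (∀ t < m, u = v t → z = x (t+1)) ∧
    ∀ t ≤ m, u ∈ A t → z ∈ Icc (x t) (x (t+1))) with hS
  set g : V → ℝ := fun u => ∑ z ∈ S u, mu D d N z with hg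
  have hg0 : ∀ u, 0 ≤ g u := fun u => sum_nonneg fun z _ => hnn z
  have hg1 : ∀ u, g u ≤ 1 := by
    intro u
    rw [← h1, ← sum_X]
    exact sum_le_sum_of_subset_of_nonneg (filter_subset _ _) (fun z _ _ => hnn z)
  have hgv : ∀ t < m, g (v t) ≤ d := by
    intro t ht
    calc g (v t) ≤ ∑ z ∈ {x (t+1)}, mu D d N z := by
          refine sum_le_sum_of_subset_of_nonneg ?_ (fun z _ _ => hnn z)
          intro z hz
          rw [hS, mem_filter] at hz
          simpa using hz.2.1 t ht rfl
      _ = d := by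
          rw [sum_singleton]
          exact mu_delta _ _ _ (j+t) _ (hx t ht).1 (hx t ht).2
  have hgA : ∀ t ≤ m, ∀ u ∈ A t, g u ≤ a t := by
    intro t ht u hu
    refine sum_le_sum_of_subset_of_nonneg ?_ (fun z _ _ => hnn z)
    intro z hz
    rw [hS, mem_filter] at hz
    exact hz.2.2 t ht hu
  have step1 : Pr D d R N (fun w : V → ℕ => (∀ t < m, w (v t) = x (t+1)) ∧
      ∀ t ≤ m, ∀ u ∈ A t, w u ∈ Icc (x t) (x (t+1))) ≤ ∏ u, g u := by
    rw [hg, prod_univ_sum S (fun _ z => mu D d N z)]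
    unfold Pr
    refine sum_le_sum_of_subset_of_nonneg ?_ (fun _ _ _ => prod_nonneg fun _ _ => hnn _)
    intro w hw
    simp only [mem_filter, Fintype.mem_piFinset] at hw
    rw [Fintype.mem_piFinset]
    intro u
    rw [hS, mem_filter]
    refine ⟨hw.1 u, ?_, ?_⟩
    · rintro t ht rfl; exact hw.2.1 t ht
    · intro t ht hu; exact hw.2.2 t ht u hu
  refine step1.trans ?_
  set W := (range m).image v with hW
  set B : ℕ → Finset V := fun t => A t \ W with hB
  set U := W ∪ (range (m+1)).biUnion B with hU
  have step2 : ∏ u, g u ≤ ∏ u ∈ U, g u := by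
    rw [← prod_mul_prod_compl U g]
    exact mul_le_of_le_one_right (prod_nonneg fun _ _ => hg0 _)
      (prod_le_one (fun _ _ => hg0 _) (fun _ _ => hg1 _))
  refine step2.trans ?_
  have hvinj : Set.InjOn v (range m) := by
    have key : ∀ s t, s < t → t < m → v s ≠ v t := by
      intro s t hst ht h
      exact hdis s (t+1) (by omega) (by omega) (v s) (hv s (by omega)).1 (h ▸ (hv t ht).2)
    intro s hs t ht h
    simp at hs ht
    rcases lt_trichotomy s t with h' | h' | h'
    · exact absurd h (key s t h' ht)
    · exact h'
    · exact absurd h.symm (key t s h' hs)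
  have hBdis : Set.PairwiseDisjoint (range (m+1) : Set ℕ) B := by
    have key : ∀ s t, s < t → t ≤ m → Disjoint (B s) (B t) := by
      intro s t hst ht
      rw [disjoint_left]
      intro u hu hu'
      rw [hB, mem_sdiff] at hu hu'
      rcases Nat.lt_or_ge (s+1) t with h | h
      · exact hdis s t h ht u hu.1 hu'.1
      · have : t = s+1 := by omega
        subst this
        apply hu.2
        rw [hv' s (by omega) u hu.1 hu'.1]
        exact mem_image_of_mem _ (mem_range.2 (by omega))
    intro s hs t ht hne
    simp at hs ht
    rcases Nat.lt_or_gt_of_ne hne with h' | h'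
    · exact key s t h' (by omega)
    · exact (key t s h' (by omega)).symm
  have hWB : Disjoint W ((range (m+1)).biUnion B) := by
    rw [disjoint_biUnion_right]
    intro t _
    exact disjoint_sdiff
  have hBcard : ∀ t ≤ m, n ≤ (B t).card + ((if t = 0 then 0 else 1) + (if t = m then 0 else 1)) := by
    intro t ht
    have hsub : A t ∩ W ⊆ (if t = 0 then ∅ else {v (t-1)}) ∪ (if t = m then ∅ else {v t}) := by
      intro u hu
      rw [mem_inter, hW, mem_image] at hu
      obtain ⟨huA, s, hs, rfl⟩ := hu
      rw [mem_range] at hs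
      have c1 : ¬ (s + 1 < t) := fun h => hdis s t h ht _ (hv s hs).1 huA
      have c2 : ¬ (t < s) := fun h => hdis t (s+1) (by omega) (by omega) _ huA (hv s hs).2
      rcases (show s + 1 = t ∨ s = t by omega) with h | h
      · subst h; simp
      · subst h; simp [hs.ne]
    have hc := card_le_card hsub
    have hc2 := card_union_le (if t = 0 then (∅ : Finset V) else {v (t-1)}) (if t = m then ∅ else {v t})
    have hc3 : (if t = 0 then (∅ : Finset V) else {v (t-1)}).card = if t = 0 then 0 else 1 := by
      split_ifs <;> simp
    have hc4 : (if t = m then (∅ : Finset V) else {v t}).card = if t = m then 0 else 1 := by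
      split_ifs <;> simp
    have hc5 := card_sdiff_add_card_inter (A t) W
    rw [hA t ht] at hc5
    have : (B t).card = (A t \ W).card := rfl
    omega
  rw [prod_union hWB, prod_biUnion hBdis, prod_image hvinj]
  have e1 : ∏ t ∈ range m, g (v t) ≤ d^m := by
    calc _ ≤ ∏ t ∈ range m, d := prod_le_prod (fun _ _ => hg0 _) (fun t ht => hgv t (mem_range.1 ht))
      _ = d^m := by simp
  have e2 : ∏ t ∈ range (m+1), ∏ u ∈ B t, g u ≤
      ∏ t ∈ range (m+1), (a t^(n-2) * (if t = 0 then a t else 1) * (if t = m then a t else 1)) := by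
    refine prod_le_prod (fun _ _ => prod_nonneg fun _ _ => hg0 _) (fun t ht => ?_)
    have ht' : t ≤ m := by simp at ht; omega
    calc ∏ u ∈ B t, g u ≤ ∏ u ∈ B t, a t :=
          prod_le_prod (fun _ _ => hg0 _) (fun u hu => hgA t ht' u (mem_sdiff.1 hu).1)
      _ = a t ^ (B t).card := by simp
      _ ≤ a t ^ ((n-2) + (if t = 0 then 1 else 0) + (if t = m then 1 else 0)) := by
          apply pow_le_pow_of_le_one (ha0 t) (ha1 t ht')
          have := hBcard t ht'
          split_ifs at this ⊢ <;> omega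
      _ = _ := by
          rw [pow_add, pow_add]
          split_ifs <;> simp
  have e3 : ∏ t ∈ range (m+1), (a t^(n-2) * (if t = 0 then a t else 1) * (if t = m then a t else 1))
      = (∏ t ∈ range (m+1), a t)^(n-2) * (a 0 * a m) := by
    rw [prod_mul_distrib, prod_mul_distrib, prod_pow, prod_ite_eq', prod_ite_eq']
    simp; ring
  have e4 : (∏ t ∈ range (m+1), a t)^(n-2) ≤
      (((m+1)*D + m*(N*d) + m*d)/(m+1))^((m+1)*(n-2)) := by
    rw [pow_mul]
    apply pow_le_pow_left₀ (prod_nonneg fun _ _ => ha0 _)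
    rw [← chain_sum D d N m j x h0 hm hx hmono]
    exact amgm m a ha0
  have e5 : a 0 * a m ≤ (D+2*(N*d))^2 := by
    rw [sq]
    exact mul_le_mul (chain_len D d hD hd N m j x h0 hm hx 0 (by omega))
      (chain_len D d hD hd N m j x h0 hm hx m le_rfl) (ha0 _) (by positivity)
  apply mul_le_mul e1 _ (prod_nonneg fun _ _ => prod_nonneg fun _ _ => hg0 _) (by positivity)
  refine e2.trans ?_
  rw [e3, mul_comm]
  exact mul_le_mul e5 e4 (pow_nonneg (prod_nonneg fun _ _ => ha0 _) _) (by positivity)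

end

/-- a chain of `m+1` edges starting in colour `j` -/
def Chain {V : Type} (N m j : ℕ) (A : ℕ → Finset V) (w : V → ℕ) : Prop :=
  ∃ v : ℕ → V, (∀ t < m, v t ∈ A t ∧ v t ∈ A (t+1)) ∧
    (∀ t < m, ∀ u, u ∈ A t → u ∈ A (t+1) → u = v t) ∧
    (∀ s t, s + 2 ≤ t → t ≤ m → ∀ u ∈ A s, u ∉ A t) ∧
    (∀ t < m, (j+t)*(N+1) < w (v t) ∧ w (v t) ≤ (j+t)*(N+1)+N) ∧
    (∀ t < m, ∀ u ∈ A t, w u ≤ w (v t)) ∧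
    (∀ t < m, ∀ u ∈ A (t+1), w (v t) ≤ w u) ∧
    (∀ u ∈ A 0, j*(N+1) ≤ w u) ∧ (∀ u ∈ A m, w u ≤ (j+m)*(N+1))

lemma Pr_chain {D d : ℝ} (hD : 0 ≤ D) (hd : 0 ≤ d) {R N : ℕ} {V : Type} [Fintype V] [DecidableEq V]
    (h1 : (R+1)*D + R*N*d = 1) (n : ℕ) (hn : 2 ≤ n) (m j : ℕ) (hjm : j + m ≤ R)
    (A : ℕ → Finset V) (hA : ∀ t ≤ m, (A t).card = n) :
    Pr D d R N (Chain N m j A) ≤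
    (N*d)^m * ((D+2*(N*d))^2 * (((m+1)*D + m*(N*d) + m*d)/(m+1))^((m+1)*(n-2))) := by
  classical
  by_cases hex : ∃ v : ℕ → V, (∀ t < m, v t ∈ A t ∧ v t ∈ A (t+1)) ∧
    (∀ t < m, ∀ u, u ∈ A t → u ∈ A (t+1) → u = v t) ∧
    (∀ s t, s + 2 ≤ t → t ≤ m → ∀ u ∈ A s, u ∉ A t)
  swap
  · have : Pr D d R N (Chain N m j A) ≤ Pr D d R N (fun _ : V → ℕ => False) := by
      apply Pr_mono hD hd
      rintro w _ ⟨v, a, b, c, _⟩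
      exact hex ⟨v, a, b, c⟩
    rw [Pr_false] at this
    exact this.trans (by positivity)
  obtain ⟨v, hv, hv', hdis⟩ := hex
  set I : Finset (Fin m → ℕ) := Fintype.piFinset
    (fun t : Fin m => Icc ((j+t)*(N+1)+1) ((j+t)*(N+1)+N)) with hI
  obtain ⟨ex, ex0, exm, ext'⟩ : ∃ ex : (Fin m → ℕ) → ℕ → ℕ, (∀ x, ex x 0 = j*(N+1)) ∧
      (∀ x, ex x (m+1) = (j+m)*(N+1)) ∧ (∀ x t (h : t < m), ex x (t+1) = x ⟨t, h⟩) := by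
    refine ⟨fun x t => if t = 0 then j*(N+1) else
      if h : t - 1 < m then x ⟨t-1, h⟩ else (j+m)*(N+1), ?_, ?_, ?_⟩
    · intro x; simp
    · intro x; simp
    · intro x t h; simp [h]
  have hcard : I.card = N^m := by
    rw [hI, Fintype.card_piFinset]
    simp
  have step : Pr D d R N (Chain N m j A) ≤ Pr D d R N (fun w => ∃ x ∈ I,
      ((∀ t < m, w (v t) = ex x (t+1)) ∧
      ∀ t ≤ m, ∀ u ∈ A t, w u ∈ Icc (ex x t) (ex x (t+1)))) := by
    apply Pr_mono hD hd
    rintro w _ ⟨v2, g1, g2, g3, g4, g5, g6, g7, g8⟩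
    have hvv : ∀ t < m, v2 t = v t := fun t ht => hv' t ht _ (g1 t ht).1 (g1 t ht).2
    refine ⟨fun t => w (v t), ?_, ?_, ?_⟩
    · rw [hI, Fintype.mem_piFinset]
      intro t
      have := g4 t t.2
      rw [hvv t t.2] at this
      rw [mem_Icc]; exact this
    · intro t ht
      exact (ext' (fun t => w (v t)) t ht).symm
    · intro t ht u hu
      rw [mem_Icc]
      constructor
      · rcases t with _ | t
        · exact (ex0 _).trans_le (g7 u hu)
        · have := g6 t (by omega) u hu
          rw [hvv t (by omega)] at this
          exact (ext' _ t (by omega)).trans_le this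
      · rcases Nat.lt_or_ge t m with h | h
        · have := g5 t h u hu
          rw [hvv t h] at this
          exact this.trans_eq (ext' (fun t => w (v t)) t h).symm
        · have : t = m := le_antisymm ht h
          subst this
          exact (g8 u hu).trans_eq (exm _).symm
  refine step.trans ((Pr_exists hD hd I _).trans ?_)
  have hb : ∀ x ∈ I, Pr D d R N (fun w => ((∀ t < m, w (v t) = ex x (t+1)) ∧
      ∀ t ≤ m, ∀ u ∈ A t, w u ∈ Icc (ex x t) (ex x (t+1)))) ≤
      d^m * ((D+2*(N*d))^2 * (((m+1)*D + m*(N*d) + m*d)/(m+1))^((m+1)*(n-2))) := by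
    intro x hx
    apply Pr_event hD hd h1 n hn m j hjm A v (ex x) (ex0 x) (exm x) _ hA hv hv' hdis
    intro t ht
    rw [hI, Fintype.mem_piFinset] at hx
    have := hx ⟨t, ht⟩
    rw [mem_Icc] at this
    rw [ext' x t ht]
    exact ⟨this.1, this.2⟩
  refine (sum_le_card_nsmul _ _ _ hb).trans (le_of_eq ?_)
  rw [hcard, nsmul_eq_mul, mul_pow]
  push_cast; ring

open Classical in
lemma exists_color {V : Type} (N : ℕ) (E : Finset (Finset V)) (w κ : V → ℕ) :
    ∃ c : V → ℕ, ∀ v, c v = if (w v % (N+1) ≠ 0 ∧ ∃ A ∈ E, v ∈ A ∧ ∀ u ∈ A, u ≠ v →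
      κ u < κ v ∧ c u = w v / (N+1)) then w v / (N+1) + 1 else w v / (N+1) := by
  let F : (v : V) → ((u : V) → κ u < κ v → ℕ) → ℕ := fun v rec =>
    if (w v % (N+1) ≠ 0 ∧ ∃ A ∈ E, v ∈ A ∧ ∀ u ∈ A, u ≠ v →
      ∃ h : κ u < κ v, rec u h = w v / (N+1)) then w v / (N+1) + 1 else w v / (N+1)
  have wf : WellFounded (fun u v : V => κ u < κ v) := (measure κ).wf
  refine ⟨wf.fix F, fun v => ?_⟩
  rw [wf.fix_eq]
  simp only [F, exists_prop]

lemma exists_key {V : Type} [Fintype V] (w : V → ℕ) :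
    ∃ κ : V → ℕ, Function.Injective κ ∧ ∀ u v, κ u ≤ κ v → w u ≤ w v := by
  have hlt : ∀ u, (Fintype.equivFin V u : ℕ) < Fintype.card V := fun u => (Fintype.equivFin V u).2
  have hk : ∀ u v, w u * Fintype.card V + (Fintype.equivFin V u : ℕ) ≤
      w v * Fintype.card V + (Fintype.equivFin V v : ℕ) → w u ≤ w v := by
    intro u v h
    by_contra hc
    have := hlt v
    have h3 := Nat.mul_le_mul_right (Fintype.card V) (show w v + 1 ≤ w u by omega)
    rw [Nat.succ_mul] at h3
    omega
  refine ⟨fun u => w u * Fintype.card V + (Fintype.equivFin V u : ℕ), ?_, hk⟩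
  intro u v h
  have h' : w u = w v := le_antisymm (hk u v h.le) (hk v u h.ge)
  simp only [h'] at h
  apply (Fintype.equivFin V).injective
  apply Fin.ext
  omega

/-- backwards construction of a chain -/
lemma build {V : Type} (N : ℕ) (E : Finset (Finset V)) (w κ c : V → ℕ)
    (hne : ∀ A ∈ E, A.Nonempty)
    (hlow : ∀ v, c v = w v / (N+1) ∨ (c v = w v / (N+1) + 1 ∧ w v % (N+1) ≠ 0 ∧ ∃ A ∈ E, v ∈ A ∧ ∀ u ∈ A, u ≠ v →
      κ u < κ v ∧ c u = w v / (N+1)))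
    (hκw : ∀ u v, κ u ≤ κ v → w u ≤ w v) (i : ℕ) :
    ∀ A ∈ E, (∀ u ∈ A, c u = i ∨ w u / (N+1) = i) →
    ∃ j m, j + m = i ∧ ∃ (B : ℕ → Finset V) (v : ℕ → V), B m = A ∧ (∀ t ≤ m, B t ∈ E) ∧
      (∀ t < m, v t ∈ B t ∧ v t ∈ B (t+1)) ∧
      (∀ t < m, (j+t)*(N+1) < w (v t) ∧ w (v t) ≤ (j+t)*(N+1)+N) ∧
      (∀ t < m, ∀ u ∈ B t, κ u ≤ κ (v t)) ∧
      (∀ t < m, ∀ u ∈ B (t+1), κ (v t) ≤ κ u) ∧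
      (∀ u ∈ B 0, j*(N+1) ≤ w u) := by
  induction i with
  | zero =>
    intro A hA h
    obtain ⟨a, ha⟩ := hne A hA
    exact ⟨0, 0, rfl, fun _ => A, fun _ => a, rfl, fun _ _ => hA, by simp, by simp, by simp, by simp,
      by simp⟩
  | succ i ih =>
    intro A hA h
    obtain ⟨f, hf, hmin⟩ := A.exists_min_image κ (hne A hA)
    by_cases hfi : (i+1)*(N+1) ≤ w f
    · exact ⟨i+1, 0, rfl, fun _ => A, fun _ => f, rfl, fun _ _ => hA, by simp, by simp, by simp,
        by simp, fun u hu => hfi.trans (hκw f u (hmin u hu))⟩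
    · have hblk : w f / (N+1) < i + 1 := by
        rw [Nat.div_lt_iff_lt_mul (by omega)]; omega
      have hcf : c f = i+1 := (h f hf).resolve_right (by omega)
      obtain ⟨hc1, hmod, A', hA', hfA', hall⟩ := (hlow f).resolve_left (by omega)
      have hb : w f / (N+1) = i := by omega
      rw [hb] at hall
      obtain ⟨j, m, hjm, B, v, hBm, hBE, k1, k2, k3, k4, k5⟩ := ih A' hA' (by
        intro u hu
        by_cases huf : u = f
        · right; rw [huf, hb]
        · left; exact (hall u hu huf).2)
      have hle : ∀ u ∈ A', κ u ≤ κ f := by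
        intro u hu
        by_cases huf : u = f
        · rw [huf]
        · exact (hall u hu huf).1.le
      have hdm := Nat.div_add_mod (w f) (N+1)
      have hml := Nat.mod_lt (w f) (show 0 < N+1 by omega)
      rw [hb, mul_comm] at hdm
      refine ⟨j, m+1, by omega, fun t => if t ≤ m then B t else A, fun t => if t < m then v t else f,
        by simp, ?_, ?_, ?_, ?_, ?_, ?_⟩
      · intro t ht
        dsimp only
        split_ifs with h'
        · exact hBE t h'
        · exact hA
      · intro t ht
        rcases Nat.lt_or_ge t m with h' | h'
        · simpa [h', h'.le, Nat.succ_le_of_lt h'] using k1 t h'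
        · have : t = m := by omega
          subst this
          simp [hBm, hfA', hf]
      · intro t ht
        rcases Nat.lt_or_ge t m with h' | h'
        · simpa [h'] using k2 t h'
        · have : t = m := by omega
          subst this
          simp only [lt_irrefl, if_false, hjm]
          omega
      · intro t ht
        rcases Nat.lt_or_ge t m with h' | h'
        · simpa [h', h'.le] using k3 t h'
        · have : t = m := by omega
          subst this
          simpa [hBm] using hle
      · intro t ht
        rcases Nat.lt_or_ge t m with h' | h'
        · simpa [h', Nat.succ_le_of_lt h'] using k4 t h'
        · have : t = m := by omega
          subst this
          simpa using hmin
      · simpa using k5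

lemma exists_chain {V : Type} [Fintype V] (R N : ℕ) (E : Finset (Finset V))
    (hne : ∀ A ∈ E, A.Nonempty)
    (hcol : ∀ c : V → Fin (R+1), ∃ A ∈ E, ∃ i : Fin (R+1), ∀ v ∈ A, c v = i)
    (w : V → ℕ) (hw : ∀ v, w v ∈ X R N) :
    ∃ m ∈ range (R+1), ∃ j ∈ range (R+1-m),
      ∃ A ∈ Fintype.piFinset (fun _ : Fin (m+1) => E),
        Chain N m j (fun t => if h : t < m+1 then A ⟨t, h⟩ else ∅) w := by
  classical
  obtain ⟨κ, hinj, hκw⟩ := exists_key w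
  obtain ⟨c, hc⟩ := exists_color N E w κ
  have hlow : ∀ v, c v = w v / (N+1) ∨ (c v = w v / (N+1) + 1 ∧ w v % (N+1) ≠ 0 ∧
      ∃ A ∈ E, v ∈ A ∧ ∀ u ∈ A, u ≠ v → κ u < κ v ∧ c u = w v / (N+1)) := by
    intro v
    have := hc v
    split_ifs at this with h
    · exact Or.inr ⟨this, h⟩
    · exact Or.inl this
  have hcR : ∀ v, c v < R+1 := by
    intro v
    have hx := hw v
    simp only [X, mem_range] at hx
    have hdm := Nat.div_add_mod (w v) (N+1)
    rcases hlow v with h | ⟨h, h2, _⟩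
    · rw [h, Nat.div_lt_iff_lt_mul (by omega)]; nlinarith
    · rw [h]
      have : w v / (N+1) < R := by
        rw [Nat.div_lt_iff_lt_mul (by omega)]
        rcases Nat.lt_or_ge (w v) (R*(N+1)) with h3 | h3
        · exact h3
        · exfalso
          have : w v = R*(N+1) := by omega
          rw [this] at h2
          simp at h2
      omega
  obtain ⟨A, hA, i, hi⟩ := hcol (fun v => ⟨c v, hcR v⟩)
  have hi' : ∀ v ∈ A, c v = i := fun v hv => congrArg Fin.val (hi v hv)
  obtain ⟨l, hl, hmax⟩ := A.exists_max_image κ (hne A hA)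
  have hlw : w l ≤ i*(N+1) := by
    have hdm := Nat.div_add_mod (w l) (N+1)
    have hml := Nat.mod_lt (w l) (show 0 < N+1 by omega)
    have hcl := hi' l hl
    rcases hlow l with h | ⟨h, h2, _⟩
    · by_cases h2 : w l % (N+1) = 0
      · rw [← hcl, h, mul_comm]; omega
      · exfalso
        have hcc := hc l
        rw [if_pos] at hcc
        · omega
        · refine ⟨h2, A, hA, hl, fun u hu hul => ⟨lt_of_le_of_ne (hmax u hu) (fun he => hul (hinj he)), ?_⟩⟩
          rw [hi' u hu, ← hcl, h]
    · rw [← hcl, h]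
      nlinarith
  obtain ⟨j, m, hjm, B, v, hBm, hBE, k1, k2, k3, k4, k5⟩ := build N E w κ c hne hlow hκw i A hA
    (fun u hu => Or.inl (hi' u hu))
  have hiR := i.2
  refine ⟨m, by simp; omega, j, by simp; omega, fun t => B t, ?_, ?_⟩
  · rw [Fintype.mem_piFinset]
    intro t
    exact hBE t (by have := t.2; omega)
  have hB : ∀ t ≤ m, (fun t : ℕ => if h : t < m+1 then (fun t : Fin (m+1) => B t) ⟨t, h⟩ else ∅) t
      = B t := by
    intro t ht
    simp [Nat.lt_succ_of_le ht]
  generalize (fun t : ℕ => if h : t < m+1 then (fun t : Fin (m+1) => B t) ⟨t, h⟩ else ∅) = B' at hB ⊢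
  refine ⟨v, ?_, ?_, ?_, k2, ?_, ?_, ?_, ?_⟩
  · intro t ht
    rw [hB t ht.le, hB (t+1) ht]; exact k1 t ht
  · intro t ht u hu hu'
    rw [hB t ht.le] at hu
    rw [hB (t+1) ht] at hu'
    exact hinj (le_antisymm (k3 t ht u hu) (k4 t ht u hu'))
  · intro s t hst ht u hu hu'
    rw [hB s (by omega)] at hu
    rw [hB t ht] at hu'
    obtain ⟨t, rfl⟩ : ∃ t', t = t'+1 := ⟨t-1, by omega⟩
    have a1 := hκw _ _ (k3 s (by omega) u hu)
    have a2 := hκw _ _ (k4 t (by omega) u hu')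
    have a3 := (k2 s (by omega)).2
    have a4 := (k2 t (by omega)).1
    have a5 := Nat.mul_le_mul_right (N+1) (show j+s+1 ≤ j+t by omega)
    rw [Nat.succ_mul] at a5
    omega
  · intro t ht u hu
    rw [hB t ht.le] at hu
    exact hκw _ _ (k3 t ht u hu)
  · intro t ht u hu
    rw [hB (t+1) ht] at hu
    exact hκw _ _ (k4 t ht u hu)
  · intro u hu
    rw [hB 0 (by omega)] at hu
    exact k5 u hu
  · intro u hu
    rw [hB m le_rfl, hBm] at hu
    rw [hjm]
    exact (hκw _ _ (hmax u hu)).trans hlw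

theorem main_ineq {D d : ℝ} (hD : 0 ≤ D) (hd : 0 ≤ d) {R N : ℕ} {V : Type} [Fintype V] [DecidableEq V]
    (h1 : (R+1)*D + R*N*d = 1) (n : ℕ) (hn : 2 ≤ n) (E : Finset (Finset V))
    (hE : ∀ A ∈ E, A.card = n)
    (hcol : ∀ c : V → Fin (R+1), ∃ A ∈ E, ∃ i : Fin (R+1), ∀ v ∈ A, c v = i) :
    1 ≤ ∑ m ∈ range (R+1), ((R+1-m : ℕ) : ℝ) * ((E.card : ℝ)^(m+1) *
      ((N*d)^m * ((D+2*(N*d))^2 * (((m+1)*D + m*(N*d) + m*d)/(m+1))^((m+1)*(n-2))))) := by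
  have hne : ∀ A ∈ E, A.Nonempty := fun A hA => card_pos.1 (by rw [hE A hA]; omega)
  have h0 : (1:ℝ) = Pr D d R N (fun _ : V → ℕ => True) := (Pr_true h1).symm
  refine h0.trans_le ?_
  refine (Pr_mono hD hd (fun w hw _ => exists_chain R N E hne hcol w hw)).trans ?_
  refine (Pr_exists hD hd _ _).trans (sum_le_sum fun m hm => ?_)
  rw [mem_range] at hm
  refine (Pr_exists hD hd _ _).trans ((sum_le_card_nsmul _ _ ((E.card : ℝ)^(m+1) *
      ((N*d)^m * ((D+2*(N*d))^2 * (((m+1)*D + m*(N*d) + m*d)/(m+1))^((m+1)*(n-2)))))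
      fun j hj => ?_).trans_eq ?_)
  swap
  · rw [card_range, nsmul_eq_mul]
  rw [mem_range] at hj
  refine (Pr_exists hD hd _ _).trans ((sum_le_card_nsmul _ _ ((N*d)^m * ((D+2*(N*d))^2 *
    (((m+1)*D + m*(N*d) + m*d)/(m+1))^((m+1)*(n-2)))) fun A hA => ?_).trans_eq ?_)
  swap
  · rw [Fintype.card_piFinset, nsmul_eq_mul]
    simp
  rw [Fintype.mem_piFinset] at hA
  apply Pr_chain hD hd h1 n hn m j (by omega)
  intro t ht
  simp only [Nat.lt_succ_of_le ht, dif_pos]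
  exact hE _ (hA _)

theorem fin_ineq {R : ℕ} (hR : 1 ≤ R) {p : ℝ} (hp : 0 ≤ p) (hp1 : p ≤ 1)
    {V : Type} [Fintype V] [DecidableEq V] (n : ℕ) (hn : 2 ≤ n) (E : Finset (Finset V))
    (hE : ∀ A ∈ E, A.card = n)
    (hcol : ∀ c : V → Fin (R+1), ∃ A ∈ E, ∃ i : Fin (R+1), ∀ v ∈ A, c v = i)
    (k : ℝ) (hk : (E.card : ℝ) ≤ k * ((R+1 : ℕ) : ℝ)^(n-1)) (hk0 : 0 ≤ k) :
    1 ≤ Real.exp (11*p) * ∑ m ∈ range (R+1), ((R+1-m : ℕ) : ℝ) *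
      ((k/(R+1)) * (k*p*(R+1)/R)^m * Real.exp (-(p*n*((R:ℝ)-m)/R))) := by
  have hRr : (1:ℝ) ≤ R := by exact_mod_cast hR
  have hR0 : (0:ℝ) < R := by linarith
  set r : ℝ := (R:ℝ)+1 with hr
  have hr0 : 0 < r := by linarith
  have hn0 : (2:ℝ) ≤ n := by exact_mod_cast hn
  obtain ⟨N, hN⟩ : ∃ N : ℕ, (N:ℝ) = r^2*n := ⟨(R+1)^2*n, by rw [hr]; push_cast; ring⟩
  have hN0 : (0:ℝ) < N := by rw [hN]; positivity
  set d : ℝ := p/(R*N) with hd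
  have hd0 : 0 ≤ d := by positivity
  have hNd : N*d = p/R := by rw [hd]; field_simp
  set D : ℝ := (1-p)/r with hDdef
  have hD0 : 0 ≤ D := div_nonneg (by linarith) hr0.le
  have h1 : ((R:ℝ)+1)*D + R*N*d = 1 := by
    rw [mul_assoc, hNd, hDdef, ← hr]; field_simp; ring
  refine (main_ineq hD0 hd0 h1 n hn E hE hcol).trans ?_
  rw [mul_sum]
  refine sum_le_sum fun m hm => ?_
  have hmR : m ≤ R := by simp at hm; omega
  have hmR' : (m:ℝ) ≤ R := by exact_mod_cast hmR
  rw [mul_left_comm (Real.exp (11*p))]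
  refine mul_le_mul_of_nonneg_left ?_ (show (0:ℝ) ≤ ((R+1-m : ℕ) : ℝ) from Nat.cast_nonneg _)
  rw [hNd]
  have hq : D + 2*(p/R) ≤ (1/r) * Real.exp (4*p) := by
    have e1 : p/R ≤ 2*p/r := by
      rw [div_le_div_iff₀ hR0 hr0, hr]; nlinarith
    have e2 := Real.add_one_le_exp (4*p)
    calc D + 2*(p/R) ≤ (1-p)/r + 2*(2*p/r) := by gcongr
      _ = (1/r) * (1+3*p) := by field_simp; ring
      _ ≤ _ := by gcongr; linarith
  have hY0 : 0 ≤ ((m+1)*D + m*(p/R) + m*d)/(m+1) := by positivity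
  have hY : ((m+1)*D + m*(p/R) + m*d)/(m+1) ≤ (1/r) * Real.exp (-(p*(R-m)/((m+1)*R)) + r*d) := by
    have e2 := Real.add_one_le_exp (-(p*(R-m)/((m+1)*R)) + r*d)
    have e3 : ((m+1)*D + m*(p/R) + m*d)/(m+1) =
        (1/r) * (-(p*(R-m)/((m+1)*R)) + r*d*(m/(m+1)) + 1) := by
      rw [hDdef, hr]; field_simp; ring
    rw [e3]
    have e4 : (m:ℝ)/(m+1) ≤ 1 := by rw [div_le_one (by positivity)]; linarith
    have e5 : r*d*(m/(m+1)) ≤ r*d := mul_le_of_le_one_right (by positivity) e4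
    gcongr; linarith
  have hYp : (((m+1)*D + m*(p/R) + m*d)/(m+1))^((m+1)*(n-2)) ≤
      (1/r)^((m+1)*(n-2)) * (Real.exp (-(p*n*((R:ℝ)-m)/R)) * Real.exp (3*p)) := by
    refine (pow_le_pow_left₀ hY0 hY _).trans ?_
    rw [mul_pow, ← Real.exp_nat_mul, ← Real.exp_add]
    gcongr
    have hc : (((m+1)*(n-2) : ℕ):ℝ) = (m+1)*((n:ℝ)-2) := by
      push_cast [Nat.cast_sub hn]; ring
    rw [hc]
    have f1 : ((m:ℝ)+1)*((n:ℝ)-2) * (-(p*(R-m)/((m+1)*R)) + r*d) =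
        -(p*n*((R:ℝ)-m)/R) + 2*p*((R-m)/R) + (m+1)*(n-2)*(r*d) := by
      field_simp; ring
    rw [f1]
    have f2 : ((R:ℝ)-m)/R ≤ 1 := by rw [div_le_one hR0]; linarith [Nat.cast_nonneg (α := ℝ) m]
    have f3 : ((m:ℝ)+1)*(n-2)*(r*d) ≤ p := by
      calc ((m:ℝ)+1)*(n-2)*(r*d) ≤ r*n*(r*d) := by
            have : (m:ℝ)+1 ≤ r := by linarith
            gcongr
            linarith
        _ = N*d := by rw [hN]; ring
        _ = p/R := hNd
        _ ≤ p := div_le_self hp hRr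
    nlinarith
  have hkr : (E.card:ℝ)^(m+1) ≤ (k*r^(n-1))^(m+1) := by
    apply pow_le_pow_left₀ (Nat.cast_nonneg _)
    have hk2 := hk
    push_cast at hk2
    exact hk2
  calc (E.card:ℝ)^(m+1) * ((p/R)^m * ((D+2*(p/R))^2 *
        (((m+1)*D + m*(p/R) + m*d)/(m+1))^((m+1)*(n-2))))
      ≤ (k*r^(n-1))^(m+1) * ((p/R)^m * (((1/r) * Real.exp (4*p))^2 *
        ((1/r)^((m+1)*(n-2)) * (Real.exp (-(p*n*((R:ℝ)-m)/R)) * Real.exp (3*p))))) := by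
        gcongr
    _ = Real.exp (11*p) * ((k/r) * (k*p*r/R)^m * Real.exp (-(p*n*((R:ℝ)-m)/R))) := by
        have g1 : Real.exp (11*p) = Real.exp (4*p)^2 * Real.exp (3*p) := by
          rw [← Real.exp_nat_mul, ← Real.exp_add]; congr 1; push_cast; ring
        have g2 : r^(n-1) = r^(n-2)*r := by rw [← pow_succ]; congr 1; omega
        rw [g1, g2]
        have g3 : (r^(n-2)*r)^(m+1) * (1/r)^((m+1)*(n-2)) = r^(m+1) := by
          rw [mul_pow, ← pow_mul, mul_comm (n-2), mul_right_comm, ← mul_pow, mul_one_div_cancel hr0.ne']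
          simp
        have g4 : r^(m+1) * (1/r)^2 = r^m * (1/r) := by field_simp; ring
        calc _ = k^(m+1) * ((r^(n-2)*r)^(m+1) * (1/r)^((m+1)*(n-2)) * (1/r)^2) * (p/R)^m *
              (Real.exp (4*p)^2 * Real.exp (3*p)) * Real.exp (-(p*n*((R:ℝ)-m)/R)) := by
                rw [mul_pow k]; ring
          _ = _ := by
                rw [g3, g4]
                have : k*p*r/R = k*(p/R)*r := by ring
                rw [this, mul_pow, mul_pow, pow_succ]; ring

lemma sum_bound (R : ℕ) (hR : 1 ≤ R) (c b y : ℝ) (hc : 0 ≤ c) (hb : 0 < b)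
    (ha : 2 < b * Real.exp (y/R)) :
    ∑ m ∈ range (R+1), ((R+1-m : ℕ) : ℝ) * (c * b^m * Real.exp (-(y*((R:ℝ)-m)/R))) ≤
      c * b^R * (1 - 2/(b * Real.exp (y/R)))⁻¹ := by
  set a := b * Real.exp (y/R) with ha'
  have hR0 : (0:ℝ) < R := by exact_mod_cast hR
  have ha0 : 0 < a := by linarith
  rw [← sum_range_reflect]
  have h1 : ∀ j ∈ range (R+1), ((R+1-(R+1-1-j) : ℕ) : ℝ) *
      (c * b^(R+1-1-j) * Real.exp (-(y*((R:ℝ)-(R+1-1-j : ℕ))/R))) ≤ c * b^R * (2/a)^j := by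
    intro j hj
    have hj' : j ≤ R := by simp at hj; omega
    have e1 : R+1-(R+1-1-j) = j+1 := by omega
    have e2 : R+1-1-j = R-j := by omega
    rw [e1, e2, Nat.cast_sub hj']
    have e3 : Real.exp (-(y*((R:ℝ)-((R:ℝ)-j))/R)) = (Real.exp (y/R)^j)⁻¹ := by
      rw [← Real.exp_nat_mul, ← Real.exp_neg]; congr 1; ring
    have e4 : b^R = b^(R-j) * b^j := by rw [← pow_add]; congr 1; omega
    have e5 : ((j+1:ℕ):ℝ) ≤ 2^j := by exact_mod_cast Nat.lt_two_pow_self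
    rw [e3, e4, div_pow, ha', mul_pow]
    have : c * (b^(R-j) * b^j) * (2^j / (b^j * Real.exp (y/R)^j)) =
        2^j * (c * b^(R-j) * (Real.exp (y/R)^j)⁻¹) := by
      have := Real.exp_pos (y/R)
      field_simp
    rw [this]
    gcongr
  refine (sum_le_sum h1).trans ?_
  rw [← mul_sum]
  gcongr
  have h2 : 2/a < 1 := by rw [div_lt_one ha0]; exact ha
  have h3 : 0 ≤ 2/a := by positivity
  rw [← tsum_geometric_of_lt_one h3 h2]
  exact (summable_geometric_of_lt_one h3 h2).sum_le_tsum _ (fun i _ => by positivity)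

lemma fact_le (R : ℕ) (hR : 1 ≤ R) : (R+1).factorial ≤ 2 * R^R := by
  induction R, hR using Nat.le_induction with
  | base => simp [Nat.factorial]
  | succ k hk ih =>
    rw [Nat.factorial_succ]
    obtain ⟨l, rfl⟩ : ∃ l, k = l+1 := ⟨k-1, by omega⟩
    calc (l+1+1+1) * (l+1+1).factorial ≤ (l+1+1+1) * (2 * (l+1)^(l+1)) := Nat.mul_le_mul_left _ ih
      _ = 2 * (((l+1+1+1) * (l+1)) * (l+1)^l) := by ring
      _ ≤ 2 * ((l+1+1)^2 * (l+1+1)^l) := by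
          gcongr
          · nlinarith
          · omega
      _ = 2 * (l+1+1)^(l+1+1) := by ring

lemma rpow_div_pow (x : ℝ) (hx : 0 ≤ x) (y : ℝ) (R : ℕ) :
    (x^(y/((R+1:ℕ):ℝ)))^(R+1) = x^y := by
  rw [← Real.rpow_natCast, ← Real.rpow_mul hx]
  congr 1
  have : ((R+1:ℕ):ℝ) ≠ 0 := by positivity
  field_simp

lemma qprime_pow (R : ℕ) (hR : 1 ≤ R) :
    qprime (R+1) ^ (R+1) = ((R+1).factorial : ℝ) * (R+1) / (2 * (R:ℝ)^R) := by
  have hR0 : (0:ℝ) < R := by exact_mod_cast hR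
  have hq : (0:ℝ) ≤ 1 - 1/((R+1:ℕ):ℝ) := by
    have : 1/((R+1:ℕ):ℝ) ≤ 1 := by
      rw [div_le_one (by positivity)]; push_cast; linarith
    linarith
  unfold qprime
  rw [div_pow, mul_pow, mul_pow, rpow_div_pow _ (by positivity), rpow_div_pow _ (by positivity),
    rpow_div_pow _ hq, rpow_div_pow _ (by positivity)]
  have e1 : ((R+1:ℕ):ℝ) - 1 = (R:ℝ) := by push_cast; ring
  have e2 : ((R+1:ℕ):ℝ) - 2 = (R:ℝ) - 1 := by push_cast; ring
  have e3 : 1 - 1/((R+1:ℕ):ℝ) = R/(R+1) := by push_cast; field_simp; ring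
  rw [e1, e2, e3, Real.rpow_one, Real.rpow_one, Real.rpow_natCast, Real.rpow_sub (by positivity),
    Real.rpow_natCast, Real.rpow_one]
  push_cast
  rw [div_pow]
  field_simp

lemma qprime_pos (R : ℕ) (hR : 1 ≤ R) : 0 < qprime (R+1) := by
  have hR0 : (0:ℝ) < R := by exact_mod_cast hR
  have hq : (0:ℝ) < 1 - 1/((R+1:ℕ):ℝ) := by
    have : 1/((R+1:ℕ):ℝ) < 1 := by
      rw [div_lt_one (by positivity)]; push_cast; linarith
    linarith
  unfold qprime
  have h1 : (0:ℝ) < ((R+1).factorial : ℝ) := by positivity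
  have h2 : (0:ℝ) < ((R+1:ℕ):ℝ) := by positivity
  exact div_pos (Real.rpow_pos_of_pos h1 _) (mul_pos (mul_pos (Real.rpow_pos_of_pos (by norm_num) _)
    (Real.rpow_pos_of_pos hq _)) (Real.rpow_pos_of_pos h2 _))

lemma qprime_ge (R : ℕ) (hR : 1 ≤ R) : Real.exp (-1) ≤ qprime (R+1) := by
  have hR0 : (1:ℝ) ≤ R := by exact_mod_cast hR
  apply le_of_pow_le_pow_left₀ (n := R+1) (by omega) (qprime_pos R hR).le
  rw [qprime_pow R hR, ← Real.exp_nat_mul]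
  have h := Real.pow_div_factorial_le_exp ((R+1:ℕ):ℝ) (by positivity) (R+1)
  have hf : (0:ℝ) < ((R+1).factorial : ℝ) := by positivity
  rw [div_le_iff₀ hf] at h
  have e : ((R+1:ℕ):ℝ) * -1 = -((R+1:ℕ):ℝ) := by ring
  rw [e, Real.exp_neg, inv_le_iff_one_le_mul₀ (Real.exp_pos _), mul_comm, mul_div_assoc', le_div_iff₀ (by positivity)]
  have h2 : (R:ℝ)^R ≤ ((R+1:ℕ):ℝ)^R := by
    apply pow_le_pow_left₀ (by positivity); push_cast; linarith
  have h3 : ((R+1:ℕ):ℝ)^(R+1) = ((R+1:ℕ):ℝ)^R * (R+1) := by rw [pow_succ]; push_cast; ring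
  calc 1 * (2 * (R:ℝ)^R) ≤ 2 * ((R+1:ℕ):ℝ)^R := by linarith
    _ ≤ (R+1) * (R+1) * ((R+1:ℕ):ℝ)^R := by
        gcongr; nlinarith
    _ = (R+1) * ((R+1:ℕ):ℝ)^(R+1) := by rw [h3]; ring
    _ ≤ (R+1) * (Real.exp ((R+1:ℕ):ℝ) * ((R+1).factorial : ℝ)) := by gcongr
    _ = _ := by ring

/-- the final estimate for fixed parameters -/
theorem final (R : ℕ) (hR : 1 ≤ R) (ε : ℝ) (hε : 0 < ε) (hε1 : ε < 1) (n : ℕ) (hn : 2 ≤ n)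
    (L : ℝ) (hL : 1 ≤ L) (hLn : L = Real.log n)
    (hp : Real.exp (11*((1-ε)⁻¹ * L / n)) ≤ 1 + ε/2)
    (ha : 4/ε < Real.exp (-1) * Real.exp (((1-ε)⁻¹ - 1) * (L/(R+1))))
    {V : Type} [Fintype V] [DecidableEq V] (E : Finset (Finset V))
    (hE : ∀ A ∈ E, A.card = n)
    (hcol : ∀ c : V → Fin (R+1), ∃ A ∈ E, ∃ i : Fin (R+1), ∀ v ∈ A, c v = i) :
    (E.card : ℝ) ≥ (1 - ε) * qprime (R+1) *
            ((n : ℝ) / L) ^ ((((R+1:ℕ) : ℝ) - 1) / ((R+1:ℕ):ℝ)) * ((R+1:ℕ) : ℝ) ^ (n - 1) := by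
  by_contra hcon
  push Not at hcon
  have hR0 : (1:ℝ) ≤ R := by exact_mod_cast hR
  have hn0 : (2:ℝ) ≤ n := by exact_mod_cast hn
  have hε' : 0 < 1 - ε := by linarith
  set ρ := (1-ε)⁻¹ with hρ
  have hρ0 : 0 < ρ := inv_pos.2 hε'
  have hρε : (1-ε)*ρ = 1 := mul_inv_cancel₀ hε'.ne'
  have hq0 := qprime_pos R hR
  set x : ℝ := (n:ℝ)/L with hx
  have hx0 : 0 < x := by positivity
  set s : ℝ := (((R+1:ℕ) : ℝ) - 1) / ((R+1:ℕ):ℝ) with hs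
  set k : ℝ := (1-ε) * qprime (R+1) * x^s with hk
  have hk0 : 0 < k := by positivity
  set p : ℝ := ρ * (R/(R+1)) * L / n with hpdef
  have hp0 : 0 < p := by positivity
  have hple : p ≤ ρ * L / n := by
    rw [hpdef]
    have : (R:ℝ)/(R+1) ≤ 1 := by rw [div_le_one (by positivity)]; linarith
    gcongr
    exact mul_le_of_le_one_right hρ0.le this
  have hexp : Real.exp (11*p) ≤ 1 + ε/2 :=
    (Real.exp_le_exp.2 (by linarith)).trans hp
  have hp1 : p ≤ 1 := by
    have := Real.add_one_le_exp (11*p)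
    linarith
  have hmain := fin_ineq hR hp0.le hp1 n hn E hE hcol k hcon.le hk0.le
  set b := k*p*(R+1)/R with hb
  have hb0 : 0 < b := by positivity
  have hb' : b = k * ρ * x⁻¹ := by
    rw [hb, hpdef, hx]; field_simp
  have hpn : p*n/R = ρ * L/(R+1) := by rw [hpdef]; field_simp
  have hage : 4/ε < b * Real.exp (p*n/R) := by
    refine ha.trans_le ?_
    rw [hb', hpn]
    have e1 : k * ρ * x⁻¹ = qprime (R+1) * (x^s * x⁻¹) := by
      rw [hk]
      calc _ = ((1-ε)*ρ) * (qprime (R+1) * (x^s * x⁻¹)) := by ring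
        _ = _ := by rw [hρε, one_mul]
    have e2 : x^s * x⁻¹ = x^(-(1/((R:ℝ)+1))) := by
      rw [← Real.rpow_neg_one x, ← Real.rpow_add hx0]
      congr 1
      rw [hs]; push_cast; field_simp; ring
    have e3 : Real.exp (-(L/(R+1))) ≤ x^(-(1/((R:ℝ)+1))) := by
      rw [Real.rpow_neg hx0.le, Real.exp_neg]
      have : x ≤ Real.exp L := by
        rw [hLn, Real.exp_log (by linarith), hx]
        exact div_le_self (by linarith) hL
      have h2 : x^(1/((R:ℝ)+1)) ≤ Real.exp (L/(R+1)) := by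
        refine (Real.rpow_le_rpow hx0.le this (by positivity)).trans_eq ?_
        rw [← Real.exp_mul]; congr 1; ring
      exact inv_anti₀ (Real.rpow_pos_of_pos hx0 _) h2
    rw [e1, e2, mul_assoc]
    have e4 : Real.exp ((ρ-1)*(L/(R+1))) = Real.exp (-(L/(R+1))) * Real.exp (ρ*L/(R+1)) := by
      rw [← Real.exp_add]; congr 1; ring
    rw [e4]
    have := qprime_ge R hR
    gcongr
  have h4ε : 4 < 4/ε := by rw [lt_div_iff₀ hε]; linarith
  have hsum := sum_bound R hR (k/(R+1)) b (p*n) (by positivity) hb0 (by linarith)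
  have hT : k/(R+1) * b^R ≤ 1-ε := by
    have t1 : k/(R+1) * b^R = k^(R+1) * ρ^R * (x⁻¹)^R / (R+1) := by
      rw [hb', mul_pow, mul_pow, pow_succ]; ring
    have t2 : (x^s)^(R+1) = x^R := by
      rw [hs, rpow_div_pow _ hx0.le]
      rw [← Real.rpow_natCast]; congr 1; push_cast; ring
    have t3 : k^(R+1) = (1-ε)^(R+1) * (((R+1).factorial : ℝ) * (R+1) / (2 * (R:ℝ)^R)) * x^R := by
      rw [hk, mul_pow, mul_pow, t2, qprime_pow R hR]
    have t4 : k/(R+1) * b^R = (1-ε) * (((R+1).factorial : ℝ) / (2 * (R:ℝ)^R)) := by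
      rw [t1, t3]
      calc _ = (1-ε) * ((1-ε)*ρ)^R * (x * x⁻¹)^R * (((R+1).factorial : ℝ) / (2 * (R:ℝ)^R)) *
            (((R:ℝ)+1)/(R+1)) := by
              rw [mul_pow, mul_pow, pow_succ]; ring
        _ = _ := by
              rw [hρε, mul_inv_cancel₀ hx0.ne', div_self (by positivity)]; simp
    rw [t4]
    apply mul_le_of_le_one_right hε'.le
    rw [div_le_one (by positivity)]
    exact_mod_cast fact_le R hR
  set a := b * Real.exp (p*n/R) with hadef
  have ha0 : 0 < a := by linarith
  have h2a : 2/a < ε/2 := by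
    rw [div_lt_iff₀ hε] at hage
    rw [div_lt_iff₀ ha0]; linarith
  have hpos : 0 < 1 - 2/a := by linarith
  have hS : ∑ m ∈ range (R+1), ((R+1-m : ℕ) : ℝ) *
      ((k/(R+1)) * b^m * Real.exp (-(p*n*((R:ℝ)-m)/R))) ≤ (1-ε) * (1-2/a)⁻¹ :=
    hsum.trans (mul_le_mul_of_nonneg_right hT (inv_nonneg.2 hpos.le))
  have hfin : 1 ≤ (1+ε/2) * ((1-ε) * (1-2/a)⁻¹) := by
    refine hmain.trans (mul_le_mul hexp hS ?_ (by positivity))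
    exact sum_nonneg fun m _ => by positivity
  rw [← mul_assoc, ← div_eq_mul_inv, le_div_iff₀ hpos] at hfin
  nlinarith

end HG

open Filter in
theorem stmt_0 (r : ℕ → ℕ) (hr2 : ∀ n, 2 ≤ r n)
    (hro : Filter.Tendsto (fun n : ℕ => ((r n : ℝ) * Real.log (Real.log n)) / Real.log n)
      Filter.atTop (nhds 0)) :
    ∀ ε : ℝ, 0 < ε → ε < 1 → ∃ n₀ : ℕ, ∀ n ≥ n₀,
      ∀ (V : Type) [Fintype V] [DecidableEq V] (E : Finset (Finset V)),
        (∀ A ∈ E, A.card = n) →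
        (∀ c : V → Fin (r n), ∃ A ∈ E, ∃ i : Fin (r n), ∀ v ∈ A, c v = i) →
        (E.card : ℝ) ≥
          (1 - ε) * qprime (r n) *
            ((n : ℝ) / Real.log n) ^ (((r n : ℝ) - 1) / (r n)) * (r n : ℝ) ^ (n - 1) := by
  intro ε hε hε1
  have hlog : Tendsto (fun n : ℕ => Real.log n) atTop atTop :=
    Real.tendsto_log_atTop.comp tendsto_natCast_atTop_atTop
  have hloglog : Tendsto (fun n : ℕ => Real.log (Real.log n)) atTop atTop :=
    Real.tendsto_log_atTop.comp hlog
  have hρ : 0 < (1-ε)⁻¹ - 1 := by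
    have := one_lt_inv₀ (show 0 < 1 - ε by linarith) |>.2 (by linarith)
    linarith
  have hquot : Tendsto (fun n : ℕ => Real.log n / n) atTop (nhds 0) := by
    have h := Real.isLittleO_log_id_atTop.tendsto_div_nhds_zero
    exact h.comp tendsto_natCast_atTop_atTop
  have hexp : Tendsto (fun n : ℕ => Real.exp (11*((1-ε)⁻¹ * Real.log n / n))) atTop (nhds 1) := by
    have h : Tendsto (fun n : ℕ => 11*((1-ε)⁻¹ * (Real.log n / n))) atTop (nhds (11*((1-ε)⁻¹*0))) :=
      (hquot.const_mul _).const_mul _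
    have h2 := (Real.continuous_exp.tendsto _).comp h
    simp only [mul_zero, Real.exp_zero] at h2
    refine h2.congr (fun n => ?_)
    simp only [Function.comp]
    congr 1; ring
  obtain ⟨K, hK, hK0⟩ : ∃ K : ℝ, 4/ε < Real.exp (-1) * Real.exp (((1-ε)⁻¹ - 1) * K) ∧ 0 < K := by
    have h : Tendsto (fun K : ℝ => Real.exp (-1) * Real.exp (((1-ε)⁻¹ - 1) * K)) atTop atTop :=
      (Real.tendsto_exp_atTop.comp (tendsto_id.const_mul_atTop hρ)).const_mul_atTop (Real.exp_pos _)
    exact ((h.eventually_gt_atTop (4/ε)).and (eventually_gt_atTop 0)).exists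
  have ev := (hexp.eventually_lt_const (show (1:ℝ) < 1 + ε/2 by linarith)).and
    ((hlog.eventually_ge_atTop 1).and ((hloglog.eventually_ge_atTop 1).and
      ((hro.eventually_lt_const (show (0:ℝ) < K⁻¹ from inv_pos.2 hK0)).and (eventually_ge_atTop 2))))
  obtain ⟨n₀, hn₀⟩ := eventually_atTop.1 ev
  refine ⟨n₀, fun n hn V _ _ E hE hcol => ?_⟩
  obtain ⟨h1, h2, h3, h4, h5⟩ := hn₀ n hn
  have hr := hr2 n
  generalize r n = rn at *
  obtain ⟨R, rfl⟩ : ∃ R, rn = R+1 := ⟨rn-1, by omega⟩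
  refine HG.final R (by omega) ε hε hε1 n h5 _ h2 rfl h1.le ?_ E hE hcol
  refine hK.trans_le ?_
  have hKL : K ≤ Real.log n / (R+1) := by
    rw [div_lt_iff₀ (by linarith), inv_mul_eq_div, lt_div_iff₀ hK0] at h4
    rw [le_div_iff₀ (by positivity)]
    push_cast at h4
    have : ((R:ℝ)+1)*K ≤ ((R:ℝ)+1) * Real.log (Real.log n) * K := by
      have : (0:ℝ) ≤ ((R:ℝ)+1)*K := by positivity
      nlinarith
    linarith
  gcongr
end

section
/- Fix an integer r ≥ 2 and set q' = (r!)^{1/r} / (2^{1/r} · (1 − 1/r)^{(r−1)/r} · r^{(r−2)/r}). For every real q < q' there exists n₀ such that for all n ≥ n₀: every n-uniform hypergraph whose chromatic number is greater than r has at least q · (n/ln n)^{(r−1)/r} · r^{n−1} edges; that is, m(n,r) ≥ q · (n/ln n)^{(r−1)/r} · r^{n−1}. -/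
open Finset

/-- `Ch E key j b`: there is a chain of `j` edges whose last vertex is `b`. -/
def ChainTo {V : Type} (E : Finset (Finset V)) (key : V → ℕ) : ℕ → V → Prop
  | 0, _ => True
  | j + 1, b => ∃ A ∈ E, b ∈ A ∧ ∃ a ∈ A, (∀ u ∈ A, key a ≤ key u ∧ key u ≤ key b) ∧
      ChainTo E key j a

lemma chainTo_extract {V : Type} (E : Finset (Finset V)) (key : V → ℕ) (j : ℕ) :
    ∀ b : V, ChainTo E key j b → ∃ (A : ℕ → Finset V) (v : ℕ → V), v j = b ∧
      ∀ i < j, A i ∈ E ∧ v i ∈ A i ∧ v (i + 1) ∈ A i ∧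
        ∀ u ∈ A i, key (v i) ≤ key u ∧ key u ≤ key (v (i + 1)) := by
  induction j with
  | zero => intro b _; exact ⟨fun _ => ∅, fun _ => b, rfl, by simp⟩
  | succ j ih =>
    rintro b ⟨A, hA, hb, a, ha, hm, hc⟩
    obtain ⟨A', v', hv', h'⟩ := ih a hc
    refine ⟨fun i => if i = j then A else A' i, fun i => if i = j + 1 then b else v' i,
      by simp, ?_⟩
    intro i hi
    by_cases hij : i = j
    · subst hij
      simp only [if_true, hv', show i ≠ i + 1 by omega, if_false]
      exact ⟨hA, ha, hb, hm⟩
    · have := h' i (by omega)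
      simpa [hij, show i ≠ j + 1 by omega] using this

lemma exists_chain {V : Type} [Fintype V] [DecidableEq V] (E : Finset (Finset V))
    (key : V → ℕ) (s : ℕ) (hne : ∀ A ∈ E, A.Nonempty)
    (hcol : ∀ c : V → Fin (s + 1), ∃ A ∈ E, ∃ i : Fin (s + 1), ∀ v ∈ A, c v = i) :
    ∃ (A : ℕ → Finset V) (v : ℕ → V), ∀ i < s + 1, A i ∈ E ∧ v i ∈ A i ∧ v (i + 1) ∈ A i ∧
        ∀ u ∈ A i, key (v i) ≤ key u ∧ key u ≤ key (v (i + 1)) := by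
  classical
  obtain ⟨A, hA, i, hi⟩ := hcol fun v =>
    ⟨Nat.findGreatest (fun j => ChainTo E key j v) s, Nat.lt_succ_of_le (Nat.findGreatest_le s)⟩
  obtain ⟨a, ha, hamin⟩ := A.exists_min_image key (hne A hA)
  obtain ⟨b, hb, hbmax⟩ := A.exists_max_image key (hne A hA)
  have h1 : Nat.findGreatest (fun j => ChainTo E key j a) s = i := congrArg Fin.val (hi a ha)
  have h2 : Nat.findGreatest (fun j => ChainTo E key j b) s = i := congrArg Fin.val (hi b hb)
  have h3 : ChainTo E key i a := by
    have := Nat.findGreatest_spec (P := fun j => ChainTo E key j a) (Nat.zero_le s) trivial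
    rwa [h1] at this
  have h4 : ChainTo E key (i + 1) b :=
    ⟨A, hA, hb, a, ha, fun u hu => ⟨hamin u hu, hbmax u hu⟩, h3⟩
  have h5 : (i : ℕ) = s := by
    by_contra hne
    have := Nat.le_findGreatest (P := fun j => ChainTo E key j b) (n := s) (by omega) h4
    omega
  rw [h5] at h4
  obtain ⟨A', v', -, h⟩ := chainTo_extract E key (s + 1) b h4
  exact ⟨A', v', h⟩

/-- Tuples of edges having the intersection pattern of a chain. -/
def IsPathTuple {V : Type} [DecidableEq V] {s : ℕ} (A : Fin (s + 1) → Finset V) : Prop :=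
  (∀ i j : Fin (s + 1), (i : ℕ) + 1 < j → Disjoint (A i) (A j)) ∧
  (∀ k : Fin s, (A k.castSucc ∩ A k.succ).card = 1)

lemma exists_pathTuple {V : Type} [Fintype V] [DecidableEq V] (E : Finset (Finset V))
    (w : V → ℕ) (s n : ℕ) (hn : 2 ≤ n) (hE : ∀ A ∈ E, A.card = n)
    (hcol : ∀ c : V → Fin (s + 1), ∃ A ∈ E, ∃ i : Fin (s + 1), ∀ v ∈ A, c v = i) :
    ∃ (A : Fin (s + 1) → Finset V) (v : ℕ → V), IsPathTuple A ∧ (∀ i, A i ∈ E) ∧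
      (∀ i : Fin (s + 1), ∀ u ∈ A i, w (v i) ≤ w u ∧ w u ≤ w (v (i + 1))) := by
  classical
  let e := Fintype.equivFin V
  set M := Fintype.card V with hM
  let key : V → ℕ := fun v => w v * M + e v
  have keyinj : Function.Injective key := by
    intro a b hab
    have h1 : (key a) % M = (key b) % M := by rw [hab]
    simp only [key, Nat.mul_add_mod_self_right, Nat.mod_eq_of_lt (e a).2, Nat.mod_eq_of_lt (e b).2] at h1
    exact e.injective (Fin.ext h1)
  have keyw : ∀ a b, key a ≤ key b → w a ≤ w b := by
    intro a b hab
    by_contra hlt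
    push Not at hlt
    have h1 : (w b + 1) * M ≤ w a * M := Nat.mul_le_mul_right _ hlt
    have := (e b).2
    simp only [key] at hab
    rw [add_mul] at h1
    omega
  obtain ⟨A, v, h⟩ := exists_chain E key s
    (fun A hA => by rw [← Finset.card_pos, hE A hA]; omega) hcol
  have hlt : ∀ i < s + 1, key (v i) < key (v (i + 1)) := by
    intro i hi
    obtain ⟨hA, h1, h2, h3⟩ := h i hi
    by_contra hle
    push Not at hle
    have : (A i).card ≤ 1 := by
      rw [Finset.card_le_one]
      intro a ha b hb
      apply keyinj
      have := h3 a ha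
      have := h3 b hb
      omega
    rw [hE _ hA] at this
    omega
  have hmono : ∀ d i, i + d ≤ s + 1 → key (v i) ≤ key (v (i + d)) := by
    intro d
    induction d with
    | zero => intro i _; simp
    | succ d ih =>
      intro i hi
      have := ih i (by omega)
      have := hlt (i + d) (by omega)
      rw [← add_assoc]; omega
  refine ⟨fun i => A i, v, ⟨?_, ?_⟩, fun i => (h i i.2).1, ?_⟩
  · intro i j hij
    rw [Finset.disjoint_left]
    intro u hu hu'
    have h1 := ((h i i.2).2.2.2 u hu).2
    have h2 := ((h j j.2).2.2.2 u hu').1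
    have h3 : key (v (i + 1)) < key (v (i + 2)) := hlt (i + 1) (by omega)
    have h4 := hmono (j - (i + 2)) (i + 2) (by omega)
    rw [show (i : ℕ) + 2 + (j - (i + 2)) = j by omega] at h4
    omega
  · intro k
    rw [Finset.card_eq_one]
    refine ⟨v (k + 1), ?_⟩
    have hk := h k (by omega)
    have hk' := h (k + 1) (by omega)
    ext u
    simp only [Fin.val_castSucc, Fin.val_succ, Finset.mem_inter, Finset.mem_singleton]
    constructor
    · rintro ⟨h1, h2⟩
      apply keyinj
      have := hk.2.2.2 u h1
      have := hk'.2.2.2 u h2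
      omega
    · rintro rfl
      exact ⟨hk.2.2.1, hk'.2.1⟩
  · intro i u hu
    have := (h i i.2).2.2.2 u hu
    exact ⟨keyw _ _ this.1, keyw _ _ this.2⟩

lemma path_perm {s : ℕ} (ρ : Equiv.Perm (Fin (s + 1)))
    (h : ∀ k : Fin s, (ρ k.castSucc : ℕ) ≤ ρ k.succ + 1 ∧ (ρ k.succ : ℕ) ≤ ρ k.castSucc + 1) :
    ρ = 1 ∨ ρ = Fin.revPerm := by
  let f : ℕ → ℤ := fun i => if hi : i < s + 1 then ((ρ ⟨i, hi⟩ : ℕ) : ℤ) else 0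
  have hf : ∀ i (hi : i < s + 1), f i = ((ρ ⟨i, hi⟩ : ℕ) : ℤ) := fun i hi => dif_pos hi
  have hfinj : ∀ i j, i < s + 1 → j < s + 1 → f i = f j → i = j := by
    intro i j hi hj hij
    rw [hf i hi, hf j hj] at hij
    have := ρ.injective (Fin.ext (by exact_mod_cast hij))
    simpa using this
  have hstep : ∀ i, i < s → f (i + 1) = f i + 1 ∨ f (i + 1) = f i - 1 := by
    intro i hi
    have h1 := h ⟨i, hi⟩
    have h2 : f (i + 1) ≠ f i := fun hh => by
      have := hfinj _ _ (by omega) (by omega) hh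
      omega
    have h3 := hf i (by omega)
    have h4 := hf (i + 1) (by omega)
    simp only [Fin.castSucc_mk, Fin.succ_mk] at h1
    omega
  have hrange : ∀ i, i < s + 1 → 0 ≤ f i ∧ f i ≤ s := by
    intro i hi
    rw [hf i hi]
    have := (ρ ⟨i, hi⟩).2
    omega
  rcases Nat.eq_zero_or_pos s with rfl | hs
  · left; ext i; omega
  rcases hstep 0 hs with h0 | h0
  · left
    have key : ∀ i, i < s → f (i + 1) = f i + 1 := by
      intro i
      induction i with
      | zero => intro _; exact h0
      | succ i ih =>
        intro hi
        have h1 := ih (by omega)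
        rcases hstep (i + 1) hi with h2 | h2
        · exact h2
        · have := hfinj (i + 1 + 1) i (by omega) (by omega) (by omega)
          omega
    have key2 : ∀ i, i ≤ s → f i = f 0 + i := by
      intro i
      induction i with
      | zero => intro _; simp
      | succ i ih => intro hi; rw [key i (by omega), ih (by omega)]; push_cast; ring
    have h1 := hrange 0 (by omega)
    have h2 := hrange s (by omega)
    have h3 := key2 s le_rfl
    ext i
    have h4 := key2 i (by omega)
    rw [hf i i.2] at h4
    simp only [Fin.eta] at h4
    simp only [Equiv.Perm.coe_one, id_eq]
    omega
  · right
    have key : ∀ i, i < s → f (i + 1) = f i - 1 := by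
      intro i
      induction i with
      | zero => intro _; exact h0
      | succ i ih =>
        intro hi
        have h1 := ih (by omega)
        rcases hstep (i + 1) hi with h2 | h2
        · have := hfinj (i + 1 + 1) i (by omega) (by omega) (by omega)
          omega
        · exact h2
    have key2 : ∀ i, i ≤ s → f i = f 0 - i := by
      intro i
      induction i with
      | zero => intro _; simp
      | succ i ih => intro hi; rw [key i (by omega), ih (by omega)]; push_cast; ring
    have h1 := hrange 0 (by omega)
    have h2 := hrange s (by omega)
    have h3 := key2 s le_rfl
    ext i
    have h4 := key2 i (by omega)
    rw [hf i i.2] at h4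
    simp only [Fin.eta] at h4
    simp only [Fin.revPerm_apply, Fin.val_rev]
    omega

open Classical in
lemma pathTuple_count {V : Type} [Fintype V] [DecidableEq V] (E : Finset (Finset V)) (s : ℕ) :
    (s + 1).factorial *
      ((Fintype.piFinset (fun _ : Fin (s + 1) => E)).filter (fun A => IsPathTuple A)).card
      ≤ 2 * E.card ^ (s + 1) := by
  set T := (Fintype.piFinset (fun _ : Fin (s + 1) => E)).filter (fun A => IsPathTuple A) with hT
  have h1 : (T ×ˢ (Finset.univ : Finset (Equiv.Perm (Fin (s + 1))))).card ≤
      2 * (Fintype.piFinset (fun _ : Fin (s + 1) => E)).card := by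
    apply Finset.card_le_mul_card_image_of_maps_to
      (f := fun x : (Fin (s + 1) → Finset V) × Equiv.Perm (Fin (s + 1)) => x.1 ∘ x.2)
    · rintro ⟨A, σ⟩ hx
      simp only [hT, Finset.mem_product, Finset.mem_filter, Fintype.mem_piFinset] at hx ⊢
      exact fun i => hx.1.1 (σ i)
    · intro B _
      rcases ((T ×ˢ (Finset.univ : Finset (Equiv.Perm (Fin (s + 1))))).filter
        (fun x => x.1 ∘ x.2 = B)).eq_empty_or_nonempty with he | ⟨⟨A, σ⟩, hA⟩
      · rw [he]; simp
      · have hsub : ((T ×ˢ (Finset.univ : Finset (Equiv.Perm (Fin (s + 1))))).filter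
          (fun x => x.1 ∘ x.2 = B)) ⊆ {(A, σ), (A ∘ Fin.revPerm, Fin.revPerm * σ)} := by
          rintro ⟨C, τ⟩ hC
          simp only [hT, Finset.mem_product, Finset.mem_filter, Finset.mem_univ, and_true] at hA hC
          obtain ⟨⟨-, hCp⟩, hCB⟩ := hC
          obtain ⟨⟨-, hAp⟩, hAB⟩ := hA
          have hCA : C = A ∘ (σ * τ⁻¹ : Equiv.Perm _) := by
            rw [← hAB] at hCB
            funext i
            have := congrFun hCB (τ⁻¹ i)
            simpa using this
          have hadj : ∀ k : Fin s, ¬ Disjoint (C k.castSucc) (C k.succ) := by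
            intro k hd
            have := hCp.2 k
            rw [Finset.disjoint_iff_inter_eq_empty.mp hd] at this
            simp at this
          have := path_perm (σ * τ⁻¹) (by
            intro k
            have hk := hadj k
            rw [hCA] at hk
            simp only [Function.comp] at hk
            constructor
            · by_contra hlt
              exact hk (hAp.1 _ _ (by omega)).symm
            · by_contra hlt
              exact hk (hAp.1 _ _ (by omega)))
          simp only [Finset.mem_insert, Finset.mem_singleton, Prod.mk.injEq]
          rcases this with h | h
          · left
            refine ⟨by rw [hCA, h]; rfl, ?_⟩
            exact (mul_inv_eq_one.mp h).symm
          · right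
            refine ⟨by rw [hCA, h], ?_⟩
            have h5 : σ = Fin.revPerm * τ := by rw [← h]; simp
            rw [h5]; ext i; simp
        exact (Finset.card_le_card hsub).trans Finset.card_le_two
  rw [Finset.card_product, Finset.card_univ, Fintype.card_perm, Fintype.card_fin,
    Fintype.card_piFinset_const] at h1
  rw [mul_comm]; exact h1

/-- Weights allowed for a vertex in a chain event. -/
def chainSet {V : Type} [DecidableEq V] {s : ℕ} (N : ℕ) (A : Fin (s + 1) → Finset V)
    (x : Fin (s + 2) → ℕ) (v : V) : Finset ℕ :=
  (range N).filter (fun y => ∀ i : Fin (s + 1), v ∈ A i → x i.castSucc ≤ y ∧ y ≤ x i.succ)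

lemma prod_ite_mem_pow {V : Type} [Fintype V] [DecidableEq V] (A : Finset V) (a : ℝ) :
    ∏ v : V, (if v ∈ A then a else 1) = a ^ A.card := by
  rw [Finset.prod_ite_mem, Finset.univ_inter, Finset.prod_const]

lemma chainSet_card {V : Type} [DecidableEq V] {s : ℕ} (N : ℕ) (hN : 0 < N)
    (A : Fin (s + 1) → Finset V) (hA : IsPathTuple A)
    (x : Fin (s + 2) → ℕ) (h : Fin (s + 1) → ℝ) (hpos : ∀ i, 0 < h i)
    (hh : ∀ i, (((Icc (x i.castSucc) (x i.succ)).card : ℕ) : ℝ) ≤ N * h i) (v : V) :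
    ((chainSet N A x v).card : ℝ) ≤ N * ((∏ i, if v ∈ A i then h i else 1) *
      ∏ k : Fin s, if v ∈ A k.castSucc ∩ A k.succ then
        ((N : ℝ) * (h k.castSucc * h k.succ))⁻¹ else 1) := by
  have hN' : (0 : ℝ) < N := by exact_mod_cast hN
  have hnear : ∀ i j, v ∈ A i → v ∈ A j → (j : ℕ) ≤ i + 1 := by
    intro i j hi hj
    by_contra hlt
    exact Finset.disjoint_left.mp (hA.1 i j (by omega)) hi hj
  by_cases hk : ∃ k : Fin s, v ∈ A k.castSucc ∩ A k.succ
  · obtain ⟨k, hk⟩ := hk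
    have hk1 := (Finset.mem_inter.mp hk).1
    have hk2 := (Finset.mem_inter.mp hk).2
    have e1 : (∏ i, if v ∈ A i then h i else 1) = h k.castSucc * h k.succ := by
      rw [Finset.prod_eq_mul k.castSucc k.succ]
      · rw [if_pos hk1, if_pos hk2]
      · intro hc
        have := congrArg Fin.val hc
        simp at this
      · intro j _ hj
        rw [if_neg]
        intro hvj
        have h1 := hnear _ _ hk1 hvj
        have h2 := hnear _ _ hvj hk2
        simp only [Fin.val_castSucc, Fin.val_succ] at h1 h2
        have : (j : ℕ) = k ∨ (j : ℕ) = k + 1 := by omega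
        rcases this with h | h
        · exact hj.1 (Fin.ext h)
        · exact hj.2 (Fin.ext h)
      · simp
      · simp
    have e2 : (∏ l : Fin s, if v ∈ A l.castSucc ∩ A l.succ then
        ((N : ℝ) * (h l.castSucc * h l.succ))⁻¹ else 1) =
        ((N : ℝ) * (h k.castSucc * h k.succ))⁻¹ := by
      rw [Finset.prod_eq_single k]
      · rw [if_pos hk]
      · intro l _ hl
        rw [if_neg]
        intro hvl
        have hl1 := (Finset.mem_inter.mp hvl).1
        have hl2 := (Finset.mem_inter.mp hvl).2
        have h1 := hnear _ _ hk1 hl2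
        have h2 := hnear _ _ hl1 hk2
        simp only [Fin.val_castSucc, Fin.val_succ] at h1 h2
        exact hl (Fin.ext (by omega))
      · simp
    rw [e1, e2]
    have hc : (chainSet N A x v).card ≤ 1 := by
      have : chainSet N A x v ⊆ {x k.succ.castSucc} := by
        intro y hy
        simp only [chainSet, Finset.mem_filter] at hy
        have h1 := hy.2 _ hk1
        have h2 := hy.2 _ hk2
        rw [Finset.mem_singleton]
        rw [Fin.succ_castSucc] at h1
        omega
      simpa using Finset.card_le_card this
    have h1 := hpos k.castSucc
    have h2 := hpos k.succ
    have : (N : ℝ) * (h k.castSucc * h k.succ * ((N : ℝ) * (h k.castSucc * h k.succ))⁻¹) = 1 := by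
      field_simp
    rw [this]
    exact_mod_cast hc
  · push Not at hk
    have e2 : (∏ l : Fin s, if v ∈ A l.castSucc ∩ A l.succ then
        ((N : ℝ) * (h l.castSucc * h l.succ))⁻¹ else 1) = 1 :=
      Finset.prod_eq_one fun l _ => if_neg (hk l)
    rw [e2, mul_one]
    by_cases hi : ∃ i, v ∈ A i
    · obtain ⟨i, hi⟩ := hi
      have e1 : (∏ i, if v ∈ A i then h i else 1) = h i := by
        rw [Finset.prod_eq_single i]
        · rw [if_pos hi]
        · intro j _ hj
          rw [if_neg]
          intro hvj
          have h1 := hnear _ _ hi hvj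
          have h2 := hnear _ _ hvj hi
          have h3 : (i : ℕ) ≠ j := fun hh => hj (Fin.ext hh.symm)
          have h4 := i.2
          have h5 := j.2
          rcases Nat.lt_or_gt_of_ne h3 with h6 | h6
          · apply hk ⟨i, by omega⟩
            rw [Finset.mem_inter]
            exact ⟨hi, by convert hvj using 2; ext; simp; omega⟩
          · apply hk ⟨j, by omega⟩
            rw [Finset.mem_inter]
            exact ⟨hvj, by convert hi using 2; ext; simp; omega⟩
        · simp
      rw [e1]
      refine le_trans ?_ (hh i)
      have : chainSet N A x v ⊆ Icc (x i.castSucc) (x i.succ) := by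
        intro y hy
        simp only [chainSet, Finset.mem_filter] at hy
        exact Finset.mem_Icc.mpr (hy.2 i hi)
      exact_mod_cast Finset.card_le_card this
    · push Not at hi
      have e1 : (∏ i, if v ∈ A i then h i else 1) = 1 :=
        Finset.prod_eq_one fun l _ => if_neg (hi l)
      rw [e1, mul_one]
      have : (chainSet N A x v).card ≤ (range N).card := Finset.card_le_card (Finset.filter_subset _ _)
      rw [Finset.card_range] at this
      exact_mod_cast this

lemma chainEvent_card {V : Type} [Fintype V] [DecidableEq V] {s : ℕ} (N : ℕ) (hN : 0 < N)
    (A : Fin (s + 1) → Finset V) (hA : IsPathTuple A) (m : ℕ) (hcard : ∀ i, (A i).card = m + 2)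
    (x : Fin (s + 2) → ℕ) (h : Fin (s + 1) → ℝ) (hpos : ∀ i, 0 < h i)
    (hh : ∀ i, (((Icc (x i.castSucc) (x i.succ)).card : ℕ) : ℝ) ≤ N * h i) :
    ((Fintype.piFinset (chainSet N A x)).card : ℝ) ≤
      (N : ℝ) ^ Fintype.card V * ((∏ i, h i) ^ m * (h 0 * h (Fin.last s)) * (1 / (N : ℝ)) ^ s) := by
  have hN' : (0 : ℝ) < N := by exact_mod_cast hN
  rw [Fintype.card_piFinset]
  push_cast
  refine (Finset.prod_le_prod (fun _ _ => Nat.cast_nonneg _)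
    (fun v _ => chainSet_card N hN A hA x h hpos hh v)).trans (le_of_eq ?_)
  rw [Finset.prod_mul_distrib, Finset.prod_const, Finset.card_univ, Finset.prod_mul_distrib,
    Finset.prod_comm, Finset.prod_comm (s := Finset.univ (α := V))]
  simp only [prod_ite_mem_pow, hcard, hA.2, pow_one]
  congr 1
  rw [Finset.prod_pow, Finset.prod_inv_distrib, Finset.prod_mul_distrib, Finset.prod_mul_distrib,
    Finset.prod_const, Finset.card_univ, Fintype.card_fin]
  have p1 := Fin.prod_univ_castSucc h
  have p2 := Fin.prod_univ_succ h
  have q1 : 0 < ∏ k : Fin s, h k.castSucc := Finset.prod_pos fun _ _ => hpos _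
  have q2 : 0 < ∏ k : Fin s, h k.succ := Finset.prod_pos fun _ _ => hpos _
  have e : (∏ i, h i) ^ (m + 2) =
      (∏ i, h i) ^ m * ((∏ k : Fin s, h k.castSucc) * h (Fin.last s)) *
        (h 0 * ∏ k : Fin s, h k.succ) := by
    rw [← p1, ← p2]; ring
  rw [e]
  generalize (∏ i, h i) = P
  rw [one_div_pow]
  field_simp

lemma amgm_fin {s : ℕ} (h : Fin (s + 1) → ℝ) (hpos : ∀ i, 0 ≤ h i) :
    ∏ i, h i ≤ ((∑ i, h i) / (s + 1 : ℝ)) ^ (s + 1) := by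
  have h1 := Real.geom_mean_le_arith_mean_weighted (Finset.univ) (fun _ : Fin (s + 1) => 1 / (s + 1 : ℝ))
    h (fun _ _ => by positivity) (by simp; field_simp) (fun i _ => hpos i)
  rw [← Finset.mul_sum, Real.finsetProd_rpow _ _ (fun i _ => hpos i)] at h1
  have hp : 0 ≤ ∏ i, h i := Finset.prod_nonneg fun i _ => hpos i
  have h2 := pow_le_pow_left₀ (Real.rpow_nonneg hp _) h1 (s + 1)
  rw [← Real.rpow_natCast, ← Real.rpow_mul hp] at h2
  have h3 : (1 / (s + 1 : ℝ)) * ((s + 1 : ℕ) : ℝ) = 1 := by push_cast; field_simp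
  rw [h3, Real.rpow_one] at h2
  rwa [one_div_mul_eq_div] at h2

/-- The event that all weights of `A` lie in `[a, a + L)`. -/
def badEvent {V : Type} [Fintype V] [DecidableEq V] (N L : ℕ) (A : Finset V) (a : ℕ) :
    Finset (V → ℕ) :=
  Fintype.piFinset (fun v => if v ∈ A then Ico a (a + L) else range N)

lemma badEvent_card {V : Type} [Fintype V] [DecidableEq V] (N L : ℕ) (hN : 0 < N)
    (A : Finset V) (a : ℕ) :
    ((badEvent N L A a).card : ℝ) = (N : ℝ) ^ Fintype.card V * ((L : ℝ) / N) ^ A.card := by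
  have hN' : (0 : ℝ) < N := by exact_mod_cast hN
  rw [badEvent, Fintype.card_piFinset]
  push_cast
  rw [← prod_ite_mem_pow, ← Finset.card_univ, ← Finset.prod_const, ← Finset.prod_mul_distrib]
  refine Finset.prod_congr rfl fun v _ => ?_
  split_ifs
  · simp; field_simp
  · simp

/-- Possible positions of the connecting vertices. -/
def posSet (s L D : ℕ) : Finset (Fin (s + 2) → ℕ) :=
  Fintype.piFinset (fun i => if i = 0 then {0} else
    if i = Fin.last (s + 1) then {(s + 1) * L + D - 1} else Ico (i * L) (i * L + D))

lemma posSet_card (s L D : ℕ) : (posSet s L D).card = D ^ s := by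
  rw [posSet, Fintype.card_piFinset, Fin.prod_univ_succ, Fin.prod_univ_castSucc]
  have h1 : ∀ i : Fin s, (i.castSucc.succ : Fin (s + 2)) ≠ Fin.last (s + 1) := by
    intro i hi
    have := congrArg Fin.val hi
    simp at this
    omega
  have h2 : ∀ i : Fin (s + 1), (i.succ : Fin (s + 2)) ≠ 0 := Fin.succ_ne_zero
  simp [h1, h2]

lemma posSet_spec (s L D : ℕ) (hD : 1 ≤ D) (x : Fin (s + 2) → ℕ) (hx : x ∈ posSet s L D) :
    x 0 = 0 ∧ x (Fin.last (s + 1)) + 1 = (s + 1) * L + D ∧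
      ∀ i : Fin (s + 2), i * L ≤ x i ∧ x i + 1 ≤ i * L + D := by
  rw [posSet, Fintype.mem_piFinset] at hx
  have h0 : x 0 = 0 := by simpa using hx 0
  have h1 : x (Fin.last (s + 1)) + 1 = (s + 1) * L + D := by
    have := hx (Fin.last (s + 1))
    have h2 : (Fin.last (s + 1)) ≠ 0 := by
      intro hi
      have := congrArg Fin.val hi
      simp at this
    rw [if_neg h2, if_pos rfl, Finset.mem_singleton] at this
    omega
  refine ⟨h0, h1, fun i => ?_⟩
  by_cases hi0 : i = 0
  · subst hi0; simp [h0, hD]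
  by_cases hil : i = Fin.last (s + 1)
  · subst hil
    simp only [Fin.val_last]
    omega
  have := hx i
  rw [if_neg hi0, if_neg hil, Finset.mem_Ico] at this
  omega

lemma chain_bound {V : Type} [Fintype V] [DecidableEq V] {s : ℕ} (L D m : ℕ) (hD : 1 ≤ D)
    (hDL : D ≤ L) (A : Fin (s + 1) → Finset V) (hA : IsPathTuple A)
    (hcard : ∀ i, (A i).card = m + 2)
    (x : Fin (s + 2) → ℕ) (hx : x ∈ posSet s L D) (N : ℕ) (hN : N = (s + 1) * L + D) :
    ((Fintype.piFinset (chainSet N A x)).card : ℝ) ≤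
      (N : ℝ) ^ Fintype.card V * ((((1 + s / (N : ℝ)) / (s + 1 : ℝ)) ^ (s + 1)) ^ m *
        (((L : ℝ) + D) / N) ^ 2 * (1 / (N : ℝ)) ^ s) := by
  obtain ⟨hx0, hx1, hx2⟩ := posSet_spec s L D hD x hx
  have hNpos : 0 < N := by omega
  have hN' : (0 : ℝ) < N := by exact_mod_cast hNpos
  have hmono : ∀ i : Fin (s + 1), x i.castSucc ≤ x i.succ := by
    intro i
    have h1 := hx2 i.castSucc
    have h2 := hx2 i.succ
    simp only [Fin.val_castSucc, Fin.val_succ, add_mul] at h1 h2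
    omega
  set h : Fin (s + 1) → ℝ := fun i => ((x i.succ : ℝ) + 1 - x i.castSucc) / N with hh
  have hpos : ∀ i, 0 < h i := by
    intro i
    have : (x i.castSucc : ℝ) ≤ x i.succ := by exact_mod_cast hmono i
    apply div_pos _ hN'
    linarith
  have hc := chainEvent_card N hNpos A hA m hcard x h hpos (by
    intro i
    rw [Nat.card_Icc, Nat.cast_sub (by have := hmono i; omega)]
    simp only [hh]
    push_cast
    rw [mul_div_cancel₀ _ hN'.ne'])
  refine hc.trans ?_
  have hsum : ∑ i, h i = 1 + s / (N : ℝ) := by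
    simp only [hh]
    rw [← Finset.sum_div, Finset.sum_sub_distrib, Finset.sum_add_distrib]
    have t1 := Fin.sum_univ_castSucc (fun i => (x i : ℝ))
    have t2 := Fin.sum_univ_succ (fun i => (x i : ℝ))
    have t3 : (x (Fin.last (s + 1)) : ℝ) + 1 = N := by rw [hN]; exact_mod_cast hx1
    simp only [hx0, Nat.cast_zero] at t2
    simp only [Finset.sum_const, Finset.card_univ, Fintype.card_fin, nsmul_eq_mul, mul_one]
    push_cast
    field_simp
    linarith
  have ham := amgm_fin h (fun i => (hpos i).le)
  rw [hsum] at ham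
  have hf : h 0 ≤ ((L : ℝ) + D) / N := by
    have h1 := (hx2 (Fin.succ 0)).2
    simp only [Fin.val_succ, Fin.val_zero] at h1
    have h2 : (x (Fin.succ 0) : ℝ) + 1 ≤ L + D := by
      have : x (Fin.succ 0) + 1 ≤ L + D := by simpa using h1
      exact_mod_cast this
    simp only [hh]
    gcongr
    have : (0 : ℝ) ≤ x (Fin.castSucc (0 : Fin (s + 1))) := Nat.cast_nonneg _
    linarith
  have hl : h (Fin.last s) ≤ ((L : ℝ) + D) / N := by
    have h1 := (hx2 (Fin.castSucc (Fin.last s))).1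
    simp only [Fin.val_castSucc, Fin.val_last] at h1
    have h2 : (s : ℝ) * L ≤ x (Fin.castSucc (Fin.last s)) := by exact_mod_cast h1
    simp only [hh, Fin.succ_last]
    have t3 : (x (Fin.last (s + 1)) : ℝ) + 1 = (s + 1) * L + D := by exact_mod_cast hx1
    gcongr
    change (x (Fin.last (s + 1)) : ℝ) + 1 - _ ≤ _
    linarith
  have hp : 0 ≤ ∏ i, h i := Finset.prod_nonneg fun i _ => (hpos i).le
  have h0 := (hpos 0).le
  have h1 := (hpos (Fin.last s)).le
  rw [pow_two (((L : ℝ) + D) / N)]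
  gcongr

open Classical in
lemma cover {V : Type} [Fintype V] [DecidableEq V] (E : Finset (Finset V)) (s n L D N : ℕ)
    (hn : 2 ≤ n) (hD : 1 ≤ D) (hN : N = (s + 1) * L + D) (hE : ∀ A ∈ E, A.card = n)
    (hcol : ∀ c : V → Fin (s + 1), ∃ A ∈ E, ∃ i : Fin (s + 1), ∀ v ∈ A, c v = i) :
    Fintype.piFinset (fun _ : V => range N) ⊆
      (E.biUnion fun A => (range (s + 1)).biUnion fun i =>
        badEvent N L A (i * L) ∪ badEvent N L A (i * L + D)) ∪
      (((Fintype.piFinset (fun _ : Fin (s + 1) => E)).filter (fun A => IsPathTuple A)).biUnion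
        fun A => (posSet s L D).biUnion fun x => Fintype.piFinset (chainSet N A x)) := by
  intro w hw
  rw [Fintype.mem_piFinset] at hw
  have hw' : ∀ v, w v < N := fun v => Finset.mem_range.mp (hw v)
  rw [Finset.mem_union, or_iff_not_imp_left]
  intro hbad
  simp only [Finset.mem_biUnion, Finset.mem_union, not_exists, not_and, not_or,
    Finset.mem_range] at hbad
  have hbad1 : ∀ A ∈ E, ∀ i < s + 1, ∀ a, (a = i * L ∨ a = i * L + D) →
      ¬ ∀ v ∈ A, a ≤ w v ∧ w v < a + L := by
    intro A hA i hi a ha hall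
    have hmem : w ∈ badEvent N L A a := by
      rw [badEvent, Fintype.mem_piFinset]
      intro v
      split_ifs with hv
      · exact Finset.mem_Ico.mpr (hall v hv)
      · exact hw v
    rcases ha with rfl | rfl
    · exact (hbad A hA i hi).1 hmem
    · exact (hbad A hA i hi).2 hmem
  obtain ⟨A, v, hA, hAE, hv⟩ := exists_pathTuple E w s n hn hE hcol
  have hlow : ∀ i, i ≤ s + 1 → i * L ≤ w (v i) := by
    intro i
    induction i with
    | zero => intro _; simp
    | succ i ih =>
      intro hi
      have h1 := ih (by omega)
      by_contra hlt
      apply hbad1 (A ⟨i, hi⟩) (hAE _) i hi _ (Or.inl rfl)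
      intro u hu
      have := hv ⟨i, hi⟩ u hu
      rw [add_mul] at hlt
      simp only at this
      omega
  have hup : ∀ d i, i + d = s + 1 → w (v i) < i * L + D := by
    intro d
    induction d with
    | zero => intro i hi; have := hw' (v i); rw [hN] at this; rw [← hi] at this; simpa using this
    | succ d ih =>
      intro i hi
      have h1 := ih (i + 1) (by omega)
      by_contra hlt
      apply hbad1 (A ⟨i, by omega⟩) (hAE _) i (by omega) _ (Or.inr rfl)
      intro u hu
      have := hv ⟨i, by omega⟩ u hu
      rw [add_mul] at h1
      simp only at this
      omega
  simp only [Finset.mem_biUnion, Finset.mem_filter, Fintype.mem_piFinset]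
  refine ⟨A, ⟨hAE, hA⟩, fun i => if i = 0 then 0 else
    if i = Fin.last (s + 1) then N - 1 else w (v i), ?_, ?_⟩
  · rw [posSet, Fintype.mem_piFinset]
    intro i
    split_ifs
    · simp
    · simp [hN]
    · rw [Finset.mem_Ico]
      exact ⟨hlow i (by omega), hup (s + 1 - i) i (by omega)⟩
  · intro u
    rw [chainSet, Finset.mem_filter]
    refine ⟨hw u, fun i hi => ?_⟩
    have h1 := hv i u hi
    have h2 := hw' u
    constructor
    · split_ifs
      · omega
      · have := i.2
        rename_i _ h3
        have := congrArg Fin.val h3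
        simp at this
        omega
      · exact h1.1
    · rw [if_neg (Fin.succ_ne_zero i)]
      split_ifs
      · omega
      · exact h1.2

lemma main_finite {V : Type} [Fintype V] [DecidableEq V] (E : Finset (Finset V)) (s m L D N : ℕ)
    (hD : 1 ≤ D) (hDL : D ≤ L) (hN : N = (s + 1) * L + D) (hE : ∀ A ∈ E, A.card = m + 2)
    (hcol : ∀ c : V → Fin (s + 1), ∃ A ∈ E, ∃ i : Fin (s + 1), ∀ v ∈ A, c v = i) :
    (1 : ℝ) ≤ 2 * (s + 1) * E.card * ((L : ℝ) / N) ^ (m + 2) +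
      2 * (E.card : ℝ) ^ (s + 1) / (s + 1).factorial * (((D : ℝ) / N) ^ s *
        (((1 + s / (N : ℝ)) / (s + 1 : ℝ)) ^ (s + 1)) ^ m * (((L : ℝ) + D) / N) ^ 2) := by
  classical
  have hNpos : 0 < N := by omega
  have hN' : (0 : ℝ) < N := by exact_mod_cast hNpos
  have h1 := Finset.card_le_card (cover E s (m + 2) L D N (by omega) hD hN hE hcol)
  rw [Fintype.card_piFinset, Finset.prod_const, Finset.card_range, Finset.card_univ] at h1
  set T := (Fintype.piFinset (fun _ : Fin (s + 1) => E)).filter (fun A => IsPathTuple A) with hT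
  have hTc : (T.card : ℝ) ≤ 2 * (E.card : ℝ) ^ (s + 1) / (s + 1).factorial := by
    rw [le_div_iff₀ (by positivity), mul_comm]
    exact_mod_cast pathTuple_count E s
  set Q : ℝ := (N : ℝ) ^ Fintype.card V with hQ
  have hQpos : 0 < Q := by positivity
  set B : ℝ := ((L : ℝ) / N) ^ (m + 2)
  set C : ℝ := (((1 + s / (N : ℝ)) / (s + 1 : ℝ)) ^ (s + 1)) ^ m *
        (((L : ℝ) + D) / N) ^ 2 * (1 / (N : ℝ)) ^ s with hC
  have hb1 : (((E.biUnion fun A => (range (s + 1)).biUnion fun i =>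
        badEvent N L A (i * L) ∪ badEvent N L A (i * L + D)).card : ℕ) : ℝ) ≤
        E.card * ((s + 1) * (2 * (Q * B))) := by
    refine (Nat.cast_le.mpr Finset.card_biUnion_le).trans ?_
    push_cast
    rw [← nsmul_eq_mul]
    refine Finset.sum_le_card_nsmul _ _ _ fun A hA => ?_
    refine (Nat.cast_le.mpr Finset.card_biUnion_le).trans ?_
    push_cast
    have : ((s : ℝ) + 1) * (2 * (Q * B)) = (range (s + 1)).card • (2 * (Q * B)) := by
      rw [nsmul_eq_mul, Finset.card_range]; push_cast; rfl
    rw [this]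
    refine Finset.sum_le_card_nsmul _ _ _ fun i hi => ?_
    refine (Nat.cast_le.mpr (Finset.card_union_le _ _)).trans ?_
    push_cast
    rw [badEvent_card N L hNpos, badEvent_card N L hNpos, hE A hA]
    linarith
  have hb2 : (((T.biUnion
        fun A => (posSet s L D).biUnion fun x => Fintype.piFinset (chainSet N A x)).card : ℕ) : ℝ) ≤
        T.card * ((D : ℝ) ^ s * (Q * C)) := by
    refine (Nat.cast_le.mpr Finset.card_biUnion_le).trans ?_
    push_cast
    rw [← nsmul_eq_mul]
    refine Finset.sum_le_card_nsmul _ _ _ fun A hA => ?_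
    refine (Nat.cast_le.mpr Finset.card_biUnion_le).trans ?_
    push_cast
    have : (D : ℝ) ^ s * (Q * C) = (posSet s L D).card • (Q * C) := by
      rw [nsmul_eq_mul, posSet_card]; push_cast; rfl
    rw [this]
    refine Finset.sum_le_card_nsmul _ _ _ fun x hx => ?_
    rw [hT, Finset.mem_filter, Fintype.mem_piFinset] at hA
    exact chain_bound L D m hD hDL A hA.2 (fun i => hE _ (hA.1 i)) x hx N hN
  have h2 : Q ≤ E.card * ((s + 1) * (2 * (Q * B))) + T.card * ((D : ℝ) ^ s * (Q * C)) := by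
    have h3 := h1.trans (Finset.card_union_le _ _)
    have h4 : ((N ^ Fintype.card V : ℕ) : ℝ) ≤ _ := Nat.cast_le.mpr h3
    push_cast at h4
    linarith
  have hCnn : 0 ≤ C := by positivity
  have h3 : (T.card : ℝ) * ((D : ℝ) ^ s * (Q * C)) ≤
      2 * (E.card : ℝ) ^ (s + 1) / (s + 1).factorial * ((D : ℝ) ^ s * (Q * C)) := by
    gcongr
  have h4 : Q * 1 ≤ Q * (2 * (s + 1) * E.card * B +
      2 * (E.card : ℝ) ^ (s + 1) / (s + 1).factorial * ((D : ℝ) ^ s * C)) := by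
    linarith
  have h5 := le_of_mul_le_mul_left h4 hQpos
  refine h5.trans (le_of_eq ?_)
  rw [hC, div_pow (D : ℝ), one_div_pow]
  ring

open Filter Topology in
lemma analytic_lim (s : ℕ) (hs : 1 ≤ s) (q c : ℝ) (r : ℝ) (hr : r = s + 1)
    (hc : c * (s / r) ^ s < 1) (p U : ℕ → ℝ) (hp : p = fun n : ℕ => s / r * (Real.log n / n))
    (hU : U = fun n : ℕ => p n / (1 - p n) + 1 / (n : ℝ) ^ 2) :
    Tendsto p atTop (𝓝 0) ∧ Tendsto U atTop (𝓝 0) ∧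
    ∀ᶠ n : ℕ in atTop, 2 * q * (Real.log n) ^ (-((s : ℝ) / r)) +
      c * (((n : ℝ) / Real.log n * U n) ^ s * Real.exp (s * r / n) * (1 + r * U n) ^ 2) < 1 := by
  have hrpos : 0 < r := by rw [hr]; positivity
  have hspos : (0 : ℝ) < s := by exact_mod_cast hs
  have hlog : Tendsto (fun n : ℕ => Real.log n) atTop atTop :=
    Real.tendsto_log_atTop.comp tendsto_natCast_atTop_atTop
  have hln : Tendsto (fun n : ℕ => Real.log n / (n : ℝ)) atTop (𝓝 0) := by
    have := (Real.isLittleO_log_id_atTop.tendsto_div_nhds_zero).comp (tendsto_natCast_atTop_atTop (R := ℝ))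
    exact this
  have hp0 : Tendsto p atTop (𝓝 0) := by
    rw [hp]; simpa using hln.const_mul ((s : ℝ) / r)
  have hinv : Tendsto (fun n : ℕ => 1 / (n : ℝ)) atTop (𝓝 0) := tendsto_one_div_atTop_nhds_zero_nat
  have h1p : Tendsto (fun n => 1 - p n) atTop (𝓝 1) := by simpa using hp0.const_sub 1
  have hU0 : Tendsto U atTop (𝓝 0) := by
    rw [hU]
    have h2 : Tendsto (fun n : ℕ => 1 / (n : ℝ) ^ 2) atTop (𝓝 0) := by
      have := hinv.pow 2
      simpa using this
    simpa using (hp0.div h1p one_ne_zero).add h2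
  refine ⟨hp0, hU0, ?_⟩
  have hnU : Tendsto (fun n : ℕ => (n : ℝ) / Real.log n * U n) atTop (𝓝 (s / r)) := by
    have h2 : Tendsto (fun n : ℕ => s / r / (1 - p n) + (1 / (n : ℝ)) * (Real.log n)⁻¹) atTop
        (𝓝 (s / r / 1 + 0 * 0)) :=
      (tendsto_const_nhds.div h1p one_ne_zero).add (hinv.mul (tendsto_inv_atTop_zero.comp hlog))
    have h3 : Tendsto (fun n : ℕ => s / r / (1 - p n) + (1 / (n : ℝ)) * (Real.log n)⁻¹) atTop
        (𝓝 (s / r)) := by simpa using h2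
    refine h3.congr' ?_
    filter_upwards [eventually_ge_atTop 2, h1p.eventually (lt_mem_nhds zero_lt_one)] with n hn h1
    have hn' : (0 : ℝ) < n := by exact_mod_cast (by omega : 0 < n)
    have hl : 0 < Real.log n := Real.log_pos (by exact_mod_cast hn)
    rw [hU]
    simp only
    have e : (n : ℝ) / Real.log n * (p n / (1 - p n)) = s / r / (1 - p n) := by
      have : (n : ℝ) / Real.log n * p n = s / r := by
        rw [hp]; simp only; field_simp
      rw [← mul_div_assoc, this]
    rw [mul_add, e]
    congr 1
    field_simp
  have hexp : Tendsto (fun n : ℕ => Real.exp (s * r / n)) atTop (𝓝 1) := by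
    have h2 : Tendsto (fun n : ℕ => s * r / (n : ℝ)) atTop (𝓝 0) :=
      tendsto_const_div_atTop_nhds_zero_nat _
    have := (Real.continuous_exp.tendsto 0).comp h2
    rw [Real.exp_zero] at this
    exact this
  have hsq : Tendsto (fun n : ℕ => (1 + r * U n) ^ 2) atTop (𝓝 1) := by
    have := ((hU0.const_mul r).const_add 1).pow 2
    simpa using this
  have hfirst : Tendsto (fun n : ℕ => 2 * q * (Real.log n) ^ (-((s : ℝ) / r))) atTop (𝓝 0) := by
    have := ((tendsto_rpow_neg_atTop (y := (s : ℝ) / r) (by positivity)).comp hlog).const_mul (2 * q)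
    simpa using this
  have htot := hfirst.add ((((hnU.pow s).mul hexp).mul hsq).const_mul c)
  refine htot.eventually (gt_mem_nhds ?_)
  simpa using hc

lemma qprime_pow (s : ℕ) (hs : 1 ≤ s) :
    qprime (s + 1) ^ (s + 1) = (s + 1).factorial /
      (2 * ((s : ℝ) / (s + 1)) ^ s * (((s : ℝ) + 1) ^ (s + 1) / ((s : ℝ) + 1) ^ 2)) := by
  have key : ∀ x y : ℝ, 0 ≤ x → (x ^ (y / ((s : ℝ) + 1))) ^ (s + 1) = x ^ y := by
    intro x y hx
    rw [← Real.rpow_natCast, ← Real.rpow_mul hx]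
    congr 1
    push_cast
    field_simp
  have hspos : (0 : ℝ) < s := by exact_mod_cast hs
  have e1 : (1 : ℝ) - 1 / ((s : ℝ) + 1) = s / (s + 1) := by field_simp; ring
  unfold qprime
  push_cast
  rw [e1, div_pow, mul_pow, mul_pow, key _ _ (by positivity), key _ _ (by norm_num),
    key _ _ (by positivity), key _ _ (by positivity), Real.rpow_one, Real.rpow_one,
    show (s : ℝ) + 1 - 1 = (s : ℕ) by ring, Real.rpow_natCast,
    Real.rpow_sub (by positivity)]
  congr 3
  · rw [← Real.rpow_natCast]; push_cast; rfl
  · exact Real.rpow_two _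

set_option maxHeartbeats 2000000 in
theorem stmt_1 (r : ℕ) (hr : 2 ≤ r) (q : ℝ) (hq : q < qprime r) :
    ∃ n₀ : ℕ, ∀ n ≥ n₀,
      ∀ (V : Type) [Fintype V] [DecidableEq V] (E : Finset (Finset V)),
        (∀ A ∈ E, A.card = n) →
        (∀ c : V → Fin r, ∃ A ∈ E, ∃ i : Fin r, ∀ v ∈ A, c v = i) →
        (E.card : ℝ) ≥
          q * ((n : ℝ) / Real.log n) ^ (((r : ℝ) - 1) / r) * (r : ℝ) ^ (n - 1) := by
  obtain ⟨s, rfl⟩ : ∃ s, r = s + 1 := ⟨r - 1, by omega⟩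
  have hs : 1 ≤ s := by omega
  have hspos : (0 : ℝ) < s := by exact_mod_cast hs
  rcases le_or_gt q 0 with hq0 | hq0
  · refine ⟨1, fun n hn V _ _ E _ _ => ?_⟩
    have h1 : 0 ≤ ((n : ℝ) / Real.log n) ^ ((((s + 1 : ℕ) : ℝ) - 1) / ((s + 1 : ℕ) : ℝ)) :=
      Real.rpow_nonneg (div_nonneg (Nat.cast_nonneg _) (Real.log_natCast_nonneg n)) _
    have h2 : q * ((n : ℝ) / Real.log n) ^ ((((s + 1 : ℕ) : ℝ) - 1) / ((s + 1 : ℕ) : ℝ)) *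
        ((s + 1 : ℕ) : ℝ) ^ (n - 1) ≤ 0 :=
      mul_nonpos_of_nonpos_of_nonneg (mul_nonpos_of_nonpos_of_nonneg hq0 h1) (by positivity)
    exact h2.trans (Nat.cast_nonneg _)
  set R : ℝ := (s : ℝ) + 1 with hR
  have hRpos : 0 < R := by positivity
  set c : ℝ := 2 / (s + 1).factorial * q ^ (s + 1) * (R ^ (s + 1) / R ^ 2) with hc
  have hcpos : 0 < c := by positivity
  have hc1 : c * (s / R) ^ s < 1 := by
    have h1 := pow_lt_pow_left₀ hq hq0.le (Nat.succ_ne_zero s)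
    rw [Nat.succ_eq_add_one, qprime_pow s hs, lt_div_iff₀ (by positivity)] at h1
    have h2 : c * (s / R) ^ s = (q ^ (s + 1) *
      (2 * ((s : ℝ) / R) ^ s * (R ^ (s + 1) / R ^ 2))) / (s + 1).factorial := by
      rw [hc]; ring
    rw [h2, div_lt_one (by positivity)]
    exact h1
  set p : ℕ → ℝ := fun n : ℕ => s / R * (Real.log n / n) with hp
  set U : ℕ → ℝ := fun n : ℕ => p n / (1 - p n) + 1 / (n : ℝ) ^ 2 with hU
  obtain ⟨hp0, hU0, hlim⟩ := analytic_lim s hs q c R hR hc1 p U hp hU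
  have hev := (hlim.and ((hp0.eventually (gt_mem_nhds zero_lt_one)).and
    ((hU0.eventually (gt_mem_nhds (by positivity : (0 : ℝ) < 1 / R))).and
      (Filter.eventually_ge_atTop 2))))
  obtain ⟨n₀, hn₀⟩ := Filter.eventually_atTop.mp hev
  refine ⟨n₀, fun n hn V _ _ E hE hcol => ?_⟩
  obtain ⟨hfin, hp1, hU1, hn2⟩ := hn₀ n hn
  obtain ⟨m, rfl⟩ : ∃ m, n = m + 2 := ⟨n - 2, by omega⟩
  by_contra hcon
  push Not at hcon
  generalize hn' : m + 2 = n at *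
  have hnpos : (0 : ℝ) < n := by exact_mod_cast (by omega : 0 < n)
  have hlogpos : 0 < Real.log n := Real.log_pos (by exact_mod_cast hn2)
  have hppos : 0 < p n := by simp only [hp]; positivity
  have h1p : 0 < 1 - p n := by linarith
  -- parameters
  set L : ℕ := n ^ 2 with hL
  have hLpos : (0 : ℝ) < L := by rw [hL]; positivity
  set D : ℕ := ⌈p n * R * L / (1 - p n)⌉₊ with hD
  set N : ℕ := (s + 1) * L + D with hN
  have hNR : (N : ℝ) = R * L + D := by rw [hN, hR]; push_cast; ring
  have hNpos : (0 : ℝ) < N := by rw [hNR]; positivity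
  have hDlow : p n * R * L / (1 - p n) ≤ D := Nat.le_ceil _
  have hDup : (D : ℝ) ≤ R * L * U n := by
    have h1 : (D : ℝ) < p n * R * L / (1 - p n) + 1 := Nat.ceil_lt_add_one (by positivity)
    have h2 : R * L * U n = p n * R * L / (1 - p n) + R := by
      simp only [hU, hL]; push_cast; field_simp
    have : 1 ≤ R := by rw [hR]; linarith
    linarith
  have hD1 : 1 ≤ D := by
    rw [hD, Nat.one_le_iff_ne_zero, ← Nat.pos_iff_ne_zero, Nat.ceil_pos]
    positivity
  have hDL : D ≤ L := by
    have h1 : R * L * U n ≤ R * L * (1 / R) := by gcongr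
    have h2 : R * L * (1 / R) = L := by field_simp
    exact_mod_cast (by linarith : (D : ℝ) ≤ L)
  have hUpos : 0 < U n := by simp only [hU]; positivity
  have hDN1 : p n ≤ D / N := by
    rw [le_div_iff₀ hNpos, hNR]
    rw [div_le_iff₀ h1p] at hDlow
    linarith
  have hDN2 : (D : ℝ) / N ≤ U n := by
    rw [div_le_iff₀ hNpos, hNR]
    nlinarith [mul_nonneg hUpos.le (Nat.cast_nonneg (α := ℝ) D)]
  have hLN : (L : ℝ) / N ≤ Real.exp (-p n) / R := by
    have h1 : (L : ℝ) / N = (1 - D / N) / R := by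
      have : (D : ℝ) = N - R * L := by linarith
      rw [this]; field_simp; ring
    rw [h1]
    have := Real.add_one_le_exp (-p n)
    gcongr
    linarith
  have hLDN : ((L : ℝ) + D) / N ≤ (1 + R * U n) / R := by
    rw [div_le_div_iff₀ hNpos hRpos, hNR]
    have : 0 ≤ R * U n * D := by positivity
    nlinarith
  have hmain := main_finite E s m L D N hD1 hDL hN (by rw [hn']; exact hE) hcol
  rw [← hR] at hmain
  -- edge bound
  set a : ℝ := ((n : ℝ) / Real.log n) ^ ((s : ℝ) / R) with ha
  have hapos : 0 < a := Real.rpow_pos_of_pos (by positivity) _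
  have hE1 : (E.card : ℝ) ≤ q * a * R ^ (n - 1) := by
    have := hcon.le
    push_cast at this
    rw [show (s : ℝ) + 1 - 1 = s by ring] at this
    exact this
  clear_value a c N D L U p R
  have hn1 : n - 1 = m + 1 := by omega
  rw [hn1] at hE1
  have harpow : a ^ (s + 1) = ((n : ℝ) / Real.log n) ^ s := by
    rw [ha, ← Real.rpow_natCast, ← Real.rpow_mul (by positivity), ← Real.rpow_natCast]
    congr 1
    push_cast
    rw [← hR]; field_simp
  have haexp : a * Real.exp (-p n) ^ (m + 2) = (Real.log n) ^ (-((s : ℝ) / R)) := by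
    rw [ha, hn', ← Real.exp_nat_mul, Real.div_rpow hnpos.le hlogpos.le, Real.rpow_neg hlogpos.le,
      Real.rpow_def_of_pos hnpos]
    have : (n : ℝ) * -p n = -(Real.log n * (s / R)) := by
      simp only [hp]; field_simp
    rw [this, Real.exp_neg]
    field_simp
  have ht1 : 2 * R * E.card * ((L : ℝ) / N) ^ (m + 2) ≤
      2 * q * (Real.log n) ^ (-((s : ℝ) / R)) := by
    calc 2 * R * E.card * ((L : ℝ) / N) ^ (m + 2)
        ≤ 2 * R * (q * a * R ^ (m + 1)) * (Real.exp (-p n) / R) ^ (m + 2) := by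
          gcongr
      _ = 2 * q * (a * Real.exp (-p n) ^ (m + 2)) := by
          rw [div_pow]; field_simp; ring
      _ = _ := by rw [haexp]
  have hexpN : (((1 + s / (N : ℝ)) / R) ^ (s + 1)) ^ m ≤
      Real.exp (s * R / n) / (R ^ (s + 1)) ^ m := by
    rw [div_pow, div_pow]
    gcongr
    have h1 : 1 + s / (N : ℝ) ≤ Real.exp (s / N) := by
      have := Real.add_one_le_exp ((s : ℝ) / N); linarith
    calc ((1 + s / (N : ℝ)) ^ (s + 1)) ^ m ≤ (Real.exp (s / N) ^ (s + 1)) ^ m := by gcongr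
      _ = Real.exp (s * R * (m / N)) := by
        rw [← Real.exp_nat_mul, ← Real.exp_nat_mul]
        congr 1
        push_cast
        rw [hR]; ring
      _ ≤ Real.exp (s * R / n) := by
        rw [div_eq_mul_one_div ((s : ℝ) * R)]
        refine Real.exp_le_exp.mpr (mul_le_mul_of_nonneg_left ?_ (by positivity))
        rw [div_le_div_iff₀ hNpos hnpos, one_mul]
        have h2 : m * n ≤ N := by
          have : m * n ≤ L := by rw [hL, pow_two]; exact Nat.mul_le_mul_right _ (by omega)
          have : L ≤ N := by rw [hN, add_mul]; omega
          omega
        exact_mod_cast h2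
  have ht2 : 2 * (E.card : ℝ) ^ (s + 1) / (s + 1).factorial * (((D : ℝ) / N) ^ s *
        (((1 + s / (N : ℝ)) / R) ^ (s + 1)) ^ m * (((L : ℝ) + D) / N) ^ 2) ≤
      c * (((n : ℝ) / Real.log n * U n) ^ s * Real.exp (s * R / n) * (1 + R * U n) ^ 2) := by
    calc _ ≤ 2 * (q * a * R ^ (m + 1)) ^ (s + 1) / (s + 1).factorial * (U n ^ s *
        (Real.exp (s * R / n) / (R ^ (s + 1)) ^ m) * ((1 + R * U n) / R) ^ 2) := by
          gcongr
      _ = 2 * (q ^ (s + 1) * a ^ (s + 1) * ((R ^ (s + 1)) ^ m * R ^ (s + 1))) /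
          (s + 1).factorial * (U n ^ s *
        (Real.exp (s * R / n) / (R ^ (s + 1)) ^ m) * ((1 + R * U n) / R) ^ 2) := by
          congr 3
          ring
      _ = _ := by
          rw [harpow, hc, mul_pow _ (U n), div_pow (1 + R * U n)]
          have hZ : (R ^ (s + 1)) ≠ 0 := by positivity
          generalize (R ^ (s + 1)) = Z at hZ ⊢
          field_simp
  linarith
end

section
/- Fix an integer r ≥ 2. There exist a constant c > 0 and n₀ such that for all n ≥ n₀: if an n-uniform hypergraph has maximum edge degree D with D < c · (n/ln n)^{(r−1)/r} · r^{n−1}, then its chromatic number is at most r, i.e. there is a coloring of its vertices in r colors with no monochromatic edge. -/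
namespace HC

theorem indep_card {V K : Type*} [Fintype V] [DecidableEq V] [Fintype K] [DecidableEq K]
    (S : Finset V) (A C : Finset (V → K))
    (hA : ∀ ω ω', (∀ u ∈ S, ω u = ω' u) → ω ∈ A → ω' ∈ A)
    (hC : ∀ ω ω', (∀ u ∉ S, ω u = ω' u) → ω ∈ C → ω' ∈ C) :
    (A ∩ C).card * Fintype.card (V → K) ≤ A.card * C.card := by
  classical
  rw [← Finset.card_univ, ← Finset.card_product, ← Finset.card_product]
  let mix : (V → K) → (V → K) → (V → K) := fun a b u => if u ∈ S then a u else b u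
  apply Finset.card_le_card_of_injOn (fun q => (mix q.1 q.2, mix q.2 q.1))
  · rintro ⟨a, b⟩ h
    simp only [Finset.coe_product, Set.mem_prod, Finset.mem_coe, Finset.mem_inter] at h ⊢
    refine ⟨hA a _ ?_ h.1.1, hC a _ ?_ h.1.2⟩
    · intro u hu; simp [mix, hu]
    · intro u hu; simp [mix, hu]
  · rintro ⟨a, b⟩ - ⟨a', b'⟩ - h
    simp only [Prod.mk.injEq] at h
    obtain ⟨h1, h2⟩ := h
    have e1 : ∀ u, a u = a' u := by
      intro u
      have := congrFun h1 u
      have := congrFun h2 u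
      by_cases hu : u ∈ S <;> simp_all [mix]
    have e2 : ∀ u, b u = b' u := by
      intro u
      have := congrFun h1 u
      have := congrFun h2 u
      by_cases hu : u ∈ S <;> simp_all [mix]
    exact Prod.ext (funext e1) (funext e2)

theorem lll {V K ι : Type*} [Fintype V] [DecidableEq V] [Fintype K] [DecidableEq K]
    [DecidableEq ι] [Nonempty K]
    (I : Finset ι) (B : ι → Finset (V → K)) (S : ι → Finset V) (p : ι → ℝ)
    (hp : ∀ i ∈ I, 0 ≤ p i)
    (hdep : ∀ i ∈ I, ∀ ω ω', (∀ u ∈ S i, ω u = ω' u) → ω ∈ B i → ω' ∈ B i)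
    (hB : ∀ i ∈ I, ((B i).card : ℝ) ≤ p i * (Fintype.card (V → K) : ℝ))
    (hS : ∀ i ∈ I, (S i).Nonempty)
    (hsum : ∀ i ∈ I, ∑ j ∈ I.filter (fun j => (S i ∩ S j).Nonempty), p j ≤ 1 / 4) :
    ∃ ω, ∀ i ∈ I, ω ∉ B i := by
  classical
  let av : Finset ι → Finset (V → K) := fun T => Finset.univ.filter (fun ω => ∀ j ∈ T, ω ∉ B j)
  have hΩ : (0 : ℝ) < Fintype.card (V → K) := by exact_mod_cast Fintype.card_pos
  have key : ∀ m : ℕ, ∀ T ⊆ I, T.card = m → ∀ i ∈ I,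
      ((B i ∩ av T).card : ℝ) ≤ 2 * p i * (av T).card := by
    intro m
    induction m using Nat.strong_induction_on with
    | _ m ih =>
    intro T hT hm i hi
    set T1 := T.filter (fun j => (S i ∩ S j).Nonempty) with hT1
    set T2 := T.filter (fun j => ¬ (S i ∩ S j).Nonempty) with hT2
    have h1 : ((B i ∩ av T).card : ℝ) ≤ (B i ∩ av T2).card := by
      have : B i ∩ av T ⊆ B i ∩ av T2 := by
        intro ω h
        simp only [Finset.mem_inter, av, Finset.mem_filter, hT2] at h ⊢
        exact ⟨h.1, h.2.1, fun j hj => h.2.2 j hj.1⟩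
      exact_mod_cast Finset.card_le_card this
    have h2 : ((B i ∩ av T2).card : ℝ) ≤ p i * (av T2).card := by
      have := indep_card (S i) (B i) (av T2) (hdep i hi) (by
        intro ω ω' hag h
        simp only [av, Finset.mem_filter, Finset.mem_univ, true_and] at h ⊢
        intro j hj hj'
        refine h j hj (hdep j (hT (Finset.filter_subset _ _ hj)) ω' ω ?_ hj')
        intro u hu
        refine (hag u ?_).symm
        intro hui
        exact (Finset.mem_filter.1 hj).2 ⟨u, Finset.mem_inter.2 ⟨hui, hu⟩⟩)
      have h' : ((B i ∩ av T2).card : ℝ) * Fintype.card (V → K) ≤ (B i).card * (av T2).card := by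
        exact_mod_cast this
      have h'' := mul_le_mul_of_nonneg_right (hB i hi) (Nat.cast_nonneg (α := ℝ) (av T2).card)
      refine le_of_mul_le_mul_right (h'.trans (h''.trans (le_of_eq ?_))) hΩ
      ring
    have h3 : ((av T2).card : ℝ) ≤ (av T).card + ∑ j ∈ T1, ((B j ∩ av T2).card : ℝ) := by
      have : av T2 ⊆ av T ∪ T1.biUnion (fun j => B j ∩ av T2) := by
        intro ω h
        by_cases hω : ω ∈ av T
        · exact Finset.mem_union_left _ hω
        · apply Finset.mem_union_right
          have hω' := hω
          simp only [av, Finset.mem_filter, Finset.mem_univ, true_and, not_forall, not_not] at hω'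
          obtain ⟨j, hj, hjB⟩ := hω'
          simp only [Finset.mem_biUnion, Finset.mem_inter]
          refine ⟨j, ?_, hjB, h⟩
          rw [hT1, Finset.mem_filter]
          refine ⟨hj, ?_⟩
          by_contra hne
          have h5 := (Finset.mem_filter.1 h).2 j (Finset.mem_filter.2 ⟨hj, hne⟩)
          exact h5 hjB
      have h4 := (Finset.card_le_card this).trans (Finset.card_union_le _ _)
      have h5 := h4.trans (Nat.add_le_add_left Finset.card_biUnion_le _)
      exact_mod_cast h5
    have h4 : ∑ j ∈ T1, ((B j ∩ av T2).card : ℝ) ≤ ∑ j ∈ T1, 2 * p j * (av T2).card := by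
      apply Finset.sum_le_sum
      intro j hj
      have hjT : j ∈ T := (Finset.mem_filter.1 hj).1
      have hlt : T2.card < m := by
        rw [← hm]
        apply Finset.card_lt_card
        refine ⟨Finset.filter_subset _ _, fun hs => ?_⟩
        exact (Finset.mem_filter.1 (hs hjT)).2 (Finset.mem_filter.1 hj).2
      exact ih _ hlt T2 ((Finset.filter_subset _ _).trans hT) rfl j (hT hjT)
    have h5 : ∑ j ∈ T1, p j ≤ 1 / 4 := by
      refine le_trans ?_ (hsum i hi)
      apply Finset.sum_le_sum_of_subset_of_nonneg
      · exact Finset.filter_subset_filter _ hT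
      · intro j hj _
        exact hp j (Finset.mem_filter.1 hj).1
    have h6 : ∑ j ∈ T1, 2 * p j * ((av T2).card : ℝ) = 2 * (∑ j ∈ T1, p j) * (av T2).card := by
      rw [Finset.mul_sum, Finset.sum_mul]
    have h7 : ((av T2).card : ℝ) ≤ 2 * (av T).card := by
      have : (0 : ℝ) ≤ (av T2).card := Nat.cast_nonneg _
      nlinarith
    have := hp i hi
    nlinarith
  have pos : ∀ T : Finset ι, T ⊆ I → 0 < (av T).card := by
    intro T
    induction T using Finset.induction_on with
    | empty =>
      intro _
      simp [av, Fintype.card_pos]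
    | insert i T hiT ih =>
      intro hT
      have hTI : T ⊆ I := (Finset.subset_insert _ _).trans hT
      have hi : i ∈ I := hT (Finset.mem_insert_self _ _)
      have h1 := key _ T hTI rfl i hi
      have h2 : p i ≤ 1 / 4 := by
        refine le_trans ?_ (hsum i hi)
        refine Finset.single_le_sum (f := p) (fun j hj => hp j (Finset.mem_filter.1 hj).1) ?_
        simp [hi, hS i hi]
      have h3 : ((av T).card : ℝ) ≤ (av (insert i T)).card + (B i ∩ av T).card := by
        have : av T ⊆ av (insert i T) ∪ (B i ∩ av T) := by
          intro ω h
          by_cases hω : ω ∈ B i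
          · exact Finset.mem_union_right _ (Finset.mem_inter.2 ⟨hω, h⟩)
          · apply Finset.mem_union_left
            simp only [av, Finset.mem_filter, Finset.mem_univ, true_and, Finset.mem_insert,
              forall_eq_or_imp] at h ⊢
            exact ⟨hω, h⟩
        exact_mod_cast (Finset.card_le_card this).trans (Finset.card_union_le _ _)
      have h4 : (0 : ℝ) < (av T).card := by exact_mod_cast ih hTI
      have h5 : (0 : ℝ) < (av (insert i T)).card := by nlinarith
      exact_mod_cast h5
  obtain ⟨ω, hω⟩ := Finset.card_pos.1 (pos I subset_rfl)
  exact ⟨ω, (Finset.mem_filter.1 hω).2⟩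

/-- greedy coloring with respect to an injective key -/
theorem greedy {V : Type*} [DecidableEq V] (E : Finset (Finset V)) (κ : V → ℕ)
    (hκ : Function.Injective κ) (s : ℕ) (T : Finset V) :
    ∃ c : V → ℕ, ∀ v ∈ T, c v ≤ s ∧
      (c v < s → ¬ ∃ A ∈ E, v ∈ A ∧ (∀ u ∈ A, κ u ≤ κ v) ∧ ∀ u ∈ A, u ≠ v → c u = c v) ∧
      (∀ i < c v, ∃ A ∈ E, v ∈ A ∧ (∀ u ∈ A, κ u ≤ κ v) ∧ ∀ u ∈ A, u ≠ v → c u = i) := by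
  classical
  induction T using Finset.induction_on_max_value κ with
  | empty => exact ⟨fun _ => 0, by simp⟩
  | insert a T haT hmax ih =>
    obtain ⟨c, hc⟩ := ih
    let Q : ℕ → Prop := fun i => ∃ A ∈ E, a ∈ A ∧ (∀ u ∈ A, κ u ≤ κ a) ∧ ∀ u ∈ A, u ≠ a → c u = i
    have hex : ∃ i, i = s ∨ ¬ Q i := ⟨s, Or.inl rfl⟩
    let k := Nat.find hex
    have hk : k ≤ s := Nat.find_min' hex (Or.inl rfl)
    have key : ∀ v, (v = a ∨ κ v < κ a) → ∀ i,
        ((∃ A ∈ E, v ∈ A ∧ (∀ u ∈ A, κ u ≤ κ v) ∧ ∀ u ∈ A, u ≠ v → Function.update c a k u = i) ↔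
        (∃ A ∈ E, v ∈ A ∧ (∀ u ∈ A, κ u ≤ κ v) ∧ ∀ u ∈ A, u ≠ v → c u = i)) := by
      intro v hv i
      refine exists_congr fun A => and_congr_right fun _ => and_congr_right fun _ =>
        and_congr_right fun hle => forall_congr' fun u => ⟨fun h hu hne => ?_, fun h hu hne => ?_⟩
      all_goals
        have hua : u ≠ a := by
          rintro rfl
          rcases hv with rfl | hv
          · exact hne rfl
          · exact absurd (hle u hu) (by omega)
        have := h hu hne
        simpa [Function.update_of_ne hua] using this
    refine ⟨Function.update c a k, fun v hv => ?_⟩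
    rcases Finset.mem_insert.1 hv with rfl | hvT
    · rw [key v (Or.inl rfl)]
      simp only [key v (Or.inl rfl), Function.update_self]
      refine ⟨hk, fun hlt => ?_, fun i hi => ?_⟩
      · rcases Nat.find_spec hex with h | h
        · exact absurd h (ne_of_lt hlt)
        · exact h
      · have := Nat.find_min hex hi
        push Not at this
        exact this.2
    · have hne : v ≠ a := fun h => haT (h ▸ hvT)
      have hlt : κ v < κ a := lt_of_le_of_ne (hmax v hvT) (fun h => hne (hκ h))
      rw [key v (Or.inr hlt)]
      simp only [key v (Or.inr hlt), Function.update_of_ne hne]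
      exact hc v hvT
end HC
namespace HC

theorem chain_extract {V : Type*} [DecidableEq V] (E : Finset (Finset V)) (κ : V → ℕ)
    (hE : ∀ A ∈ E, 2 ≤ A.card) (c : V → ℕ)
    (hc : ∀ v, ∀ i < c v, ∃ A ∈ E, v ∈ A ∧ (∀ u ∈ A, κ u ≤ κ v) ∧ ∀ u ∈ A, u ≠ v → c u = i)
    (hκ : Function.Injective κ) (m : ℕ) :
    ∀ A ∈ E, (∃ z ∈ A, (∀ u ∈ A, κ u ≤ κ z) ∧ ∀ u ∈ A, u ≠ z → c u = m) →
    ∃ (f : ℕ → Finset V) (v : ℕ → V), f m = A ∧ (∀ j ≤ m, f j ∈ E) ∧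
      ∀ j < m, v j ∈ f j ∧ v j ∈ f (j + 1) ∧ (∀ u ∈ f j, κ u ≤ κ (v j)) ∧
        ∀ u ∈ f (j + 1), κ (v j) ≤ κ u := by
  induction m with
  | zero =>
    rintro A hA ⟨z, -⟩
    exact ⟨fun _ => A, fun _ => z, rfl, fun _ _ => hA, by simp⟩
  | succ m ih =>
    rintro A hA ⟨z, hz, hmax, hcol⟩
    obtain ⟨w, hw, hwmin⟩ := Finset.exists_min_image A κ ⟨z, hz⟩
    have hwz : w ≠ z := by
      rintro rfl
      have : A ⊆ {w} := by
        intro u hu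
        exact Finset.mem_singleton.2 (hκ (le_antisymm (hmax u hu) (hwmin u hu)))
      have := Finset.card_le_card this
      have := hE A hA
      simp at *
      omega
    obtain ⟨A', hA', hwA', hmax', hcol'⟩ := hc w m (by rw [hcol w hw hwz]; omega)
    obtain ⟨f, v, hfm, hfE, hf⟩ := ih A' hA' ⟨w, hwA', hmax', hcol'⟩
    refine ⟨Function.update f (m + 1) A, Function.update v m w, by simp, ?_, ?_⟩
    · intro j hj
      rcases Nat.lt_or_ge j (m + 1) with h | h
      · rw [Function.update_of_ne (by omega)]; exact hfE j (by omega)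
      · have : j = m + 1 := by omega
        subst this; simpa using hA
    · intro j hj
      rw [Function.update_of_ne (show j ≠ m + 1 by omega)]
      rcases Nat.lt_or_ge j m with h | h
      · rw [Function.update_of_ne (show j + 1 ≠ m + 1 by omega),
          Function.update_of_ne (show j ≠ m by omega)]
        exact hf j h
      · have : j = m := by omega
        subst this
        rw [hfm]
        simp only [Function.update_self]
        exact ⟨hwA', hw, hmax', hwmin⟩

def Short {V : Type*} (L : ℕ) (A : Finset V) (ω : V → ℕ) : Prop :=
  ∃ v ∈ A, ∀ u ∈ A, ω v ≤ ω u ∧ ω u < ω v + L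

def BadChain {V : Type*} [DecidableEq V] (s L P : ℕ) (f : Fin (s + 1) → Finset V) (ω : V → ℕ) :
    Prop :=
  ∃ v : Fin s → V, (∀ j : Fin s, f j.castSucc ∩ f j.succ = {v j}) ∧
    (∀ j k : Fin (s + 1), j.val + 1 < k.val → Disjoint (f j) (f k)) ∧
    (∀ j : Fin s, (j.val + 1) * L ≤ ω (v j) ∧ ω (v j) < (j.val + 1) * L + P) ∧
    (∀ j : Fin s, ∀ u ∈ f j.castSucc, ω u ≤ ω (v j)) ∧
    (∀ j : Fin s, ∀ u ∈ f j.succ, ω (v j) ≤ ω u)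

theorem color_exists {V : Type*} [Fintype V] [DecidableEq V] (E : Finset (Finset V))
    (hE : ∀ A ∈ E, 2 ≤ A.card) (s L P : ℕ) (ω : V → ℕ)
    (hω : ∀ u, ω u < (s + 1) * L + P)
    (hshort : ∀ A ∈ E, ¬ Short L A ω)
    (hbad : ∀ f : Fin (s + 1) → Finset V, (∀ j, f j ∈ E) →
      (∀ j : Fin s, (f j.castSucc ∩ f j.succ).Nonempty) → ¬ BadChain s L P f ω) :
    ∃ c' : V → Fin (s + 1), ∀ A ∈ E, ¬ ∃ i : Fin (s + 1), ∀ v ∈ A, c' v = i := by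
  classical
  let N := Fintype.card V
  let idx : V → Fin N := Fintype.equivFin V
  let κ : V → ℕ := fun v => ω v * N + (idx v).val
  have hκω : ∀ u v, κ u ≤ κ v → ω u ≤ ω v := by
    intro u v h
    by_contra hlt
    push Not at hlt
    have h1 := (idx v).isLt
    have h2 : (ω v + 1) * N ≤ ω u * N := Nat.mul_le_mul_right _ hlt
    simp only [κ] at h
    rw [Nat.add_mul] at h2
    omega
  have hκ : Function.Injective κ := by
    intro u v h
    have h1 := le_antisymm (hκω u v h.le) (hκω v u h.ge)
    simp only [κ, h1] at h
    have : idx u = idx v := Fin.ext (by omega)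
    exact (Fintype.equivFin V).injective this
  obtain ⟨c, hc⟩ := greedy E κ hκ s Finset.univ
  refine ⟨fun v => ⟨c v, Nat.lt_succ_of_le (hc v (Finset.mem_univ _)).1⟩, ?_⟩
  rintro A hA ⟨i, hi⟩
  have hcol : ∀ v ∈ A, c v = i.val := fun v hv => congrArg Fin.val (hi v hv)
  have hAne : A.Nonempty := Finset.card_pos.1 (by have := hE A hA; omega)
  obtain ⟨z, hz, hzmax⟩ := Finset.exists_max_image A κ hAne
  have his : i.val = s := by
    by_contra hne
    refine (hc z (Finset.mem_univ _)).2.1 ?_ ⟨A, hA, hz, hzmax, fun u hu _ => ?_⟩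
    · rw [hcol z hz]; have := i.isLt; omega
    · rw [hcol u hu, hcol z hz]
  obtain ⟨f, v, hfs, hfE, hf⟩ := chain_extract E κ hE c
    (fun v => (hc v (Finset.mem_univ _)).2.2) hκ s A hA
    ⟨z, hz, hzmax, fun u hu _ => by rw [hcol u hu, his]⟩
  -- strict monotonicity of v
  have hstep : ∀ j, j + 1 < s → κ (v j) < κ (v (j + 1)) := by
    intro j hj
    have h1 := hf j (by omega)
    have h2 := hf (j + 1) hj
    refine lt_of_le_of_ne (h1.2.2.2 _ h2.1) ?_
    intro heq
    have : f (j + 1) ⊆ {v j} := by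
      intro u hu
      refine Finset.mem_singleton.2 (hκ (le_antisymm ?_ (h1.2.2.2 u hu)))
      rw [heq]; exact h2.2.2.1 u hu
    have := Finset.card_le_card this
    have := hE _ (hfE (j + 1) (by omega))
    simp at *
    omega
  have hmono : ∀ j d, j + d + 1 < s → κ (v j) < κ (v (j + d + 1)) := by
    intro j d
    induction d with
    | zero => exact hstep j
    | succ d ih =>
      intro h
      exact (ih (by omega)).trans (hstep (j + d + 1) (by omega))
  have hlong : ∀ j ≤ s, ∀ w ∈ f j, (∀ u ∈ f j, ω w ≤ ω u) → ∃ u ∈ f j, ω w + L ≤ ω u := by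
    intro j hj w hw hmin
    by_contra hcon
    push Not at hcon
    exact hshort _ (hfE j hj) ⟨w, hw, fun u hu => ⟨hmin u hu, hcon u hu⟩⟩
  have hlow : ∀ j < s, (j + 1) * L ≤ ω (v j) := by
    intro j
    induction j with
    | zero =>
      intro h0
      obtain ⟨w, hw, hwmin⟩ := Finset.exists_min_image (f 0) ω ⟨_, (hf 0 h0).1⟩
      obtain ⟨u, hu, hul⟩ := hlong 0 (by omega) w hw hwmin
      have := hκω _ _ ((hf 0 h0).2.2.1 u hu)
      omega
    | succ j ih =>
      intro h
      have h1 := ih (by omega)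
      have h2 := hf j (by omega)
      obtain ⟨u, hu, hul⟩ := hlong (j + 1) (by omega) (v j) h2.2.1
        (fun u hu => hκω _ _ (h2.2.2.2 u hu))
      have h3 := hκω _ _ ((hf (j + 1) h).2.2.1 u hu)
      rw [Nat.add_mul (j + 1) 1 L]
      omega
  have hhigh : ∀ d j, j + d + 1 = s → ω (v j) < (j + 1) * L + P := by
    intro d
    induction d with
    | zero =>
      intro j hj
      have h2 := hf j (by omega)
      obtain ⟨u, hu, hul⟩ := hlong (j + 1) (by omega) (v j) h2.2.1
        (fun u hu => hκω _ _ (h2.2.2.2 u hu))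
      have h3 := hω u
      rw [← hj, Nat.add_mul (j + 0 + 1) 1 L] at h3
      simp at h3
      omega
    | succ d ih =>
      intro j hj
      have h1 := ih (j + 1) (by omega)
      have h2 := hf j (by omega)
      obtain ⟨u, hu, hul⟩ := hlong (j + 1) (by omega) (v j) h2.2.1
        (fun u hu => hκω _ _ (h2.2.2.2 u hu))
      have h3 := hκω _ _ ((hf (j + 1) (by omega)).2.2.1 u hu)
      rw [Nat.add_mul (j + 1) 1 L] at h1
      omega
  have hinter : ∀ j < s, f j ∩ f (j + 1) = {v j} := by
    intro j hj
    have h := hf j hj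
    ext u
    simp only [Finset.mem_inter, Finset.mem_singleton]
    refine ⟨fun hu => hκ (le_antisymm (h.2.2.1 u hu.1) (h.2.2.2 u hu.2)), ?_⟩
    rintro rfl
    exact ⟨h.1, h.2.1⟩
  refine hbad (fun j => f j.val) (fun j => hfE _ (by have := j.isLt; omega)) ?_
    ⟨fun j => v j.val, ?_, ?_, ?_, ?_, ?_⟩
  · intro j
    simp [hinter j.val j.isLt]
  · intro j
    simpa using hinter j.val j.isLt
  · intro j k hjk
    rw [Finset.disjoint_left]
    intro u hu hu'
    have hk := k.isLt
    obtain ⟨d, hd⟩ : ∃ d, k.val = j.val + d + 1 + 1 := ⟨k.val - j.val - 2, by omega⟩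
    have h1 := (hf j.val (by omega)).2.2.1 u hu
    simp only at hu'
    rw [hd] at hu'
    have h2 := (hf (j.val + d + 1) (by omega)).2.2.2 u hu'
    have h3 := hmono j.val d (by omega)
    omega
  · intro j
    have := j.isLt
    exact ⟨hlow j.val j.isLt, hhigh (s - 1 - j.val) j.val (by omega)⟩
  · intro j u hu
    exact hκω _ _ ((hf j.val j.isLt).2.2.1 u (by simpa using hu))
  · intro j u hu
    exact hκω _ _ ((hf j.val j.isLt).2.2.2 u (by simpa using hu))

end HC
namespace HC

theorem pi_bound {V K : Type*} [Fintype V] [DecidableEq V] [Fintype K] [DecidableEq K]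
    (T : V → Finset K) (g : V → ℝ)
    (h : ∀ u, ((T u).card : ℝ) ≤ g u * Fintype.card K) :
    ((Fintype.piFinset T).card : ℝ) ≤ (∏ u, g u) * Fintype.card (V → K) := by
  rw [Fintype.card_piFinset, Fintype.card_fun, Nat.cast_prod, Nat.cast_pow,
    ← Finset.card_univ (α := V), ← Finset.prod_const, ← Finset.prod_mul_distrib]
  exact Finset.prod_le_prod (fun _ _ => Nat.cast_nonneg _) (fun u _ => h u)

theorem fin_interval_card {M : ℕ} (a b : ℕ) (T : Finset (Fin M))
    (h : ∀ y ∈ T, a ≤ y.val ∧ y.val < b) : T.card ≤ b - a := by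
  rw [← Nat.card_Ico]
  apply Finset.card_le_card_of_injOn (fun y => y.val)
  · intro y hy
    simpa using h y hy
  · intro x _ y _ hxy
    exact Fin.ext hxy

open Classical in
theorem short_bound {V : Type*} [Fintype V] [DecidableEq V] (M L : ℕ) (hM : 0 < M)
    (A : Finset V) (n : ℕ) (hA : A.card = n) :
    ((Finset.univ.filter (fun ω : V → Fin M => Short L A (fun u => (ω u).val))).card : ℝ) ≤
      (n * ((L : ℝ) / M) ^ (n - 1)) * Fintype.card (V → Fin M) := by
  have hM' : (0 : ℝ) < M := by exact_mod_cast hM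
  let T : V → Fin M → V → Finset (Fin M) := fun v x u =>
    if u = v then {x} else if u ∈ A then
      Finset.univ.filter (fun y : Fin M => x.val ≤ y.val ∧ y.val < x.val + L) else Finset.univ
  have hsub : (Finset.univ.filter (fun ω : V → Fin M => Short L A (fun u => (ω u).val))) ⊆
      A.biUnion (fun v => Finset.univ.biUnion (fun x => Fintype.piFinset (T v x))) := by
    intro ω hω
    obtain ⟨v, hv, h⟩ := (Finset.mem_filter.1 hω).2
    simp only [Finset.mem_biUnion, Fintype.mem_piFinset]
    refine ⟨v, hv, ω v, Finset.mem_univ _, fun u => ?_⟩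
    by_cases huv : u = v
    · simp [T, huv]
    · by_cases huA : u ∈ A
      · simpa [T, huv, huA] using h u huA
      · simp [T, huv, huA]
  have hone : ∀ v ∈ A, ∀ x : Fin M, ((Fintype.piFinset (T v x)).card : ℝ) ≤
      ((1 / M) * ((L : ℝ) / M) ^ (n - 1)) * Fintype.card (V → Fin M) := by
    intro v hv x
    have := pi_bound (T v x) (fun u => (if u = v then (1 / M : ℝ) else 1) *
      (if u ∈ A.erase v then (L / M : ℝ) else 1)) (by
        intro u
        by_cases huv : u = v
        · simp [T, huv, hM'.ne']
        · by_cases huA : u ∈ A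
          · simp only [T, huv, huA, if_true, if_false, Finset.mem_erase, ne_eq, not_false_eq_true,
              and_self, one_mul, Fintype.card_fin]
            rw [div_mul_cancel₀ _ hM'.ne']
            have := fin_interval_card x.val (x.val + L)
              (Finset.univ.filter (fun y : Fin M => x.val ≤ y.val ∧ y.val < x.val + L))
              (fun y hy => (Finset.mem_filter.1 hy).2)
            exact_mod_cast this.trans (by omega)
          · simp [T, huv, huA])
    rw [Finset.prod_mul_distrib, Finset.prod_ite_eq', Finset.prod_ite_mem] at this
    simpa [Finset.card_erase_of_mem hv, hA, div_pow] using this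
  have h1 := (Finset.card_le_card hsub).trans Finset.card_biUnion_le
  have h2 : (∑ v ∈ A, (Finset.univ.biUnion (fun x => Fintype.piFinset (T v x))).card : ℕ) ≤
      ∑ v ∈ A, ∑ x, (Fintype.piFinset (T v x)).card :=
    Finset.sum_le_sum fun v _ => Finset.card_biUnion_le
  have h3 : ((∑ v ∈ A, ∑ x, (Fintype.piFinset (T v x)).card : ℕ) : ℝ) ≤
      ∑ v ∈ A, ∑ x : Fin M, ((1 / M) * ((L : ℝ) / M) ^ (n - 1)) * Fintype.card (V → Fin M) := by
    push_cast
    exact Finset.sum_le_sum fun v hv => Finset.sum_le_sum fun x _ => by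
      simpa using hone v hv x
  refine (Nat.cast_le.2 (h1.trans h2)).trans (h3.trans (le_of_eq ?_))
  simp only [Finset.sum_const, Finset.card_univ, Fintype.card_fin, nsmul_eq_mul, hA]
  field_simp

theorem amgm (r : ℕ) (hr : 0 < r) (z : Fin r → ℝ) (hz : ∀ i, 0 ≤ z i) :
    ∏ i, z i ≤ ((∑ i, z i) / r) ^ r := by
  have hr' : (0 : ℝ) < r := by exact_mod_cast hr
  have h := Real.geom_mean_le_arith_mean_weighted Finset.univ (fun _ : Fin r => (1 / r : ℝ)) z
    (fun _ _ => by positivity) (by simp [hr'.ne']) (fun i _ => hz i)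
  have h2 := pow_le_pow_left₀ (Finset.prod_nonneg fun i _ => Real.rpow_nonneg (hz i) _) h r
  rw [← Finset.prod_pow] at h2
  have h3 : ∀ i, (z i ^ (1 / r : ℝ)) ^ r = z i := by
    intro i
    rw [← Real.rpow_natCast, ← Real.rpow_mul (hz i)]
    rw [one_div, inv_mul_cancel₀ hr'.ne', Real.rpow_one]
  simp only [h3] at h2
  rw [← Finset.mul_sum] at h2
  calc _ ≤ _ := h2
    _ = _ := by congr 1; ring

/-- boundaries of the intervals -/
def bnd {s M : ℕ} (x : Fin s → Fin M) (j : ℕ) : ℕ :=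
  if j = 0 then 0 else if h : j - 1 < s then (x ⟨j - 1, h⟩).val else M - 1

open Classical in
theorem chain_bound {V : Type*} [Fintype V] [DecidableEq V] (M L P s : ℕ) (hM : 0 < M)
    (f : Fin (s + 1) → Finset V) (n : ℕ) (hn0 : n ≠ 0)
    (hf : ∀ j, (f j).card = n) :
    ((Finset.univ.filter (fun ω : V → Fin M => BadChain s L P f (fun u => (ω u).val))).card : ℝ) ≤
      (((P : ℝ) / M) ^ s * ((((M : ℝ) + s) / ((s + 1 : ℕ) * M)) ^ (s + 1)) ^ (n - 2)) *
        Fintype.card (V → Fin M) := by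
  have hM' : (0 : ℝ) < M := by exact_mod_cast hM
  set Q := Finset.univ.filter (fun ω : V → Fin M => BadChain s L P f (fun u => (ω u).val)) with hQ
  rcases Q.eq_empty_or_nonempty with hemp | ⟨ω0, hω0⟩
  · rw [hemp]; simp only [Finset.card_empty, Nat.cast_zero]; positivity
  obtain ⟨v, hv1, hv2, -, -, -⟩ := (Finset.mem_filter.1 hω0).2
  have hvc : ∀ k : Fin s, v k ∈ f k.castSucc := fun k =>
    (Finset.mem_inter.1 (by rw [hv1 k]; simp : v k ∈ f k.castSucc ∩ f k.succ)).1
  have hvs : ∀ k : Fin s, v k ∈ f k.succ := fun k =>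
    (Finset.mem_inter.1 (by rw [hv1 k]; simp : v k ∈ f k.castSucc ∩ f k.succ)).2
  have hdis : ∀ j k u, u ∈ f j → u ∈ f k → j.val + 1 < k.val → False := fun j k u h1 h2 h3 =>
    Finset.disjoint_left.1 (hv2 j k h3) h1 h2
  have hvinj : Function.Injective v := by
    intro j k hjk
    by_contra hne
    rcases lt_or_gt_of_ne (fun h => hne (Fin.ext h) : j.val ≠ k.val) with h | h
    · exact hdis j.castSucc k.succ (v j) (hvc j) (hjk ▸ hvs k) (by simpa using h)
    · exact hdis k.castSucc j.succ (v j) (hjk ▸ hvc k) (hvs j) (by simpa using h)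
  set W : Finset V := Finset.univ.image v with hW
  have hWcard : W.card = s := by simp [hW, Finset.card_image_of_injective _ hvinj]
  have huniq : ∀ j k u, u ∉ W → u ∈ f j → u ∈ f k → j = k := by
    have aux : ∀ j k : Fin (s + 1), ∀ u, u ∉ W → u ∈ f j → u ∈ f k → j.val < k.val → False := by
      intro j k u hu hj hk hlt
      rcases Nat.lt_or_ge (j.val + 1) k.val with h | h
      · exact hdis j k u hj hk h
      · have hkk := k.isLt
        have hjs : j.val < s := by omega
        have e1 : j = (⟨j.val, hjs⟩ : Fin s).castSucc := by ext; simp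
        have e2 : k = (⟨j.val, hjs⟩ : Fin s).succ := by ext; simp; omega
        have : u ∈ f (⟨j.val, hjs⟩ : Fin s).castSucc ∩ f (⟨j.val, hjs⟩ : Fin s).succ := by
          rw [Finset.mem_inter, ← e1, ← e2]; exact ⟨hj, hk⟩
        rw [hv1, Finset.mem_singleton] at this
        exact hu (by rw [this, hW]; simp)
    intro j k u hu hj hk
    by_contra hne
    rcases lt_or_gt_of_ne (fun h => hne (Fin.ext h) : j.val ≠ k.val) with h | h
    · exact aux j k u hu hj hk h
    · exact aux k j u hu hk hj h
  have hfW : ∀ j, n - 2 ≤ (f j \ W).card := by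
    intro j
    have hsub : f j ∩ W ⊆ (Finset.univ.filter
        (fun k : Fin s => k.val = j.val ∨ k.val + 1 = j.val)).image v := by
      intro u hu
      obtain ⟨hu1, hu2⟩ := Finset.mem_inter.1 hu
      obtain ⟨k, -, rfl⟩ := Finset.mem_image.1 hu2
      refine Finset.mem_image_of_mem _ (Finset.mem_filter.2 ⟨Finset.mem_univ _, ?_⟩)
      by_contra hcon
      push Not at hcon
      rcases lt_or_gt_of_ne hcon.1 with h | h
      · refine hdis k.castSucc j (v k) (hvc k) hu1 ?_
        simp; omega
      · refine hdis j k.succ (v k) hu1 (hvs k) ?_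
        simp; omega
    have h2 : (Finset.univ.filter
        (fun k : Fin s => k.val = j.val ∨ k.val + 1 = j.val)).card ≤ 2 := by
      refine (fin_interval_card (j.val - 1) (j.val + 1) _ ?_).trans (by omega)
      intro y hy
      have := (Finset.mem_filter.1 hy).2
      omega
    have h3 := (Finset.card_le_card hsub).trans (Finset.card_image_le.trans h2)
    have h4 := Finset.card_sdiff_add_card_inter (f j) W
    rw [hf j] at h4
    omega
  let T : (Fin s → Fin M) → V → Finset (Fin M) := fun x u =>
    Finset.univ.filter (fun y : Fin M => (∀ k, u = v k → y = x k) ∧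
      ∀ j : Fin (s + 1), u ∈ f j → bnd x j.val ≤ y.val ∧ y.val ≤ bnd x (j.val + 1))
  let X : Finset (Fin s → Fin M) := Fintype.piFinset (fun j : Fin s =>
    Finset.univ.filter (fun y : Fin M => (j.val + 1) * L ≤ y.val ∧ y.val < (j.val + 1) * L + P))
  have hX : X.card ≤ P ^ s := by
    rw [Fintype.card_piFinset]
    refine (Finset.prod_le_prod' (g := fun _ => P) fun j _ => ?_).trans (by simp)
    refine (fin_interval_card ((j.val + 1) * L) ((j.val + 1) * L + P) _ ?_).trans (by omega)
    exact fun y hy => (Finset.mem_filter.1 hy).2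
  have hsub : Q ⊆ X.biUnion (fun x => Fintype.piFinset (T x)) := by
    intro ω hω
    obtain ⟨v', hv1', -, h3, h4, h5⟩ := (Finset.mem_filter.1 hω).2
    have hvv : v' = v := by
      funext j
      have := hv1' j
      rw [hv1 j] at this
      exact (Finset.singleton_injective this).symm
    subst hvv
    simp only [Finset.mem_biUnion, Fintype.mem_piFinset]
    refine ⟨fun j => ω (v' j), ?_, fun u => ?_⟩
    · simp only [X, Fintype.mem_piFinset, Finset.mem_filter, Finset.mem_univ, true_and]
      exact h3
    · simp only [T, Finset.mem_filter, Finset.mem_univ, true_and]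
      refine ⟨fun k hk => by rw [hk], fun j hj => ⟨?_, ?_⟩⟩
      · unfold bnd
        have hjl := j.isLt
        split_ifs with h0 h1
        · omega
        · have e : j = (⟨j.val - 1, h1⟩ : Fin s).succ := by ext; simp; omega
          exact h5 ⟨j.val - 1, h1⟩ u (e ▸ hj)
        · omega
      · unfold bnd
        have hjl := j.isLt
        have hωu := (ω u).isLt
        rw [if_neg (by omega)]
        split_ifs with h1
        · have e : j = (⟨j.val + 1 - 1, h1⟩ : Fin s).castSucc := by ext; simp
          exact h4 ⟨j.val + 1 - 1, h1⟩ u (e ▸ hj)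
        · omega
  have hone : ∀ x, ((Fintype.piFinset (T x)).card : ℝ) ≤
      ((1 / M) ^ s * ((((M : ℝ) + s) / ((s + 1 : ℕ) * M)) ^ (s + 1)) ^ (n - 2)) *
        Fintype.card (V → Fin M) := by
    intro x
    rcases (Fintype.piFinset (T x)).eq_empty_or_nonempty with hemp | ⟨ω, hω⟩
    · rw [hemp]; simp only [Finset.card_empty, Nat.cast_zero]; positivity
    rw [Fintype.mem_piFinset] at hω
    have hle : ∀ j : Fin (s + 1), bnd x j.val ≤ bnd x (j.val + 1) := by
      intro j
      have : (f j).Nonempty := Finset.card_pos.1 (by rw [hf j]; omega)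
      obtain ⟨u, hu⟩ := this
      have := (Finset.mem_filter.1 (hω u)).2.2 j hu
      omega
    have hbM : ∀ j, bnd x j ≤ M - 1 := by
      intro j
      unfold bnd
      split_ifs with h0 h1
      · omega
      · have := (x ⟨j - 1, h1⟩).isLt; omega
      · omega
    let ℓ : Fin (s + 1) → ℝ := fun j => (bnd x (j.val + 1) : ℝ) - bnd x j.val + 1
    have hℓ0 : ∀ j, 0 ≤ ℓ j := by
      intro j
      have : (bnd x j.val : ℝ) ≤ bnd x (j.val + 1) := by exact_mod_cast hle j
      simp only [ℓ]; linarith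
    have hℓM : ∀ j, ℓ j ≤ M := by
      intro j
      have h1 : bnd x (j.val + 1) + 1 ≤ M := by have := hbM (j.val + 1); omega
      have h2 : (bnd x (j.val + 1) : ℝ) + 1 ≤ M := by exact_mod_cast h1
      have h3 : (0 : ℝ) ≤ bnd x j.val := Nat.cast_nonneg _
      simp only [ℓ]; linarith
    have hℓsum : ∑ j, ℓ j = M + s := by
      simp only [ℓ]
      rw [Finset.sum_add_distrib, Fin.sum_univ_eq_sum_range
        (fun j => (bnd x (j + 1) : ℝ) - bnd x j) (s + 1),
        Finset.sum_range_sub (fun j => (bnd x j : ℝ))]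
      have e1 : bnd x (s + 1) = M - 1 := by simp [bnd]
      have e2 : bnd x 0 = 0 := by simp [bnd]
      rw [e1, e2, Nat.cast_sub hM]
      simp
    have hpb := pi_bound (T x) (fun u => (if u ∈ W then (1 / M : ℝ) else 1) *
      ∏ j, (if u ∈ f j \ W then ℓ j / M else 1)) (by
        intro u
        by_cases huW : u ∈ W
        · obtain ⟨k, -, rfl⟩ := Finset.mem_image.1 huW
          have : T x (v k) ⊆ {x k} := by
            intro y hy
            exact Finset.mem_singleton.2 ((Finset.mem_filter.1 hy).2.1 k rfl)
          have h1 := Finset.card_le_card this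
          simp only [Finset.card_singleton] at h1
          simp [huW, hM'.ne']
          exact_mod_cast h1
        · by_cases hex : ∃ j, u ∈ f j
          · obtain ⟨j, hj⟩ := hex
            rw [Finset.prod_eq_single j]
            · simp only [huW, if_false, one_mul, Finset.mem_sdiff, hj, not_false_eq_true,
                and_self, if_true, Fintype.card_fin]
              rw [div_mul_cancel₀ _ hM'.ne']
              have h1 := fin_interval_card (bnd x j.val) (bnd x (j.val + 1) + 1) (T x u) (by
                intro y hy
                have := (Finset.mem_filter.1 hy).2.2 j hj
                omega)
              have h2 := hle j
              have h3 : (T x u).card + bnd x j.val ≤ bnd x (j.val + 1) + 1 := by omega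
              have h4 : ((T x u).card : ℝ) + bnd x j.val ≤ bnd x (j.val + 1) + 1 := by
                exact_mod_cast h3
              simp only [ℓ]; linarith
            · intro k _ hkj
              have : u ∉ f k := fun hk => hkj (huniq k j u huW hk hj)
              simp [this]
            · simp
          · push Not at hex
            have : (T x u).card ≤ M := by simpa using Finset.card_le_univ (T x u)
            simpa [hex, huW] using this)
    refine hpb.trans (mul_le_mul_of_nonneg_right ?_ (Nat.cast_nonneg _))
    rw [Finset.prod_mul_distrib, Finset.prod_comm]
    simp only [Finset.prod_ite_mem, Finset.univ_inter, Finset.prod_const]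
    rw [hWcard]
    refine mul_le_mul_of_nonneg_left ?_ (by positivity)
    calc ∏ j, (ℓ j / M) ^ (f j \ W).card ≤ ∏ j, (ℓ j / M) ^ (n - 2) := by
          refine Finset.prod_le_prod (fun j _ => pow_nonneg (div_nonneg (hℓ0 j) hM'.le) _) ?_
          intro j _
          exact pow_le_pow_of_le_one (div_nonneg (hℓ0 j) hM'.le)
            ((div_le_one hM').2 (hℓM j)) (hfW j)
      _ = (∏ j, (ℓ j / M)) ^ (n - 2) := Finset.prod_pow _ _ _
      _ ≤ _ := by
          refine pow_le_pow_left₀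
            (Finset.prod_nonneg fun j _ => div_nonneg (hℓ0 j) hM'.le) ?_ _
          refine (amgm (s + 1) (by omega) _ fun j => div_nonneg (hℓ0 j) hM'.le).trans
            (le_of_eq ?_)
          rw [← Finset.sum_div, hℓsum, div_div, mul_comm (M : ℝ)]
  have h1 := (Finset.card_le_card hsub).trans Finset.card_biUnion_le
  calc (Q.card : ℝ) ≤ ∑ x ∈ X, ((Fintype.piFinset (T x)).card : ℝ) := by exact_mod_cast h1
    _ ≤ X.card • (((1 / M) ^ s * ((((M : ℝ) + s) / ((s + 1 : ℕ) * M)) ^ (s + 1)) ^ (n - 2)) *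
        (Fintype.card (V → Fin M) : ℝ)) := Finset.sum_le_card_nsmul _ _ _ fun x _ => hone x
    _ ≤ ((P : ℝ) ^ s) * (((1 / M) ^ s * ((((M : ℝ) + s) / ((s + 1 : ℕ) * M)) ^ (s + 1)) ^ (n - 2)) *
        (Fintype.card (V → Fin M) : ℝ)) := by
      rw [nsmul_eq_mul]
      refine mul_le_mul_of_nonneg_right ?_ (by positivity)
      exact_mod_cast hX
    _ = _ := by rw [div_pow, div_pow, one_pow]; ring

end HC
namespace HC

theorem exists_code {α : Type*} [DecidableEq α] (t : Finset α) (Δ : ℕ) (h : t.card ≤ Δ) :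
    ∃ g : α → ℕ, Set.InjOn g t ∧ ∀ a ∈ t, g a < Δ := by
  refine ⟨fun a => if h : a ∈ t then (t.equivFin ⟨a, h⟩).val else 0, ?_, ?_⟩
  · intro a ha b hb hab
    have ha' : a ∈ t := ha
    have hb' : b ∈ t := hb
    simp only [ha', hb', dif_pos] at hab
    have := t.equivFin.injective (Fin.ext hab)
    exact congrArg Subtype.val this
  · intro a ha
    simp only [ha, dif_pos]
    exact lt_of_lt_of_le (Fin.isLt _) h

open Classical in
theorem chain_count {V : Type*} [Fintype V] [DecidableEq V] (E : Finset (Finset V)) (Δ s : ℕ)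
    (hΔ : ∀ B ∈ E, (E.filter fun C => (B ∩ C).Nonempty).card ≤ Δ) (B : Finset V) (hB : B ∈ E) :
    ((Finset.univ : Finset (Fin (s + 1) → Finset V)).filter (fun f => (∀ j, f j ∈ E) ∧
      (∀ j : Fin s, (f j.castSucc ∩ f j.succ).Nonempty) ∧ ∃ j, (B ∩ f j).Nonempty)).card ≤
      (s + 1) * Δ ^ (s + 1) := by
  have hcode : ∀ B : Finset V, ∃ g : Finset V → ℕ, B ∈ E →
      Set.InjOn g (E.filter fun C => (B ∩ C).Nonempty) ∧
        ∀ a ∈ (E.filter fun C => (B ∩ C).Nonempty), g a < Δ := by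
    intro B
    by_cases h : B ∈ E
    · obtain ⟨g, hg⟩ := exists_code _ Δ (hΔ B h)
      exact ⟨g, fun _ => hg⟩
    · exact ⟨fun _ => 0, fun h' => absurd h' h⟩
  choose code hcode using hcode
  have hfix : ∀ i : Fin (s + 1),
      ((Finset.univ : Finset (Fin (s + 1) → Finset V)).filter (fun f => (∀ j, f j ∈ E) ∧
      (∀ j : Fin s, (f j.castSucc ∩ f j.succ).Nonempty) ∧ (B ∩ f i).Nonempty)).card ≤
      Δ ^ (s + 1) := by
    intro i
    have htgt : (Fintype.piFinset (fun _ : Fin (s + 1) => Finset.range Δ)).card = Δ ^ (s + 1) := by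
      simp
    rw [← htgt]
    let pr : Fin (s + 1) → Fin (s + 1) := fun j => ⟨j.val - 1, by omega⟩
    let nx : Fin (s + 1) → Fin (s + 1) := fun j => ⟨min (j.val + 1) s, by omega⟩
    let par : (Fin (s + 1) → Finset V) → Fin (s + 1) → Finset V := fun f j =>
      if j.val = i.val then B else if i.val < j.val then f (pr j) else f (nx j)
    have hadj : ∀ f : Fin (s + 1) → Finset V,
        (∀ j : Fin s, (f j.castSucc ∩ f j.succ).Nonempty) →
        ∀ a b : Fin (s + 1), a.val + 1 = b.val → (f a ∩ f b).Nonempty := by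
      intro f hf a b hab
      have hb := b.isLt
      have := hf ⟨a.val, by omega⟩
      have e1 : (⟨a.val, by omega⟩ : Fin s).castSucc = a := by ext; simp
      have e2 : (⟨a.val, by omega⟩ : Fin s).succ = b := by ext; simp; omega
      rwa [e1, e2] at this
    have hpar : ∀ f : Fin (s + 1) → Finset V, (∀ j, f j ∈ E) →
        (∀ j : Fin s, (f j.castSucc ∩ f j.succ).Nonempty) → (B ∩ f i).Nonempty →
        ∀ j, par f j ∈ E ∧ f j ∈ E.filter fun C => (par f j ∩ C).Nonempty := by
      intro f h1 h2 h3 j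
      have hjl := j.isLt
      have hil := i.isLt
      rw [Finset.mem_filter]
      simp only [par]
      split_ifs with ha hb
      · have : j = i := Fin.ext ha
        subst this
        exact ⟨hB, h1 _, h3⟩
      · exact ⟨h1 _, h1 _, hadj f h2 _ _ (by simp only [pr]; omega)⟩
      · refine ⟨h1 _, h1 _, ?_⟩
        rw [Finset.inter_comm]
        exact hadj f h2 _ _ (by simp only [nx]; omega)
    apply Finset.card_le_card_of_injOn (fun f j => code (par f j) (f j))
    · intro f hf
      obtain ⟨h1, h2, h3⟩ := (Finset.mem_filter.1 hf).2
      simp only [Finset.mem_coe, Fintype.mem_piFinset, Finset.mem_range]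
      intro j
      obtain ⟨h4, h5⟩ := hpar f h1 h2 h3 j
      exact (hcode _ h4).2 _ h5
    · intro f hf g hg hfg
      obtain ⟨f1, f2, f3⟩ := (Finset.mem_filter.1 hf).2
      obtain ⟨g1, g2, g3⟩ := (Finset.mem_filter.1 hg).2
      have hstep : ∀ j, par f j = par g j → f j = g j := by
        intro j hj
        obtain ⟨h4, h5⟩ := hpar f f1 f2 f3 j
        obtain ⟨h6, h7⟩ := hpar g g1 g2 g3 j
        have h8 := congrFun hfg j
        simp only at h8
        rw [← hj] at h7 h8
        exact (hcode _ h4).1 h5 h7 h8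
      have hup : ∀ d, ∀ j : Fin (s + 1), j.val = i.val + d → f j = g j := by
        intro d
        induction d with
        | zero =>
          intro j hj
          apply hstep
          simp only [par]
          rw [if_pos (by omega), if_pos (by omega)]
        | succ d ih =>
          intro j hj
          apply hstep
          simp only [par]
          have c1 : ¬ j.val = i.val := by omega
          have c2 : i.val < j.val := by omega
          simp only [c1, c2, if_false, if_true]
          exact ih _ (by simp only [pr]; omega)
      have hdown : ∀ d, ∀ j : Fin (s + 1), j.val + d = i.val → f j = g j := by
        intro d
        induction d with
        | zero =>
          intro j hj
          exact hup 0 j (by omega)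
        | succ d ih =>
          intro j hj
          apply hstep
          simp only [par]
          have c1 : ¬ j.val = i.val := by omega
          have c2 : ¬ i.val < j.val := by omega
          simp only [c1, c2, if_false]
          exact ih _ (by have := i.isLt; simp only [nx]; omega)
      funext j
      rcases le_total i.val j.val with h | h
      · exact hup (j.val - i.val) j (by omega)
      · exact hdown (i.val - j.val) j (by omega)
  have hsub : ((Finset.univ : Finset (Fin (s + 1) → Finset V)).filter (fun f => (∀ j, f j ∈ E) ∧
      (∀ j : Fin s, (f j.castSucc ∩ f j.succ).Nonempty) ∧ ∃ j, (B ∩ f j).Nonempty)) ⊆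
      Finset.univ.biUnion (fun i => (Finset.univ : Finset (Fin (s + 1) → Finset V)).filter
        (fun f => (∀ j, f j ∈ E) ∧
      (∀ j : Fin s, (f j.castSucc ∩ f j.succ).Nonempty) ∧ (B ∩ f i).Nonempty)) := by
    intro f hf
    obtain ⟨h1, h2, j, h3⟩ := (Finset.mem_filter.1 hf).2
    simp only [Finset.mem_biUnion, Finset.mem_filter, Finset.mem_univ, true_and]
    exact ⟨j, h1, h2, h3⟩
  refine (Finset.card_le_card hsub).trans (Finset.card_biUnion_le.trans ?_)
  refine (Finset.sum_le_card_nsmul _ _ _ fun i _ => hfix i).trans ?_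
  simp

open Classical in
theorem comb {V : Type*} [Fintype V] [DecidableEq V] (E : Finset (Finset V)) (n s L P M Δ : ℕ)
    (hn : 2 ≤ n) (hE : ∀ A ∈ E, A.card = n) (hM0 : 0 < M) (hM : M = (s + 1) * L + P)
    (hΔ : ∀ B ∈ E, (E.filter fun C => (B ∩ C).Nonempty).card ≤ Δ)
    (hnum : ((s + 1 : ℕ) : ℝ) * (Δ * (n * ((L : ℝ) / M) ^ (n - 1)) +
      ((s + 1 : ℕ) : ℝ) * (Δ : ℝ) ^ (s + 1) *
      (((P : ℝ) / M) ^ s * ((((M : ℝ) + s) / ((s + 1 : ℕ) * M)) ^ (s + 1)) ^ (n - 2))) ≤ 1 / 4) :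
    ∃ c' : V → Fin (s + 1), ∀ A ∈ E, ¬ ∃ i : Fin (s + 1), ∀ v ∈ A, c' v = i := by
  set p1 : ℝ := n * ((L : ℝ) / M) ^ (n - 1) with hp1
  set p2 : ℝ := ((P : ℝ) / M) ^ s * ((((M : ℝ) + s) / ((s + 1 : ℕ) * M)) ^ (s + 1)) ^ (n - 2)
    with hp2
  have hp1' : 0 ≤ p1 := by positivity
  have hp2' : 0 ≤ p2 := by positivity
  have : Nonempty (Fin M) := ⟨⟨0, hM0⟩⟩
  let Ch := (Finset.univ : Finset (Fin (s + 1) → Finset V)).filter (fun f => (∀ j, f j ∈ E) ∧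
      (∀ j : Fin s, (f j.castSucc ∩ f j.succ).Nonempty))
  have hCh : ∀ f ∈ Ch, (∀ j, f j ∈ E) ∧
      (∀ j : Fin s, (f j.castSucc ∩ f j.succ).Nonempty) := fun f hf => (Finset.mem_filter.1 hf).2
  let I : Finset (Finset V ⊕ (Fin (s + 1) → Finset V)) := E.disjSum Ch
  let B : Finset V ⊕ (Fin (s + 1) → Finset V) → Finset (V → Fin M) := Sum.elim
    (fun A => Finset.univ.filter (fun ω : V → Fin M => Short L A (fun u => (ω u).val)))
    (fun f => Finset.univ.filter (fun ω : V → Fin M => BadChain s L P f (fun u => (ω u).val)))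
  let S : Finset V ⊕ (Fin (s + 1) → Finset V) → Finset V := Sum.elim id
    (fun f => Finset.univ.biUnion f)
  let p : Finset V ⊕ (Fin (s + 1) → Finset V) → ℝ := Sum.elim (fun _ => p1) (fun _ => p2)
  have hp : ∀ i, 0 ≤ p i := by
    rintro (A | f)
    · exact hp1'
    · exact hp2'
  have hEne : ∀ A ∈ E, A.Nonempty := fun A hA => Finset.card_pos.1 (by rw [hE A hA]; omega)
  have hedge : ∀ A ∈ E, ∑ j ∈ I.filter (fun j => (A ∩ S j).Nonempty), p j ≤
      Δ * p1 + ((s + 1 : ℕ) : ℝ) * (Δ : ℝ) ^ (s + 1) * p2 := by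
    intro A hA
    rw [Finset.sum_filter, Finset.sum_disjSum, ← Finset.sum_filter, ← Finset.sum_filter]
    simp only [S, p, Sum.elim_inl, Sum.elim_inr, Finset.sum_const, nsmul_eq_mul, id]
    refine add_le_add (mul_le_mul_of_nonneg_right ?_ hp1') (mul_le_mul_of_nonneg_right ?_ hp2')
    · exact_mod_cast hΔ A hA
    · have h1 := chain_count E Δ s hΔ A hA
      have h2 : (Ch.filter (fun f => (A ∩ Finset.univ.biUnion f).Nonempty)).card ≤
          (s + 1) * Δ ^ (s + 1) := by
        refine (Finset.card_le_card ?_).trans h1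
        intro f hf
        obtain ⟨hf1, u, hu⟩ := Finset.mem_filter.1 hf
        obtain ⟨hu1, hu2⟩ := Finset.mem_inter.1 hu
        obtain ⟨j, -, hj⟩ := Finset.mem_biUnion.1 hu2
        exact Finset.mem_filter.2 ⟨Finset.mem_univ _, (hCh f hf1).1, (hCh f hf1).2, j, u,
          Finset.mem_inter.2 ⟨hu1, hj⟩⟩
      exact_mod_cast h2
  set q := Δ * p1 + ((s + 1 : ℕ) : ℝ) * (Δ : ℝ) ^ (s + 1) * p2 with hq
  have hq0 : 0 ≤ q := by positivity
  obtain ⟨ω, hω⟩ := lll I B S p (fun i _ => hp i) (by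
      rintro (A | f) hi ω ω' hag hω
      · obtain ⟨v, hv, h⟩ := (Finset.mem_filter.1 hω).2
        refine Finset.mem_filter.2 ⟨Finset.mem_univ _, v, hv, fun u hu => ?_⟩
        have := h u hu
        simp only [hag u hu, hag v hv] at this
        exact this
      · have hag' : ∀ j, ∀ u ∈ f j, ω u = ω' u := fun j u hu =>
          hag u (Finset.mem_biUnion.2 ⟨j, Finset.mem_univ _, hu⟩)
        obtain ⟨v, h1, h2, h3, h4, h5⟩ := (Finset.mem_filter.1 hω).2
        have hvc : ∀ k : Fin s, v k ∈ f k.castSucc := fun k =>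
          (Finset.mem_inter.1 (by rw [h1 k]; simp : v k ∈ f k.castSucc ∩ f k.succ)).1
        have hvω : ∀ k, ω (v k) = ω' (v k) := fun k => hag' _ _ (hvc k)
        refine Finset.mem_filter.2 ⟨Finset.mem_univ _, v, h1, h2, fun j => ?_, fun j u hu => ?_,
          fun j u hu => ?_⟩
        · have := h3 j; simp only [hvω] at this; exact this
        · have := h4 j u hu; simp only [hvω, hag' _ u hu] at this; exact this
        · have := h5 j u hu; simp only [hvω, hag' _ u hu] at this; exact this)
    (by
      rintro (A | f) hi
      · exact short_bound M L hM0 A n (hE A (by simpa [I] using hi))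
      · have hf : f ∈ Ch := by simpa [I] using hi
        exact chain_bound M L P s hM0 f n (by omega) (fun j => hE _ ((hCh f hf).1 j)))
    (by
      rintro (A | f) hi
      · exact hEne A (by simpa [I] using hi)
      · have hf : f ∈ Ch := by simpa [I] using hi
        obtain ⟨u, hu⟩ := hEne _ ((hCh f hf).1 0)
        exact ⟨u, Finset.mem_biUnion.2 ⟨0, Finset.mem_univ _, hu⟩⟩)
    (by
      rintro (A | f) hi
      · refine (hedge A (by simpa [I] using hi)).trans (le_trans ?_ hnum)
        have : (1 : ℝ) ≤ ((s + 1 : ℕ) : ℝ) := by exact_mod_cast Nat.le_add_left 1 s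
        nlinarith
      · have hf : f ∈ Ch := by simpa [I] using hi
        have h1 : ∑ j ∈ I.filter (fun j => (S (Sum.inr f) ∩ S j).Nonempty), p j ≤
            ∑ k, ∑ j ∈ I.filter (fun j => (f k ∩ S j).Nonempty), p j := by
          simp only [Finset.sum_filter]
          rw [Finset.sum_comm]
          refine Finset.sum_le_sum fun j _ => ?_
          split_ifs with h
          · obtain ⟨u, hu⟩ := h
            obtain ⟨hu1, hu2⟩ := Finset.mem_inter.1 hu
            obtain ⟨k, -, hk⟩ := Finset.mem_biUnion.1 hu1
            have h3 := Finset.single_le_sum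
              (f := fun k => if (f k ∩ S j).Nonempty then p j else 0)
              (fun k _ => by split_ifs; exacts [hp j, le_rfl]) (Finset.mem_univ k)
            rwa [if_pos ⟨u, Finset.mem_inter.2 ⟨hk, hu2⟩⟩] at h3
          · exact Finset.sum_nonneg fun k _ => by split_ifs; exacts [hp j, le_rfl]
        refine h1.trans ((Finset.sum_le_card_nsmul _ _ q fun k _ =>
          hedge _ ((hCh f hf).1 k)).trans (le_trans ?_ hnum))
        simp)
  refine color_exists E (fun A hA => by rw [hE A hA]; exact hn) s L P (fun u => (ω u).val)
    (fun u => by rw [← hM]; exact (ω u).isLt) ?_ ?_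
  · intro A hA h
    exact hω (Sum.inl A) (by simpa [I] using hA) (Finset.mem_filter.2 ⟨Finset.mem_univ _, h⟩)
  · intro f h1 h2 h
    exact hω (Sum.inr f) (by simpa [I, Ch] using ⟨h1, h2⟩)
      (Finset.mem_filter.2 ⟨Finset.mem_univ _, h⟩)

end HC
namespace HC

set_option maxHeartbeats 2000000 in
theorem numerics (s n : ℕ) (hs : 1 ≤ s) (hn : 624 * (s + 1) ^ 2 ≤ n) :
    ∃ k : ℕ, ∀ (Δ L P M : ℕ), L = (s + 1) * n → P = (s + 1) ^ 2 * k → M = (s + 1) * L + P →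
    (Δ : ℝ) ≤ 1 / (624 * ((s + 1 : ℕ) : ℝ) ^ 2) *
      ((n : ℝ) / Real.log n) ^ ((((s + 1 : ℕ) : ℝ) - 1) / ((s + 1 : ℕ) : ℝ)) *
        ((s + 1 : ℕ) : ℝ) ^ (n - 1) + 1 →
    ((s + 1 : ℕ) : ℝ) * (Δ * (n * ((L : ℝ) / M) ^ (n - 1)) +
      ((s + 1 : ℕ) : ℝ) * (Δ : ℝ) ^ (s + 1) *
      (((P : ℝ) / M) ^ s * ((((M : ℝ) + s) / ((s + 1 : ℕ) * M)) ^ (s + 1)) ^ (n - 2))) ≤ 1 / 4 := by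
  set r : ℝ := ((s + 1 : ℕ) : ℝ) with hr
  have hrs : r = s + 1 := by rw [hr]; push_cast; ring
  have hs' : (1 : ℝ) ≤ s := by exact_mod_cast hs
  have hr2 : 2 ≤ r := by linarith
  have hr0 : 0 < r := by linarith
  have hnr : 624 * r ^ 2 ≤ n := by rw [hr]; exact_mod_cast hn
  have hn1000 : (2496 : ℝ) ≤ n := by nlinarith
  have hn0 : (0 : ℝ) < n := by linarith
  have hnn : 2496 ≤ n := by exact_mod_cast hn1000
  set l := Real.log n with hl
  have hl1 : 1 ≤ l := by
    rw [hl, Real.le_log_iff_exp_le hn0]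
    have := Real.exp_one_lt_d9
    linarith
  have hlsq : 13 * l ≤ n := by
    have h1 : Real.log (Real.sqrt n) ≤ Real.sqrt n - 1 :=
      Real.log_le_sub_one_of_pos (Real.sqrt_pos.2 hn0)
    rw [Real.log_sqrt hn0.le] at h1
    have h2 : Real.sqrt n * Real.sqrt n = n := Real.mul_self_sqrt hn0.le
    have h3 : 26 ≤ Real.sqrt n := Real.le_sqrt_of_sq_le (by linarith)
    nlinarith
  set k := ⌈12 * l⌉₊ with hk
  have hk1 : 12 * l ≤ k := Nat.le_ceil _
  have hk2 : (k : ℝ) ≤ 13 * l := by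
    have := Nat.ceil_lt_add_one (show 0 ≤ 12 * l by linarith)
    rw [← hk] at this
    linarith
  have hkn : (k : ℝ) ≤ n := hk2.trans hlsq
  have hk0 : (0 : ℝ) < k := by linarith
  refine ⟨k, ?_⟩
  rintro Δ L P M hL hP hM hΔ
  have hM' : (M : ℝ) = r ^ 2 * (n + k) := by
    rw [hM, hL, hP]; push_cast; rw [hrs]; ring
  have hL' : (L : ℝ) = r * n := by rw [hL]; push_cast; rw [hrs]
  have hP' : (P : ℝ) = r ^ 2 * k := by rw [hP]; push_cast; rw [hrs]
  have hnk : (0 : ℝ) < n + k := by linarith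
  have hLM : (L : ℝ) / M = (n / (n + k)) / r := by
    rw [hL', hM']; field_simp
  have hPM : (P : ℝ) / M = k / (n + k) := by
    rw [hP', hM']; field_simp
  set X : ℝ := ((n : ℝ) / l) ^ ((r - 1) / r) with hX
  have hnl : 1 ≤ (n : ℝ) / l := by rw [le_div_iff₀ (by linarith)]; linarith
  have hX1 : 1 ≤ X := Real.one_le_rpow hnl (div_nonneg (by linarith) hr0.le)
  have hXn : X ≤ n := by
    have h1 : X ≤ ((n : ℝ) / l) ^ (1 : ℝ) :=
      Real.rpow_le_rpow_of_exponent_le hnl (by rw [div_le_one hr0]; linarith)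
    rw [Real.rpow_one] at h1
    exact h1.trans (div_le_self hn0.le hl1)
  have hXr : X ^ (s + 1) = ((n : ℝ) / l) ^ s := by
    rw [hX, ← Real.rpow_natCast, ← Real.rpow_mul (by linarith), ← hr, div_mul_cancel₀ _ hr0.ne',
      hrs, add_sub_cancel_right, Real.rpow_natCast]
  set R : ℝ := r ^ (n - 1) with hR
  have hR0 : 0 < R := by positivity
  have hRn : (n : ℝ) ≤ R := by
    have h1 : n ≤ 2 ^ (n - 1) := by
      have := Nat.lt_two_pow_self (n := n - 1)
      omega
    have h2 : (n : ℝ) ≤ 2 ^ (n - 1) := by exact_mod_cast h1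
    exact h2.trans (pow_le_pow_left₀ (by norm_num) hr2 _)
  have hΔ2 : (Δ : ℝ) ≤ 1 / (312 * r ^ 2) * X * R := by
    have h1 : 1 ≤ 1 / (624 * r ^ 2) * X * R := by
      have : 624 * r ^ 2 ≤ X * R := by nlinarith
      rw [mul_assoc, one_div, inv_mul_eq_div, le_div_iff₀ (by positivity)]
      linarith
    have h2 : 1 / (312 * r ^ 2) * X * R = 2 * (1 / (624 * r ^ 2) * X * R) := by
      field_simp; norm_num
    linarith
  -- first part
  have hA : (Δ : ℝ) * (n * ((L : ℝ) / M) ^ (n - 1)) ≤ 1 / (312 * r ^ 2) := by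
    rw [hLM, div_pow, ← hR]
    have h1 : ((n : ℝ) / (n + k)) ^ (n - 1) ≤ 1 / (n : ℝ) ^ 3 := by
      have h2 : (n : ℝ) / (n + k) ≤ Real.exp (-(k / (n + k))) := by
        have := Real.one_sub_le_exp_neg ((k : ℝ) / (n + k))
        have e : (n : ℝ) / (n + k) = 1 - k / (n + k) := by field_simp; ring
        rw [e]; exact this
      have h3 := pow_le_pow_left₀ (by positivity) h2 (n - 1)
      rw [← Real.exp_nat_mul] at h3
      refine h3.trans ?_
      have h4 : 1 / (n : ℝ) ^ 3 = Real.exp (-(3 * l)) := by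
        rw [Real.exp_neg, one_div, hl]
        congr 1
        rw [show (3 : ℝ) * Real.log n = ((3 : ℕ) : ℝ) * Real.log n by norm_num,
          Real.exp_nat_mul, Real.exp_log hn0]
      rw [h4, Real.exp_le_exp, Nat.cast_sub (by omega)]
      have h5 : (1 : ℝ) / 4 ≤ ((n : ℝ) - 1) / (n + k) := by
        rw [div_le_div_iff₀ (by norm_num) hnk]; linarith
      have h6 : ((n : ℝ) - (1 : ℕ)) * -(k / (n + k)) = - (k * (((n : ℝ) - 1) / (n + k))) := by
        push_cast; ring
      rw [h6]
      nlinarith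
    calc (Δ : ℝ) * (n * (((n : ℝ) / (n + k)) ^ (n - 1) / R))
        ≤ (1 / (312 * r ^ 2) * X * R) * (n * ((1 / (n : ℝ) ^ 3) / R)) := by gcongr
      _ = 1 / (312 * r ^ 2) * (X / n ^ 2) := by field_simp
      _ ≤ 1 / (312 * r ^ 2) * 1 := by
          gcongr
          rw [div_le_one (by positivity)]
          nlinarith
      _ = _ := by ring
  -- second part
  have hB : (Δ : ℝ) ^ (s + 1) *
      (((P : ℝ) / M) ^ s * ((((M : ℝ) + s) / (r * M)) ^ (s + 1)) ^ (n - 2)) ≤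
      3 / (576 * r ^ 2) := by
    have hM0 : (0 : ℝ) < M := by rw [hM']; positivity
    have h1 : (P : ℝ) / M ≤ 13 * (l / n) := by
      rw [hPM]
      calc (k : ℝ) / (n + k) ≤ (13 * l) / n := by
            apply div_le_div₀ (by linarith) hk2 hn0 (by linarith)
        _ = _ := by ring
    have h2 : ((((M : ℝ) + s) / (r * M)) ^ (s + 1)) ^ (n - 2) ≤
        3 * (r ^ (s + 1) / R ^ (s + 1)) := by
      have e1 : ((M : ℝ) + s) / (r * M) = (1 + s / M) / r := by field_simp
      have h3 : (1 + (s : ℝ) / M) ^ ((s + 1) * (n - 2)) ≤ 3 := by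
        have h4 : 1 + (s : ℝ) / M ≤ Real.exp (s / M) := by
          have := Real.add_one_le_exp ((s : ℝ) / M); linarith
        have h5 := pow_le_pow_left₀ (by positivity) h4 ((s + 1) * (n - 2))
        rw [← Real.exp_nat_mul] at h5
        have h6 : (((s + 1) * (n - 2) : ℕ) : ℝ) * (s / M) ≤ 1 := by
          have h7 : (((s + 1) * (n - 2) : ℕ) : ℝ) ≤ r * n := by
            rw [Nat.cast_mul, ← hr]
            gcongr
            omega
          calc _ ≤ (r * n) * (s / M) := by gcongr
            _ = (r * n * s) / M := by ring
            _ ≤ 1 := by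
              rw [div_le_one hM0, hM']
              have : (s : ℝ) ≤ r := by linarith
              calc r * n * s ≤ r * (n + k) * r := by gcongr; linarith
                _ = _ := by ring
        have h8 := Real.exp_le_exp.2 h6
        have := Real.exp_one_lt_d9
        linarith
      have e2 : R = r ^ (n - 2) * r := by
        rw [hR, ← pow_succ]; congr 1; omega
      rw [e1, ← pow_mul, div_pow]
      calc _ ≤ 3 / r ^ ((s + 1) * (n - 2)) := by gcongr
        _ = _ := by
          rw [e2, mul_pow, ← pow_mul, mul_comm (n - 2) (s + 1)]
          field_simp
    have hl0 : (0 : ℝ) < l := by linarith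
    calc _ ≤ (1 / (312 * r ^ 2) * X * R) ^ (s + 1) *
          ((13 * (l / n)) ^ s * (3 * (r ^ (s + 1) / R ^ (s + 1)))) := by gcongr
      _ = 3 * (1 / (312 * r)) ^ (s + 1) * 13 ^ s := by
          rw [mul_pow, mul_pow, hXr]
          simp only [mul_pow, div_pow, one_pow, pow_succ]
          field_simp
          simp
      _ ≤ 3 * (1 / (312 * r)) ^ (s + 1) * 13 ^ (s + 1) := by
          gcongr
          · norm_num
          · omega
      _ = 3 * (1 / (24 * r)) ^ (s + 1) := by
          rw [mul_assoc, ← mul_pow]; congr 2; field_simp; norm_num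
      _ ≤ 3 * (1 / (24 * r)) ^ 2 := by
          refine mul_le_mul_of_nonneg_left ?_ (by norm_num)
          refine pow_le_pow_of_le_one (by positivity) ?_ (by omega)
          rw [div_le_one (by positivity)]; linarith
      _ = _ := by field_simp; norm_num
  calc _ = r * ((Δ : ℝ) * (n * ((L : ℝ) / M) ^ (n - 1))) + r ^ 2 * ((Δ : ℝ) ^ (s + 1) *
      (((P : ℝ) / M) ^ s * ((((M : ℝ) + s) / (r * M)) ^ (s + 1)) ^ (n - 2))) := by ring
    _ ≤ r * (1 / (312 * r ^ 2)) + r ^ 2 * (3 / (576 * r ^ 2)) := by gcongr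
    _ = 1 / (312 * r) + 3 / 576 := by field_simp
    _ ≤ 1 / 312 + 3 / 576 := by
      gcongr
      linarith
    _ ≤ 1 / 4 := by norm_num

end HC

/-- Theorem 3 (fixed `r`): there are `c > 0` and `n₀` such that for all `n ≥ n₀`, every
`n`-uniform hypergraph whose maximum edge degree is less than
`c · (n / ln n)^{(r−1)/r} · r^{n−1}` admits a proper coloring in `r` colors
(no monochromatic edge), i.e. its chromatic number is at most `r`. -/
theorem stmt_3 (r : ℕ) (hr : 2 ≤ r) :
    ∃ c : ℝ, 0 < c ∧ ∃ n₀ : ℕ, ∀ n ≥ n₀,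
      ∀ (V : Type) [Fintype V] [DecidableEq V] (E : Finset (Finset V)),
        (∀ A ∈ E, A.card = n) →
        (∀ A ∈ E, ((E.filter fun B => B ≠ A ∧ (A ∩ B).Nonempty).card : ℝ) <
          c * ((n : ℝ) / Real.log n) ^ (((r : ℝ) - 1) / r) * (r : ℝ) ^ (n - 1)) →
        ∃ c' : V → Fin r, ∀ A ∈ E, ¬ ∃ i : Fin r, ∀ v ∈ A, c' v = i := by
  obtain ⟨s, rfl⟩ : ∃ s, r = s + 1 := ⟨r - 1, by omega⟩
  refine ⟨1 / (624 * ((s + 1 : ℕ) : ℝ) ^ 2), by positivity, 624 * (s + 1) ^ 2, ?_⟩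
  intro n hn V _ _ E hE hdeg
  obtain ⟨k, hk⟩ := HC.numerics s n (by omega) hn
  set Y : ℝ := 1 / (624 * ((s + 1 : ℕ) : ℝ) ^ 2) *
      ((n : ℝ) / Real.log n) ^ ((((s + 1 : ℕ) : ℝ) - 1) / ((s + 1 : ℕ) : ℝ)) *
        ((s + 1 : ℕ) : ℝ) ^ (n - 1) with hY
  have hn2 : 2 ≤ n := by nlinarith
  have hY0 : 0 ≤ Y := by
    have : 0 ≤ Real.log n := Real.log_natCast_nonneg n
    positivity
  refine HC.comb E n s ((s + 1) * n) ((s + 1) ^ 2 * k) ((s + 1) * ((s + 1) * n) + (s + 1) ^ 2 * k)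
    (⌊Y⌋₊ + 1) hn2 hE (by positivity) rfl ?_ ?_
  · intro A hA
    have h1 : (E.filter fun B => B ≠ A ∧ (A ∩ B).Nonempty).card ≤ ⌊Y⌋₊ :=
      Nat.le_floor (hdeg A hA).le
    have h2 : (E.filter fun C => (A ∩ C).Nonempty) ⊆
        insert A (E.filter fun B => B ≠ A ∧ (A ∩ B).Nonempty) := by
      intro C hC
      obtain ⟨h3, h4⟩ := Finset.mem_filter.1 hC
      by_cases h : C = A
      · exact Finset.mem_insert.2 (Or.inl h)
      · exact Finset.mem_insert_of_mem (Finset.mem_filter.2 ⟨h3, h, h4⟩)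
    exact ((Finset.card_le_card h2).trans (Finset.card_insert_le _ _)).trans
      (Nat.succ_le_succ h1)
  · refine hk _ _ _ _ rfl rfl rfl ?_
    push_cast
    have := Nat.floor_le hY0
    linarith
end
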